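/- Let K belong to the class R and let t be the distinguished singular vertex of K (the singular vertex whose link has maximal first Z₂-Betti number, chosen with d(t) ≥ 8). If u is a vertex of K not in st(t,K), then the weight of u satisfies W_u = Σ_{v ∈ lk(u,K)} λ(u,v) ≥ 4. -/

import Mathlib

/-- An abstract simplicial complex on vertex set `ℕ`: a finite, downward closed
collection of nonempty finite sets of vertices. -/
structure SComplex where
  faces : Finset (Finset ℕ)
  not_empty_mem : ∅ ∉ faces
  down_closed : ∀ s ∈ faces, ∀ t ⊆ s, t ≠ ∅ → t ∈ faces

namespace SComplex

/-- The set of vertices of the complex. -/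
def vertexSet (K : SComplex) : Finset ℕ := K.faces.sup id

/-- `fnum K i` is the number of `i`-dimensional faces of `K`. -/
def fnum (K : SComplex) (i : ℕ) : ℕ := (K.faces.filter fun s => s.card = i + 1).card

/-- `g₂` for a 3-dimensional complex: `f₁ - 4 f₀ + 10`. -/
def g2 (K : SComplex) : ℤ := (K.fnum 1 : ℤ) - 4 * (K.fnum 0 : ℤ) + 10

/-- `g₂` for a 2-dimensional complex: `f₁ - 3 f₀ + 6`. -/
def g2surf (K : SComplex) : ℤ := (K.fnum 1 : ℤ) - 3 * (K.fnum 0 : ℤ) + 6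

/-- Euler characteristic of a (2-dimensional) complex. -/
def euler (K : SComplex) : ℤ := (K.fnum 0 : ℤ) - (K.fnum 1 : ℤ) + (K.fnum 2 : ℤ)

/-- The link of a face `σ`. -/
def lk (K : SComplex) (σ : Finset ℕ) : SComplex where
  faces := K.faces.filter fun γ => γ ∩ σ = ∅ ∧ γ ∪ σ ∈ K.faces
  not_empty_mem := fun h => K.not_empty_mem (Finset.mem_filter.mp h).1
  down_closed := by
    intro s hs t hts ht
    rw [Finset.mem_filter] at hs ⊢
    refine ⟨K.down_closed s hs.1 t hts ht, ?_, ?_⟩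
    · have h1 : t ∩ σ ⊆ s ∩ σ := Finset.inter_subset_inter hts (Finset.Subset.refl σ)
      rw [hs.2.1] at h1
      exact Finset.subset_empty.mp h1
    · refine K.down_closed (s ∪ σ) hs.2.2 (t ∪ σ)
        (Finset.union_subset_union hts (Finset.Subset.refl σ)) ?_
      intro hc
      exact ht (Finset.union_eq_empty.mp hc).1

/-- The (closed) star of a face `σ`. -/
def st (K : SComplex) (σ : Finset ℕ) : SComplex where
  faces := K.faces.filter fun α => α ∪ σ ∈ K.faces
  not_empty_mem := fun h => K.not_empty_mem (Finset.mem_filter.mp h).1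
  down_closed := by
    intro s hs t hts ht
    rw [Finset.mem_filter] at hs ⊢
    refine ⟨K.down_closed s hs.1 t hts ht, ?_⟩
    refine K.down_closed (s ∪ σ) hs.2 (t ∪ σ)
      (Finset.union_subset_union hts (Finset.Subset.refl σ)) ?_
    intro hc
    exact ht (Finset.union_eq_empty.mp hc).1

/-- A facet is a maximal face. -/
def IsFacet (K : SComplex) (s : Finset ℕ) : Prop :=
  s ∈ K.faces ∧ ∀ t ∈ K.faces, s ⊆ t → s = t

/-- A pure `d`-dimensional complex: all facets have `d+1` vertices. -/
def IsPure (K : SComplex) (d : ℕ) : Prop :=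
  K.faces.Nonempty ∧ ∀ s, K.IsFacet s → s.card = d + 1

/-- Two facets are adjacent if they share a codimension-one face. -/
def FacetAdj (K : SComplex) (s t : Finset ℕ) : Prop :=
  K.IsFacet s ∧ K.IsFacet t ∧ (s ∩ t).card + 1 = s.card

/-- Strong connectedness: any two facets are joined by a chain of facets, consecutive
ones sharing a codimension-one face. -/
def StronglyConnected (K : SComplex) : Prop :=
  ∀ s t, K.IsFacet s → K.IsFacet t → Relation.ReflTransGen K.FacetAdj s t

/-- Two vertices are adjacent if they span an edge. -/
def VertAdj (K : SComplex) (u v : ℕ) : Prop := ({u, v} : Finset ℕ) ∈ K.faces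

/-- Connectedness of a complex (via its 1-skeleton). -/
def Conn (K : SComplex) : Prop :=
  K.faces.Nonempty ∧
    ∀ u v, {u} ∈ K.faces → {v} ∈ K.faces → Relation.ReflTransGen K.VertAdj u v

/-- A normal `d`-pseudomanifold: pure, strongly connected, every `(d-1)`-face is in
exactly two facets, and links of faces of dimension at most `d-2` are connected. -/
def IsNormalPseudomanifold (K : SComplex) (d : ℕ) : Prop :=
  K.IsPure d ∧ K.StronglyConnected ∧
    (∀ s ∈ K.faces, s.card = d →
      (K.faces.filter fun F => F.card = d + 1 ∧ s ⊆ F).card = 2) ∧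
    (∀ s ∈ K.faces, s.card ≤ d - 1 → (K.lk s).Conn)

/-- The geometric realization `|K|`, as a subspace of `ℕ → ℝ`. -/
def realSpace (K : SComplex) : Set (ℕ → ℝ) :=
  {w | (∀ v, 0 ≤ w v) ∧ ∃ s ∈ K.faces, (∀ v, w v ≠ 0 → v ∈ s) ∧ ∑ v ∈ s, w v = 1}

/-- The link of the vertex `v` triangulates the `(d-1)`-sphere. -/
def HasSphereLink (K : SComplex) (d : ℕ) (v : ℕ) : Prop :=
  Nonempty (↥((K.lk {v}).realSpace) ≃ₜ
    ↥(Metric.sphere (0 : EuclideanSpace ℝ (Fin d)) 1))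

/-- A singular vertex of a normal 3-pseudomanifold: its link is not a 2-sphere. -/
def IsSingular (K : SComplex) (v : ℕ) : Prop :=
  {v} ∈ K.faces ∧ ¬ K.HasSphereLink 3 v

/-- `d(σ)`: the number of vertices of the link of `σ`. -/
def deg (K : SComplex) (σ : Finset ℕ) : ℕ := (K.lk σ).fnum 0

/-- The boundary complex of the simplex on vertex set `s`: all nonempty proper subsets. -/
def properFaces (s : Finset ℕ) : Finset (Finset ℕ) :=
  s.powerset.filter fun t => t ≠ ∅ ∧ t ≠ s

/-- All nonempty faces of the simplex on vertex set `s`. -/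
def simplexFaces (s : Finset ℕ) : Finset (Finset ℕ) :=
  s.powerset.filter fun t => t ≠ ∅

/-- Operation (A): a bistellar 2-move on an edge `uv` with `lk(uv) = ∂(abc)`, `abc ∉ K`. -/
def BistellarTwoMove (K K' : SComplex) : Prop :=
  ∃ u v a b c : ℕ,
    ({u, v} : Finset ℕ) ∈ K.faces ∧ u ≠ v ∧
    ({a, b, c} : Finset ℕ).card = 3 ∧
    u ∉ ({a, b, c} : Finset ℕ) ∧ v ∉ ({a, b, c} : Finset ℕ) ∧
    (K.lk {u, v}).faces = properFaces {a, b, c} ∧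
    ({a, b, c} : Finset ℕ) ∉ K.faces ∧
    K'.faces = ((K.faces.filter fun α => ¬ ({u, v} : Finset ℕ) ⊆ α) ∪
      simplexFaces (insert u {a, b, c})) ∪ simplexFaces (insert v {a, b, c})

/-- The faces of the boundary complex of a pure `d`-dimensional complex with face set `F`:
faces contained in some `(d-1)`-face lying in exactly one facet. -/
def bdryFaces (F : Finset (Finset ℕ)) (d : ℕ) : Finset (Finset ℕ) :=
  F.filter fun s => ∃ r ∈ F, s ⊆ r ∧ r.card = d ∧
    (F.filter fun t => t.card = d + 1 ∧ r ⊆ t).card = 1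

/-- The faces of the cone with apex `w` over the complex with face set `F`. -/
def coneFaces (w : ℕ) (F : Finset (Finset ℕ)) : Finset (Finset ℕ) :=
  (F ∪ F.image (insert w)) ∪ {{w}}

/-- `K₁` is obtained from the normal `d`-pseudomanifold `K` by contracting the
edge `uv` (satisfying the link condition): delete all faces containing `u` or `v`
and cone off the boundary of the result with a new vertex `w`. -/
def EdgeContractionAt (d : ℕ) (K : SComplex) (u v : ℕ) (K₁ : SComplex) : Prop :=
  ({u, v} : Finset ℕ) ∈ K.faces ∧ u ≠ v ∧
  (K.lk {u}).faces ∩ (K.lk {v}).faces = (K.lk {u, v}).faces ∧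
  ∃ w, w ∉ K.vertexSet ∧
    K₁.faces = (K.faces.filter fun α => u ∉ α ∧ v ∉ α) ∪
      coneFaces w (bdryFaces (K.faces.filter fun α => u ∉ α ∧ v ∉ α) d)

/-- Operation (B): an edge contraction in a 3-dimensional complex. -/
def EdgeContraction (K K₁ : SComplex) : Prop := ∃ u v, EdgeContractionAt 3 K u v K₁

/-- The class `R`: normal 3-pseudomanifolds with one or two singular vertices such that
(i) if `K` contains the boundary of a 3-simplex then it contains the 3-simplex and
(ii) no normal 3-pseudomanifold with smaller `g₂` is obtained from `K` by a
bistellar 2-move, an edge contraction, an edge expansion followed by a bistellar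
2-move, or an edge expansion followed by an edge contraction. -/
def InClassR (K : SComplex) : Prop :=
  K.IsNormalPseudomanifold 3 ∧
  1 ≤ {v | K.IsSingular v}.ncard ∧ {v | K.IsSingular v}.ncard ≤ 2 ∧
  (∀ s : Finset ℕ, s.card = 4 → (∀ t ∈ properFaces s, t ∈ K.faces) → s ∈ K.faces) ∧
  (∀ K' : SComplex, K'.IsNormalPseudomanifold 3 →
    (BistellarTwoMove K K' ∨ EdgeContraction K K' ∨
      (∃ M, EdgeContraction M K ∧ BistellarTwoMove M K') ∨
      (∃ M, EdgeContraction M K ∧ EdgeContraction M K')) →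
    K.g2 ≤ K'.g2)



/-- Auxiliary weight (the basic cases of Definition 3.8). -/
noncomputable def lamAux (K : SComplex) (u v : ℕ) : ℝ :=
  if (K.lk {u}).fnum 0 = 6 then 2/3
  else if (K.lk {u}).fnum 0 = 7 ∧ (K.lk {u, v}).fnum 0 = 5 then 3/4
  else if (K.lk {u}).fnum 0 = 7 ∧ (K.lk {u, v}).fnum 0 = 4 then 1/2
  else if (K.lk {u}).fnum 0 = 8 then 1/2
  else 1/2

/-- The weight `λ(u,v)` of the (directed) edge `uv`, relative to the distinguished
singular vertex `t`. -/
noncomputable def lam (K : SComplex) (t u v : ℕ) : ℝ :=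
  if {u} ∈ (K.st {t}).faces ∧ {v} ∈ (K.st {t}).faces then 1/2
  else if 9 ≤ (K.lk {u}).fnum 0 ∧ (K.lk {v}).fnum 0 ≤ 8 then 1 - lamAux K v u
  else lamAux K u v

/-- The outer weight `O_u` of a vertex `u ∈ lk(t)`. -/
noncomputable def outerWeight (K : SComplex) (t u : ℕ) : ℝ :=
  ∑ v ∈ (K.lk {u}).vertexSet.filter
      (fun v => ({u, v} : Finset ℕ) ∉ (K.lk {t}).faces),
    lam K t u v

/-- `t` is the distinguished singular vertex: the first `ℤ₂`-Betti number of its link is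
maximal among links of vertices, i.e. (links being closed connected surfaces) its Euler
characteristic is minimal, and `d(t) ≥ 8`. -/
def DistinguishedSingular (K : SComplex) (t : ℕ) : Prop :=
  K.IsSingular t ∧ (∀ v, K.IsSingular v → (K.lk {t}).euler ≤ (K.lk {v}).euler) ∧
    8 ≤ K.deg {t}

section ModB
open Relation

/-- Vertices adjacent in the (possibly empty-simplex) link of `s`. -/
def LA (K : SComplex) (s : Finset ℕ) (a b : ℕ) : Prop :=
  a ∉ s ∧ b ∉ s ∧ insert a (insert b s) ∈ K.faces

/-- Connectedness of link of `s`, where `s` may be empty. -/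
def Cn (K : SComplex) (s : Finset ℕ) : Prop :=
  ∀ x y, x ∉ s → y ∉ s → insert x s ∈ K.faces → insert y s ∈ K.faces →
    ReflTransGen (K.LA s) x y

structure Nrm (K : SComplex) : Prop where
  ne : K.faces.Nonempty
  pure : ∀ s ∈ K.faces, ∃ F ∈ K.faces, s ⊆ F ∧ F.card = 4
  le4 : ∀ s ∈ K.faces, s.card ≤ 4
  two : ∀ s ∈ K.faces, s.card = 3 → ∃ x y, x ≠ y ∧ x ∉ s ∧ y ∉ s ∧ insert x s ∈ K.faces ∧
    insert y s ∈ K.faces ∧ ∀ z, z ∉ s → insert z s ∈ K.faces → z = x ∨ z = y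
  cn : ∀ s, (s = ∅ ∨ s ∈ K.faces) → s.card ≤ 2 → K.Cn s

theorem LA.symm {K : SComplex} {s : Finset ℕ} {a b : ℕ} (h : K.LA s a b) : K.LA s b a :=
  ⟨h.2.1, h.1, by rw [Finset.insert_comm]; exact h.2.2⟩

theorem down {K : SComplex} {s t : Finset ℕ} (h : t ∈ K.faces) (hs : s ⊆ t) (hne : s.Nonempty) :
    s ∈ K.faces := K.down_closed t h s hs hne.ne_empty

theorem mem_lk {K : SComplex} {s g : Finset ℕ} :
    g ∈ (K.lk s).faces ↔ g ∈ K.faces ∧ g ∩ s = ∅ ∧ g ∪ s ∈ K.faces := by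
  simp [lk]

theorem mem_lk' {K : SComplex} {s g : Finset ℕ} :
    g ∈ (K.lk s).faces ↔ g.Nonempty ∧ g ∩ s = ∅ ∧ g ∪ s ∈ K.faces := by
  rw [mem_lk]
  constructor
  · rintro ⟨h1, h2, h3⟩
    refine ⟨?_, h2, h3⟩
    rw [Finset.nonempty_iff_ne_empty]; rintro rfl; exact K.not_empty_mem h1
  · rintro ⟨h1, h2, h3⟩
    exact ⟨down h3 Finset.subset_union_left h1, h2, h3⟩

/-- facet adjacency inside the star of `s` -/
def FA (K : SComplex) (s A B : Finset ℕ) : Prop :=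
  s ⊆ A ∧ s ⊆ B ∧ A ∈ K.faces ∧ B ∈ K.faces ∧ A.card = 4 ∧ B.card = 4 ∧ (A ∩ B).card = 3

theorem FA.mono {K : SComplex} {s t A B : Finset ℕ} (h : K.FA t A B) (hs : s ⊆ t) : K.FA s A B :=
  ⟨hs.trans h.1, hs.trans h.2.1, h.2.2⟩

theorem exists_mem_notMem_of_card {s F : Finset ℕ} (h : s.card < F.card) :
    ∃ x ∈ F, x ∉ s := by
  by_contra! hc
  exact absurd (Finset.card_le_card (s := F) (t := s) hc) (by omega)

/-- strong connectivity of stars -/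
theorem Nrm.sc_aux {K : SComplex} (h : K.Nrm) : ∀ (k : ℕ) (s : Finset ℕ), s.card + k = 3 →
    ∀ F G, F ∈ K.faces → G ∈ K.faces → F.card = 4 → G.card = 4 → s ⊆ F → s ⊆ G →
      ReflTransGen (K.FA s) F G := by
  intro k
  induction k with
  | zero =>
    intro s hs F G hF hG hF4 hG4 hsF hsG
    by_cases hFG : F = G
    · subst hFG; exact .refl
    · refine .single ⟨hsF, hsG, hF, hG, hF4, hG4, ?_⟩
      have h1 : s ⊆ F ∩ G := Finset.subset_inter hsF hsG
      have h2 := Finset.card_le_card h1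
      have h3 : (F ∩ G).card ≤ F.card := Finset.card_le_card Finset.inter_subset_left
      by_contra hne
      have h4 : F ∩ G = F := Finset.eq_of_subset_of_card_le Finset.inter_subset_left (by omega)
      have h5 : F ∩ G = G := Finset.eq_of_subset_of_card_le Finset.inter_subset_right (by omega)
      exact hFG (h4.symm.trans h5)
  | succ k ih =>
    intro s hs F G hF hG hF4 hG4 hsF hsG
    obtain ⟨x, hxF, hxs⟩ := exists_mem_notMem_of_card (s := s) (F := F) (by omega)
    obtain ⟨y, hyG, hys⟩ := exists_mem_notMem_of_card (s := s) (F := G) (by omega)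
    have hsK : s = ∅ ∨ s ∈ K.faces := by
      rcases s.eq_empty_or_nonempty with h0 | h0
      · exact Or.inl h0
      · exact Or.inr (down hF hsF h0)
    have hins : ∀ {z : ℕ} {H : Finset ℕ}, z ∈ H → s ⊆ H → insert z s ⊆ H :=
      fun hz hH => Finset.insert_subset hz hH
    have hp := h.cn s hsK (by omega) x y hxs hys
      (down hF (hins hxF hsF) (Finset.insert_nonempty _ _))
      (down hG (hins hyG hsG) (Finset.insert_nonempty _ _))
    have step : ∀ z, z ∉ s → ∀ A B, A ∈ K.faces → B ∈ K.faces → A.card = 4 → B.card = 4 →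
        insert z s ⊆ A → insert z s ⊆ B → ReflTransGen (K.FA s) A B := by
      intro z hz A B hA hB hA4 hB4 hzA hzB
      refine ReflTransGen.mono (fun a b hab => FA.mono hab (Finset.subset_insert z s)) _ _
        (ih (insert z s) ?_ A B hA hB hA4 hB4 hzA hzB)
      rw [Finset.card_insert_of_notMem hz]; omega
    have key : ∀ z, ReflTransGen (K.LA s) x z → z ∉ s → ∀ B, B ∈ K.faces → B.card = 4 →
        insert z s ⊆ B → ReflTransGen (K.FA s) F B := by
      intro z hz
      induction hz with
      | refl =>
        intro hz B hB hB4 hzB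
        exact step x hz F B hF hB hF4 hB4 (hins hxF hsF) hzB
      | tail h1 h2 ih2 =>
        rename_i p q
        intro hz B hB hB4 hzB
        obtain ⟨C, hC, hC1, hC4⟩ := h.pure _ h2.2.2
        refine (ih2 h2.1 C hC hC4 ?_).trans (step q hz C B hC hB hC4 hB4 ?_ hzB)
        · exact (Finset.insert_subset_insert _ (Finset.subset_insert _ _)).trans hC1
        · exact (Finset.subset_insert _ _).trans hC1
    exact key y hp hys G hG hG4 (hins hyG hsG)

theorem Nrm.sc {K : SComplex} (h : K.Nrm) (s : Finset ℕ) (hs : s.card ≤ 3)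
    (F G : Finset ℕ) (hF : F ∈ K.faces) (hG : G ∈ K.faces) (hF4 : F.card = 4) (hG4 : G.card = 4)
    (hsF : s ⊆ F) (hsG : s ⊆ G) : ReflTransGen (K.FA s) F G :=
  h.sc_aux (3 - s.card) s (by omega) F G hF hG hF4 hG4 hsF hsG

theorem Nrm.isFacet {K : SComplex} (h : K.Nrm) {s : Finset ℕ} :
    K.IsFacet s ↔ s ∈ K.faces ∧ s.card = 4 := by
  constructor
  · rintro ⟨h1, h2⟩
    obtain ⟨F, hF, hsF, hF4⟩ := h.pure s h1
    have := h2 F hF hsF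
    subst this
    exact ⟨h1, hF4⟩
  · rintro ⟨h1, h2⟩
    refine ⟨h1, fun t ht hst => Finset.eq_of_subset_of_card_le hst ?_⟩
    rw [h2]; exact h.le4 t ht

theorem insert_eq_of_card {s F : Finset ℕ} (hs : s ⊆ F) (hc : F.card = s.card + 1) :
    ∃ x, x ∉ s ∧ F = insert x s := by
  obtain ⟨x, hx, hxs⟩ := exists_mem_notMem_of_card (s := s) (F := F) (by omega)
  refine ⟨x, hxs, (Finset.eq_of_subset_of_card_le (Finset.insert_subset hx hs) ?_).symm⟩
  rw [Finset.card_insert_of_notMem hxs]; omega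

theorem insert_inj_right {s : Finset ℕ} {x y : ℕ} (hx : x ∉ s)
    (h : insert x s = insert y s) : x = y := by
  have : x ∈ insert y s := h ▸ Finset.mem_insert_self x s
  rcases Finset.mem_insert.mp this with h | h
  · exact h
  · exact absurd h hx

theorem Nrm.toNormal {K : SComplex} (h : K.Nrm) : K.IsNormalPseudomanifold 3 := by
  refine ⟨⟨h.ne, fun s hs => (h.isFacet.mp hs).2⟩, ?_, ?_, ?_⟩
  · intro s t hs ht
    have hs' := h.isFacet.mp hs
    have ht' := h.isFacet.mp ht
    refine ReflTransGen.mono ?_ _ _ (h.sc ∅ (by simp) s t hs'.1 ht'.1 hs'.2 ht'.2 (by simp) (by simp))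
    intro a b hab
    obtain ⟨-, -, ha, hb, ha4, hb4, hab⟩ := hab
    exact ⟨h.isFacet.mpr ⟨ha, ha4⟩, h.isFacet.mpr ⟨hb, hb4⟩, by omega⟩
  · intro s hs hs3
    obtain ⟨x, y, hxy, hx, hy, hxK, hyK, hz⟩ := h.two s hs hs3
    have : (K.faces.filter fun F => F.card = 3 + 1 ∧ s ⊆ F) = {insert x s, insert y s} := by
      ext F
      simp only [Finset.mem_filter, Finset.mem_insert, Finset.mem_singleton]
      constructor
      · rintro ⟨hF, hF4, hsF⟩
        obtain ⟨z, hzs, rfl⟩ := insert_eq_of_card hsF (by omega)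
        rcases hz z hzs hF with rfl | rfl
        · exact Or.inl rfl
        · exact Or.inr rfl
      · rintro (rfl | rfl)
        · exact ⟨hxK, by rw [Finset.card_insert_of_notMem hx]; omega, Finset.subset_insert _ _⟩
        · exact ⟨hyK, by rw [Finset.card_insert_of_notMem hy]; omega, Finset.subset_insert _ _⟩
    rw [this, Finset.card_pair]
    exact fun he => hxy (insert_inj_right hx he)
  · intro s hs hs2
    have hs2' : s.card ≤ 2 := by omega
    have hsne : s.Nonempty := by
      rw [Finset.nonempty_iff_ne_empty]; rintro rfl; exact K.not_empty_mem hs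
    constructor
    · obtain ⟨F, hF, hsF, hF4⟩ := h.pure s hs
      obtain ⟨x, hxF, hxs⟩ := exists_mem_notMem_of_card (s := s) (F := F) (by omega)
      refine ⟨{x}, mem_lk'.mpr ⟨by simp, by simp [hxs], ?_⟩⟩
      exact down hF (Finset.union_subset (by simpa using hxF) hsF) (by simp)
    · intro x y hx hy
      rw [mem_lk'] at hx hy
      have hxs : x ∉ s := by
        intro hh; have := hx.2.1; rw [Finset.singleton_inter_of_mem hh] at this; simp at this
      have hys : y ∉ s := by
        intro hh; have := hy.2.1; rw [Finset.singleton_inter_of_mem hh] at this; simp at this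
      refine ReflTransGen.mono ?_ _ _ (h.cn s (Or.inr hs) hs2' x y hxs hys
        (by simpa [Finset.singleton_union] using hx.2.2)
        (by simpa [Finset.singleton_union] using hy.2.2))
      rintro a b ⟨ha, hb, hab⟩
      refine mem_lk'.mpr ⟨by simp, ?_, ?_⟩
      · ext z; simp only [Finset.mem_inter, Finset.mem_insert, Finset.mem_singleton,
          Finset.notMem_empty, iff_false]
        rintro ⟨rfl | rfl, h⟩ <;> contradiction
      · simpa [Finset.insert_union] using hab

theorem exists_facet {K : SComplex} {s : Finset ℕ} (hs : s ∈ K.faces) :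
    ∃ F, K.IsFacet F ∧ s ⊆ F := by
  obtain ⟨F, hF, hmax⟩ := Finset.exists_maximal
    (s := K.faces.filter (fun F => s ⊆ F)) ⟨s, by simp [hs]⟩
  rw [Finset.mem_filter] at hF
  refine ⟨F, ⟨hF.1, fun t ht hFt => ?_⟩, hF.2⟩
  exact Finset.Subset.antisymm hFt (hmax (by simp [ht, hF.2.trans hFt]) hFt)

theorem ofNormal {K : SComplex} (h : K.IsNormalPseudomanifold 3) : K.Nrm := by
  obtain ⟨⟨hne, hpure⟩, hsc, htwo, hconn⟩ := h
  have hP : ∀ s ∈ K.faces, ∃ F ∈ K.faces, s ⊆ F ∧ F.card = 4 := by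
    intro s hs
    obtain ⟨F, hF, hsF⟩ := exists_facet hs
    exact ⟨F, hF.1, hsF, hpure F hF⟩
  have h4 : ∀ s ∈ K.faces, s.card ≤ 4 := by
    intro s hs
    obtain ⟨F, hF, hsF, hF4⟩ := hP s hs
    rw [← hF4]; exact Finset.card_le_card hsF
  refine ⟨hne, hP, h4, ?_, ?_⟩
  · intro s hs hs3
    obtain ⟨F, G, hFG, he⟩ := Finset.card_eq_two.mp (htwo s hs hs3)
    have hF : F ∈ ({F, G} : Finset (Finset ℕ)) := by simp
    have hG : G ∈ ({F, G} : Finset (Finset ℕ)) := by simp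
    rw [← he, Finset.mem_filter] at hF hG
    obtain ⟨x, hx, rfl⟩ := insert_eq_of_card hF.2.2 (by omega)
    obtain ⟨y, hy, rfl⟩ := insert_eq_of_card hG.2.2 (by omega)
    refine ⟨x, y, ?_, hx, hy, hF.1, hG.1, ?_⟩
    · rintro rfl; exact hFG rfl
    · intro z hz hzK
      have : insert z s ∈ ({insert x s, insert y s} : Finset (Finset ℕ)) := by
        rw [← he, Finset.mem_filter]
        exact ⟨hzK, by rw [Finset.card_insert_of_notMem hz]; omega, Finset.subset_insert _ _⟩
      simp only [Finset.mem_insert, Finset.mem_singleton] at this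
      rcases this with h | h
      · exact Or.inl (insert_inj_right hz h)
      · exact Or.inr (insert_inj_right hz h)
  · intro s hs hs2
    rcases hs with rfl | hs
    · -- connectivity of the 1-skeleton
      intro x y _ _ hx hy
      obtain ⟨F, hF, hxF⟩ := exists_facet hx
      obtain ⟨G, hG, hyG⟩ := exists_facet hy
      have hxF' : x ∈ F := hxF (by simp)
      have hyG' : y ∈ G := hyG (by simp)
      have inF : ∀ H, H ∈ K.faces → ∀ a ∈ H, ∀ b ∈ H, K.LA ∅ a b := by
        intro H hH a ha b hb
        refine ⟨by simp, by simp, down hH ?_ (by simp)⟩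
        intro z hz
        simp only [Finset.mem_insert, Finset.notMem_empty, or_false] at hz
        rcases hz with rfl | rfl <;> assumption
      have key : ∀ H, ReflTransGen K.FacetAdj F H → ∀ z ∈ H, ReflTransGen (K.LA ∅) x z := by
        intro H hH
        induction hH with
        | refl => intro z hz; exact .single (inF F hF.1 x hxF' z hz)
        | tail h1 h2 ih =>
          rename_i A B
          intro z hz
          have hA := hpure A h2.1
          have : (A ∩ B).Nonempty := by
            rw [← Finset.card_pos]; have := h2.2.2; omega
          obtain ⟨p, hp⟩ := this
          rw [Finset.mem_inter] at hp
          exact (ih p hp.1).tail (inF B h2.2.1.1 p hp.2 z hz)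
      exact key G (hsc F G hF hG) y hyG'
    · intro x y hx hy hxK hyK
      have hm : ∀ z, z ∉ s → insert z s ∈ K.faces → {z} ∈ (K.lk s).faces := by
        intro z hz hzK
        exact mem_lk'.mpr ⟨by simp, by simp [hz], by simpa [Finset.singleton_union] using hzK⟩
      refine ReflTransGen.mono ?_ _ _ ((hconn s hs (by omega)).2 x y (hm x hx hxK) (hm y hy hyK))
      intro a b hab
      have hab := mem_lk'.mp hab
      have hnin : ∀ z ∈ ({a, b} : Finset ℕ), z ∉ s := by
        intro z hz hzs
        have : z ∈ ({a, b} : Finset ℕ) ∩ s := Finset.mem_inter.mpr ⟨hz, hzs⟩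
        rw [hab.2.1] at this; simp at this
      refine ⟨hnin a (by simp), hnin b (by simp), ?_⟩
      simpa [Finset.insert_union] using hab.2.2
end ModB

section ModC
open Relation

/-- The complex with given faces (those nonempty subsets of `V` satisfying `p`). -/
noncomputable def mk' (V : Finset ℕ) (p : Finset ℕ → Prop)
    (hp : ∀ s, p s → ∀ t ⊆ s, t ≠ ∅ → p t) : SComplex where
  faces := by classical exact V.powerset.filter (fun s => s.Nonempty ∧ p s)
  not_empty_mem := by simp
  down_closed := by
    intro s hs t hts ht
    simp only [Finset.mem_filter, Finset.mem_powerset] at hs ⊢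
    exact ⟨hts.trans hs.1, Finset.nonempty_iff_ne_empty.mpr ht, hp s hs.2.2 t hts ht⟩

theorem mem_mk' {V : Finset ℕ} {p : Finset ℕ → Prop}
    {hp : ∀ s, p s → ∀ t ⊆ s, t ≠ ∅ → p t} {s : Finset ℕ} :
    s ∈ (mk' V p hp).faces ↔ s ⊆ V ∧ s.Nonempty ∧ p s := by
  simp [mk']

theorem mem_vertexSet {K : SComplex} {x : ℕ} : x ∈ K.vertexSet ↔ {x} ∈ K.faces := by
  simp only [vertexSet, Finset.mem_sup, id]
  constructor
  · rintro ⟨s, hs, hx⟩; exact down hs (by simpa using hx) (by simp)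
  · intro h; exact ⟨{x}, h, by simp⟩

theorem subset_vertexSet {K : SComplex} {s : Finset ℕ} (hs : s ∈ K.faces) : s ⊆ K.vertexSet := by
  intro x hx; exact mem_vertexSet.mpr (down hs (by simpa using hx) (by simp))

theorem ne_of_mem {K : SComplex} {s : Finset ℕ} (hs : s ∈ K.faces) : s.Nonempty := by
  rw [Finset.nonempty_iff_ne_empty]; rintro rfl; exact K.not_empty_mem hs

theorem bdry_del {K : SComplex} (h : K.Nrm) (w : ℕ) :
    bdryFaces (K.faces.filter fun α => w ∉ α) 3 = (K.lk {w}).faces := by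
  ext s
  simp only [bdryFaces, Finset.mem_filter]
  constructor
  · rintro ⟨⟨hs, hws⟩, r, ⟨hr, hwr⟩, hsr, hr3, hone⟩
    obtain ⟨x, y, hxy, hx, hy, hxK, hyK, -⟩ := h.two r hr hr3
    have hwr' : insert w r ∈ K.faces := by
      by_contra hc
      have hxw : x ≠ w := by rintro rfl; exact hc hxK
      have hyw : y ≠ w := by rintro rfl; exact hc hyK
      obtain ⟨F, hF⟩ := Finset.card_eq_one.mp hone
      have h1 : insert x r ∈ ({F} : Finset (Finset ℕ)) := by
        rw [← hF]
        simp only [Finset.mem_filter, Finset.mem_insert, not_or]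
        exact ⟨⟨hxK, hxw.symm, hwr⟩, by rw [Finset.card_insert_of_notMem hx]; omega,
          Finset.subset_insert _ _⟩
      have h2 : insert y r ∈ ({F} : Finset (Finset ℕ)) := by
        rw [← hF]
        simp only [Finset.mem_filter, Finset.mem_insert, not_or]
        exact ⟨⟨hyK, hyw.symm, hwr⟩, by rw [Finset.card_insert_of_notMem hy]; omega,
          Finset.subset_insert _ _⟩
      rw [Finset.mem_singleton] at h1 h2
      exact hxy (insert_inj_right hx (h1.trans h2.symm))
    refine mem_lk'.mpr ⟨ne_of_mem hs, by simp [hws], down hwr' ?_ (by simp)⟩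
    intro z hz
    simp only [Finset.mem_union, Finset.mem_singleton] at hz
    rcases hz with hz | rfl
    · exact Finset.mem_insert_of_mem (hsr hz)
    · simp
  · intro hs
    obtain ⟨hne, hd, hK⟩ := mem_lk'.mp hs
    have hws : w ∉ s := by intro hh; rw [Finset.inter_singleton_of_mem hh] at hd; simp at hd
    obtain ⟨F, hF, hsF, hF4⟩ := h.pure _ hK
    have hwF : w ∈ F := hsF (by simp)
    have hr3 : (F.erase w).card = 3 := by rw [Finset.card_erase_of_mem hwF]; omega
    have hrK : F.erase w ∈ K.faces :=
      down hF (Finset.erase_subset _ _) (by rw [← Finset.card_pos]; omega)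
    refine ⟨⟨down hK Finset.subset_union_left hne, hws⟩, F.erase w, ⟨hrK, by simp⟩, ?_, hr3, ?_⟩
    · intro z hz
      refine Finset.mem_erase.mpr ⟨?_, hsF (by simp [hz])⟩
      rintro rfl; exact hws hz
    · obtain ⟨x, y, hxy, hx, hy, hxK, hyK, hall⟩ := h.two _ hrK hr3
      have hFi : insert w (F.erase w) = F := Finset.insert_erase hwF
      have key : ∀ p q, p ≠ q → p ∉ F.erase w → insert p (F.erase w) ∈ K.faces →
          (∀ z, z ∉ F.erase w → insert z (F.erase w) ∈ K.faces → z = w ∨ z = p) → p ≠ w →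
          ((K.faces.filter fun α => w ∉ α).filter
            fun t => t.card = 3 + 1 ∧ F.erase w ⊆ t).card = 1 := by
        intro p q hpq hp hpK hall hpw
        refine Finset.card_eq_one.mpr ⟨insert p (F.erase w), ?_⟩
        ext t
        simp only [Finset.mem_filter, Finset.mem_singleton]
        constructor
        · rintro ⟨⟨ht, hwt⟩, ht4, hrt⟩
          obtain ⟨z, hz, rfl⟩ := insert_eq_of_card hrt (by omega)
          rcases hall z hz ht with rfl | rfl
          · exact absurd (Finset.mem_insert_self _ _) hwt
          · rfl
        · rintro rfl
          exact ⟨⟨hpK, by simp [hpw.symm]⟩, by rw [Finset.card_insert_of_notMem hp]; omega,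
            Finset.subset_insert _ _⟩
      have hwxy := hall w (by simp) (by rw [hFi]; exact hF)
      rcases hwxy with rfl | rfl
      · exact key y w hxy.symm hy hyK hall hxy.symm
      · exact key x w hxy hx hxK (fun z hz hzK => (hall z hz hzK).symm) hxy

theorem cone_del {K : SComplex} (w : ℕ) (hw : {w} ∈ K.faces) :
    K.faces = (K.faces.filter fun α => w ∉ α) ∪ coneFaces w (K.lk {w}).faces := by
  ext s
  simp only [coneFaces, Finset.mem_union, Finset.mem_filter, Finset.mem_image,
    Finset.mem_singleton, mem_lk']
  constructor
  · intro hs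
    by_cases hws : w ∈ s
    · right
      by_cases hs1 : s = {w}
      · right; exact hs1
      · left; right
        refine ⟨s.erase w, ⟨?_, by simp, ?_⟩, Finset.insert_erase hws⟩
        · rw [Finset.nonempty_iff_ne_empty]
          intro h0
          apply hs1
          rw [← Finset.insert_erase hws, h0]; rfl
        · rw [Finset.union_comm, ← Finset.insert_eq, Finset.insert_erase hws]; exact hs
    · exact Or.inl ⟨hs, hws⟩
  · rintro (h | (⟨h1, h2, h3⟩ | ⟨r, ⟨h1, h2, h3⟩, rfl⟩) | rfl)
    · exact h.1
    · exact down h3 Finset.subset_union_left h1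
    · rw [Finset.union_comm, ← Finset.insert_eq] at h3; exact h3
    · exact hw

/-- `s` lies in a link triangle of `w` with colour `P`. -/
def DD (K : SComplex) (w : ℕ) (P : Finset ℕ → Prop) (s : Finset ℕ) : Prop :=
  ∃ T, w ∉ T ∧ T.card = 3 ∧ insert w T ∈ K.faces ∧ P T ∧ s ⊆ T

structure CutData (K : SComplex) (w : ℕ) (γ : Finset ℕ) (P : Finset ℕ → Prop) : Prop where
  nrm : K.Nrm
  hγ : γ.card = 3
  hw : w ∉ γ
  hed : ∀ e ⊆ γ, e.card = 2 → insert w e ∈ K.faces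
  hγK : γ ∉ K.faces
  hP : ∀ T1 T2, T1.card = 3 → w ∉ T1 → insert w T1 ∈ K.faces →
    T2.card = 3 → w ∉ T2 → insert w T2 ∈ K.faces → (T1 ∩ T2).card = 2 →
    ((P T1 ↔ P T2) ↔ ¬ (T1 ∩ T2 ⊆ γ))

namespace CutData
variable {K : SComplex} {w : ℕ} {γ : Finset ℕ} {P : Finset ℕ → Prop}

theorem swap (h : CutData K w γ P) : CutData K w γ (fun T => ¬ P T) :=
  { h with
    hP := by
      intro T1 T2 a1 a2 a3 a4 a5 a6 a7
      rw [← h.hP T1 T2 a1 a2 a3 a4 a5 a6 a7]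
      tauto }

theorem DD_mono {s t : Finset ℕ} (h : DD K w P t) (hs : s ⊆ t) : DD K w P s := by
  obtain ⟨T, h1, h2, h3, h4, h5⟩ := h
  exact ⟨T, h1, h2, h3, h4, hs.trans h5⟩

theorem DD_face {s : Finset ℕ} (h : DD K w P s) : insert w s ∈ K.faces ∧ w ∉ s ∧ s.card ≤ 3 := by
  obtain ⟨T, h1, h2, h3, h4, h5⟩ := h
  exact ⟨down h3 (Finset.insert_subset_insert _ h5) (by simp), fun h => h1 (h5 h),
    h2 ▸ Finset.card_le_card h5⟩

theorem DD_or (h : CutData K w γ P) {s : Finset ℕ} (hs : insert w s ∈ K.faces) (hw : w ∉ s) :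
    DD K w P s ∨ DD K w (fun T => ¬ P T) s := by
  obtain ⟨F, hF, hsF, hF4⟩ := h.nrm.pure _ hs
  have hwF : w ∈ F := hsF (by simp)
  have hc : (F.erase w).card = 3 := by rw [Finset.card_erase_of_mem hwF]; omega
  have hi : insert w (F.erase w) ∈ K.faces := by rw [Finset.insert_erase hwF]; exact hF
  have hss : s ⊆ F.erase w := by
    intro z hz
    refine Finset.mem_erase.mpr ⟨?_, hsF (by simp [hz])⟩
    rintro rfl; exact hw hz
  by_cases hp : P (F.erase w)
  · exact Or.inl ⟨_, by simp, hc, hi, hp, hss⟩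
  · exact Or.inr ⟨_, by simp, hc, hi, hp, hss⟩

/-- erase form of a facet adjacency in the star of `insert w s`. -/
theorem step (h : CutData K w γ P) {s A B : Finset ℕ} (hw : w ∉ s)
    (hAB : K.FA (insert w s) A B) :
    s ⊆ A.erase w ∩ B.erase w ∧ (A.erase w ∩ B.erase w).card = 2 ∧
    (A.erase w).card = 3 ∧ (B.erase w).card = 3 ∧ insert w (A.erase w) ∈ K.faces ∧
    insert w (B.erase w) ∈ K.faces ∧
    ((P (A.erase w) ↔ P (B.erase w)) ↔ ¬ (A.erase w ∩ B.erase w ⊆ γ)) := by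
  obtain ⟨h1, h2, h3, h4, h5, h6, h7⟩ := hAB
  have hwA : w ∈ A := h1 (by simp)
  have hwB : w ∈ B := h2 (by simp)
  have e1 : (A.erase w).card = 3 := by rw [Finset.card_erase_of_mem hwA]; omega
  have e2 : (B.erase w).card = 3 := by rw [Finset.card_erase_of_mem hwB]; omega
  have e3 : A.erase w ∩ B.erase w = (A ∩ B).erase w := by ext z; simp; tauto
  have e4 : (A.erase w ∩ B.erase w).card = 2 := by
    rw [e3, Finset.card_erase_of_mem (by simp [hwA, hwB])]; omega
  have e5 : insert w (A.erase w) ∈ K.faces := by rw [Finset.insert_erase hwA]; exact h3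
  have e6 : insert w (B.erase w) ∈ K.faces := by rw [Finset.insert_erase hwB]; exact h4
  refine ⟨?_, e4, e1, e2, e5, e6, h.hP _ _ e1 (by simp) e5 e2 (by simp) e6 e4⟩
  intro z hz
  have : z ≠ w := by rintro rfl; exact hw hz
  simp [this, h1 (Finset.mem_insert_of_mem hz), h2 (Finset.mem_insert_of_mem hz)]

theorem cross (h : CutData K w γ P) {s : Finset ℕ} (hs : s.card ≤ 2)
    (h1 : DD K w P s) (h2 : DD K w (fun T => ¬ P T) s) : s ⊆ γ := by
  obtain ⟨T1, a1, a2, a3, a4, a5⟩ := h1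
  obtain ⟨T2, b1, b2, b3, b4, b5⟩ := h2
  have hws : w ∉ s := fun hh => a1 (a5 hh)
  have hc := h.nrm.sc (insert w s) (by rw [Finset.card_insert_of_notMem hws]; omega)
    (insert w T1) (insert w T2) a3 b3
    (by rw [Finset.card_insert_of_notMem a1]; omega)
    (by rw [Finset.card_insert_of_notMem b1]; omega)
    (Finset.insert_subset_insert _ a5) (Finset.insert_subset_insert _ b5)
  by_contra hsg
  have key : ∀ H, ReflTransGen (K.FA (insert w s)) (insert w T1) H → P (H.erase w) := by
    intro H hH
    induction hH with
    | refl => rw [Finset.erase_insert a1]; exact a4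
    | tail h3 h4 ih =>
      obtain ⟨c1, -, -, -, -, -, c7⟩ := h.step hws h4
      exact (c7.mpr (fun hh => hsg (c1.trans hh))).mp ih
  have := key _ hc
  rw [Finset.erase_insert b1] at this
  exact b4 this

theorem proper_DD (h : CutData K w γ P) {s : Finset ℕ} (hs : s ⊆ γ) (hc : s.card ≤ 2) :
    DD K w P s := by
  obtain ⟨e, hse, heγ, he⟩ := Finset.exists_subsuperset_card_eq hs hc (by rw [h.hγ]; omega)
  have hwe : w ∉ e := fun hh => h.hw (heγ hh)
  have hK := h.hed e heγ he
  have hc3 : (insert w e).card = 3 := by rw [Finset.card_insert_of_notMem hwe]; omega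
  obtain ⟨x, y, hxy, hx, hy, hxK, hyK, -⟩ := h.nrm.two _ hK hc3
  have hx' : x ≠ w ∧ x ∉ e := by simpa using hx
  have hy' : y ≠ w ∧ y ∉ e := by simpa using hy
  rw [Finset.insert_comm] at hxK hyK
  have d1 : (insert x e).card = 3 := by rw [Finset.card_insert_of_notMem hx'.2]; omega
  have d2 : (insert y e).card = 3 := by rw [Finset.card_insert_of_notMem hy'.2]; omega
  have d3 : w ∉ insert x e := by simp [hwe, hx'.1.symm]
  have d4 : w ∉ insert y e := by simp [hwe, hy'.1.symm]
  have d5 : insert x e ∩ insert y e = e := by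
    ext z; simp only [Finset.mem_inter, Finset.mem_insert]
    constructor
    · rintro ⟨rfl | h1, rfl | h2⟩
      · exact absurd rfl hxy
      · exact h2
      · exact h1
      · exact h1
    · intro hz; exact ⟨Or.inr hz, Or.inr hz⟩
  have := h.hP _ _ d1 d3 hxK d2 d4 hyK (by rw [d5]; exact he)
  rw [d5] at this
  by_cases hp : P (insert x e)
  · exact ⟨_, d3, d1, hxK, hp, hse.trans (Finset.subset_insert _ _)⟩
  · have hpy : P (insert y e) := by
      by_contra hpy
      exact (this.mp (by tauto)) heγ
    exact ⟨_, d4, d2, hyK, hpy, hse.trans (Finset.subset_insert _ _)⟩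

end CutData

/-- Membership specification for the result of expansion followed by a 2-move. -/
structure CutRes (K : SComplex) (w : ℕ) (γ : Finset ℕ) (P : Finset ℕ → Prop) (w1 w2 : ℕ)
    (K' : SComplex) : Prop where
  cut : CutData K w γ P
  h12 : w1 ≠ w2
  hw1 : w1 ∉ K.vertexSet
  hw2 : w2 ∉ K.vertexSet
  m0 : ∀ s, w1 ∉ s → w2 ∉ s → (s ∈ K'.faces ↔ (s ∈ K.faces ∧ w ∉ s) ∨ s = γ)
  m1 : ∀ s, w1 ∉ s → w2 ∉ s → (insert w1 s ∈ K'.faces ↔ DD K w P s ∨ s ⊆ γ)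
  m2 : ∀ s, w1 ∉ s → w2 ∉ s → (insert w2 s ∈ K'.faces ↔ DD K w (fun T => ¬ P T) s ∨ s ⊆ γ)
  m12 : ∀ s ∈ K'.faces, w1 ∈ s → w2 ∉ s

namespace CutRes
variable {K K' : SComplex} {w w1 w2 : ℕ} {γ : Finset ℕ} {P : Finset ℕ → Prop}

theorem swap (h : CutRes K w γ P w1 w2 K') : CutRes K w γ (fun T => ¬ P T) w2 w1 K' where
  cut := h.cut.swap
  h12 := h.h12.symm
  hw1 := h.hw2
  hw2 := h.hw1
  m0 := fun s a b => h.m0 s b a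
  m1 := fun s a b => h.m2 s b a
  m2 := fun s a b => by
    rw [h.m1 s b a]; simp
  m12 := fun s hs a b => h.m12 s hs b a

theorem nin (h : CutRes K w γ P w1 w2 K') {s : Finset ℕ} (hs : s ∈ K.faces) :
    w1 ∉ s ∧ w2 ∉ s :=
  ⟨fun hh => h.hw1 (subset_vertexSet hs hh), fun hh => h.hw2 (subset_vertexSet hs hh)⟩

theorem ninγ (h : CutRes K w γ P w1 w2 K') : w1 ∉ γ ∧ w2 ∉ γ := by
  constructor
  · intro hh
    obtain ⟨h1, -, -⟩ := CutData.DD_face (h.cut.proper_DD (s := {w1}) (by simpa using hh) (by simp))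
    exact (h.nin h1).1 (by simp)
  · intro hh
    obtain ⟨h1, -, -⟩ := CutData.DD_face (h.cut.proper_DD (s := {w2}) (by simpa using hh) (by simp))
    exact (h.nin h1).2 (by simp)

theorem ninD (h : CutRes K w γ P w1 w2 K') {P' : Finset ℕ → Prop} {s : Finset ℕ}
    (hs : DD K w P' s ∨ s ⊆ γ) : w1 ∉ s ∧ w2 ∉ s := by
  rcases hs with hs | hs
  · have := h.nin (CutData.DD_face hs).1
    simp only [Finset.mem_insert, not_or] at this
    exact ⟨this.1.2, this.2.2⟩
  · exact ⟨fun hh => h.ninγ.1 (hs hh), fun hh => h.ninγ.2 (hs hh)⟩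

theorem m1' (h : CutRes K w γ P w1 w2 K') {s : Finset ℕ} (hs : DD K w P s ∨ s ⊆ γ) :
    insert w1 s ∈ K'.faces := (h.m1 s (h.ninD hs).1 (h.ninD hs).2).mpr hs

theorem m1e (h : CutRes K w γ P w1 w2 K') {s : Finset ℕ} (hs : s ∈ K'.faces) (hw : w1 ∈ s) :
    ∃ r, s = insert w1 r ∧ w1 ∉ r ∧ w2 ∉ r ∧ (DD K w P r ∨ r ⊆ γ) := by
  have h2 := h.m12 s hs hw
  have e : insert w1 (s.erase w1) = s := Finset.insert_erase hw
  have h3 : w2 ∉ s.erase w1 := fun hh => h2 (Finset.mem_of_mem_erase hh)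
  refine ⟨s.erase w1, e.symm, by simp, h3, ?_⟩
  rw [← h.m1 _ (by simp) h3, e]; exact hs

theorem pure1 (h : CutRes K w γ P w1 w2 K') {s : Finset ℕ} (hs : s ∈ K'.faces) (hw : w1 ∈ s) :
    (∃ F ∈ K'.faces, s ⊆ F ∧ F.card = 4) ∧ s.card ≤ 4 := by
  obtain ⟨r, rfl, h1, h2, hr⟩ := h.m1e hs hw
  rcases hr with hr | hr
  · obtain ⟨T, a1, a2, a3, a4, a5⟩ := hr
    have hT : DD K w P T ∨ T ⊆ γ := Or.inl ⟨T, a1, a2, a3, a4, subset_rfl⟩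
    have hF := h.m1' hT
    have c4 : (insert w1 T).card = 4 := by
      rw [Finset.card_insert_of_notMem (h.ninD hT).1]; omega
    exact ⟨⟨_, hF, Finset.insert_subset_insert _ a5, c4⟩,
      c4 ▸ Finset.card_le_card (Finset.insert_subset_insert _ a5)⟩
  · have c4 : (insert w1 γ).card = 4 := by
      rw [Finset.card_insert_of_notMem h.ninγ.1, h.cut.hγ]
    exact ⟨⟨_, h.m1' (Or.inr subset_rfl), Finset.insert_subset_insert _ hr, c4⟩,
      c4 ▸ Finset.card_le_card (Finset.insert_subset_insert _ hr)⟩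

theorem pureK (h : CutRes K w γ P w1 w2 K') {s : Finset ℕ} (hs : s ∈ K'.faces) :
    (∃ F ∈ K'.faces, s ⊆ F ∧ F.card = 4) ∧ s.card ≤ 4 := by
  by_cases h1 : w1 ∈ s
  · exact h.pure1 hs h1
  by_cases h2 : w2 ∈ s
  · exact h.swap.pure1 hs h2
  rcases (h.m0 s h1 h2).mp hs with ⟨hsK, hws⟩ | rfl
  · refine ⟨?_, h.cut.nrm.le4 s hsK⟩
    obtain ⟨F, hF, hsF, hF4⟩ := h.cut.nrm.pure s hsK
    by_cases hwF : w ∈ F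
    · have hF' : insert w s ∈ K.faces := down hF (Finset.insert_subset hwF hsF) (by simp)
      rcases h.cut.DD_or hF' hws with hd | hd
      · obtain ⟨G, hG, hsG, hG4⟩ := (h.pure1 (h.m1' (Or.inl hd)) (by simp)).1
        exact ⟨G, hG, (Finset.subset_insert _ _).trans hsG, hG4⟩
      · obtain ⟨G, hG, hsG, hG4⟩ := (h.swap.pure1 (h.swap.m1' (Or.inl hd)) (by simp)).1
        exact ⟨G, hG, (Finset.subset_insert _ _).trans hsG, hG4⟩
    · exact ⟨F, (h.m0 F (h.nin hF).1 (h.nin hF).2).mpr (Or.inl ⟨hF, hwF⟩), hsF, hF4⟩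
  · refine ⟨⟨insert w1 s, h.m1' (Or.inr subset_rfl), Finset.subset_insert _ _, ?_⟩, ?_⟩
    · rw [Finset.card_insert_of_notMem h1, h.cut.hγ]
    · rw [h.cut.hγ]; omega

theorem DD_card3 {s : Finset ℕ} (hs : s.card = 3) (h : DD K w P s) :
    w ∉ s ∧ insert w s ∈ K.faces ∧ P s := by
  obtain ⟨T, a1, a2, a3, a4, a5⟩ := h
  have : s = T := Finset.eq_of_subset_of_card_le a5 (by omega)
  subst this
  exact ⟨a1, a3, a4⟩

theorem subγ (h : CutRes K w γ P w1 w2 K') {s : Finset ℕ} (hs : s.card = 3) (h1 : s ⊆ γ) :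
    s = γ := Finset.eq_of_subset_of_card_le h1 (by rw [h.cut.hγ, hs])

theorem two1 (h : CutRes K w γ P w1 w2 K') {s : Finset ℕ} (hs : s ∈ K'.faces) (h3 : s.card = 3)
    (hw : w1 ∈ s) : ∃ x y, x ≠ y ∧ x ∉ s ∧ y ∉ s ∧ insert x s ∈ K'.faces ∧
    insert y s ∈ K'.faces ∧ ∀ z, z ∉ s → insert z s ∈ K'.faces → z = x ∨ z = y := by
  obtain ⟨e, rfl, h1, h2, he⟩ := h.m1e hs hw
  have hc : e.card = 2 := by rw [Finset.card_insert_of_notMem h1] at h3; omega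
  have hD : DD K w P e := he.elim id (fun hh => h.cut.proper_DD hh (by omega))
  obtain ⟨hK, hwe, -⟩ := CutData.DD_face hD
  have hc3 : (insert w e).card = 3 := by rw [Finset.card_insert_of_notMem hwe]; omega
  obtain ⟨x, y, hxy, hx, hy, hxK, hyK, hall⟩ := h.cut.nrm.two _ hK hc3
  have hx' : x ≠ w ∧ x ∉ e := by simpa using hx
  have hy' : y ≠ w ∧ y ∉ e := by simpa using hy
  have hxn := h.nin hxK
  have hyn := h.nin hyK
  simp only [Finset.mem_insert, not_or] at hxn hyn
  rw [Finset.insert_comm] at hxK hyK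
  have cx : ∀ z, z ∉ e → (insert z e).card = 3 := fun z hz => by
    rw [Finset.card_insert_of_notMem hz]; omega
  have d3 : w ∉ insert x e := by simp [hwe, hx'.1.symm]
  have d4 : w ∉ insert y e := by simp [hwe, hy'.1.symm]
  have d5 : insert x e ∩ insert y e = e := by
    ext z; simp only [Finset.mem_inter, Finset.mem_insert]
    constructor
    · rintro ⟨rfl | h1, rfl | h2⟩
      · exact absurd rfl hxy
      · exact h2
      · exact h1
      · exact h1
    · intro hz; exact ⟨Or.inr hz, Or.inr hz⟩
  have hPxy := h.cut.hP _ _ (cx x hx'.2) d3 hxK (cx y hy'.2) d4 hyK (by rw [d5]; exact hc)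
  rw [d5] at hPxy
  -- neighbours of `insert w1 e`
  have nb : ∀ z, z ∉ insert w1 e → insert z (insert w1 e) ∈ K'.faces →
      z ∉ e ∧ (((z = x ∨ z = y) ∧ P (insert z e)) ∨ insert z e = γ) := by
    intro z hz hzK
    have hz' : z ≠ w1 ∧ z ∉ e := by simpa using hz
    have hz2 : z ≠ w2 := by
      rintro rfl
      exact h.m12 _ hzK (by simp) (by simp)
    rw [Finset.insert_comm, h.m1 _ (by simp [h1, hz'.1.symm]) (by simp [h2, hz2.symm])] at hzK
    refine ⟨hz'.2, ?_⟩
    rcases hzK with hd | hd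
    · obtain ⟨b1, b2, b3⟩ := DD_card3 (cx z hz'.2) hd
      left
      rw [Finset.insert_comm] at b2
      refine ⟨hall z ?_ b2, b3⟩
      simp only [Finset.mem_insert, not_or] at b1 ⊢
      exact ⟨fun hh => b1.1 hh.symm, hz'.2⟩
    · exact Or.inr (h.subγ (cx z hz'.2) hd)
  have nbP : ∀ z, z ≠ w → z ∉ e → insert w (insert z e) ∈ K.faces → P (insert z e) →
      insert z (insert w1 e) ∈ K'.faces := by
    intro z hzw hz hzK hzP
    rw [Finset.insert_comm]
    refine h.m1' (Or.inl ⟨_, ?_, cx z hz, hzK, hzP, subset_rfl⟩)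
    simp [hwe, hzw.symm]
  by_cases heγ : e ⊆ γ
  · have hne : ¬ (P (insert x e) ↔ P (insert y e)) := fun hh => hPxy.mp hh heγ
    obtain ⟨g, hg, hγe⟩ := insert_eq_of_card heγ (by rw [h.cut.hγ]; omega)
    have hgw1 : g ∉ insert w1 e := by
      simp only [Finset.mem_insert, not_or]
      refine ⟨?_, hg⟩
      rintro rfl; exact h.ninγ.1 (by rw [hγe]; simp)
    have hgK : insert g (insert w1 e) ∈ K'.faces := by
      rw [Finset.insert_comm]
      exact h.m1' (Or.inr (by rw [hγe]))
    have ngx : ∀ z, z ∉ e → insert w (insert z e) ∈ K.faces → z ≠ g := by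
      rintro z hz hzK rfl
      exact h.cut.hγK (hγe ▸ down hzK (Finset.subset_insert _ _) (by simp))
    have gu : ∀ z, insert z e = γ → z ∉ e → z = g := by
      intro z hz hze
      rw [hγe] at hz
      exact insert_inj_right hze hz
    by_cases hpx : P (insert x e)
    · refine ⟨x, g, ngx x hx'.2 hxK, ?_, hgw1, nbP x hx'.1 hx'.2 hxK hpx, hgK, ?_⟩
      · simp only [Finset.mem_insert, not_or]; exact ⟨fun hh => hxn.1.1 hh.symm, hx'.2⟩
      · intro z hz hzK
        obtain ⟨hze, ⟨rfl | rfl, hzP⟩ | hz2⟩ := nb z hz hzK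
        · exact Or.inl rfl
        · exact absurd ⟨fun _ => hzP, fun _ => hpx⟩ hne
        · exact Or.inr (gu z hz2 hze)
    · have hpy : P (insert y e) := by by_contra hh; exact hne ⟨fun a => absurd a hpx, fun a => absurd a hh⟩
      refine ⟨y, g, ngx y hy'.2 hyK, ?_, hgw1, nbP y hy'.1 hy'.2 hyK hpy, hgK, ?_⟩
      · simp only [Finset.mem_insert, not_or]; exact ⟨fun hh => hyn.1.1 hh.symm, hy'.2⟩
      · intro z hz hzK
        obtain ⟨hze, ⟨rfl | rfl, hzP⟩ | hz2⟩ := nb z hz hzK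
        · exact absurd hzP hpx
        · exact Or.inl rfl
        · exact Or.inr (gu z hz2 hze)
  · have hiff := hPxy.mpr heγ
    have hor : P (insert x e) ∨ P (insert y e) := by
      obtain ⟨T, a1, a2, a3, a4, a5⟩ := hD
      obtain ⟨z, hz, rfl⟩ := insert_eq_of_card a5 (by omega)
      rw [Finset.insert_comm] at a3
      rcases hall z (by simp only [Finset.mem_insert, not_or] at a1 ⊢; exact ⟨fun hh => a1.1 hh.symm, hz⟩) a3 with rfl | rfl
      · exact Or.inl a4
      · exact Or.inr a4
    have hpx : P (insert x e) := hor.elim id hiff.mpr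
    have hpy : P (insert y e) := hiff.mp hpx
    refine ⟨x, y, hxy, ?_, ?_, nbP x hx'.1 hx'.2 hxK hpx, nbP y hy'.1 hy'.2 hyK hpy, ?_⟩
    · simp only [Finset.mem_insert, not_or]; exact ⟨fun hh => hxn.1.1 hh.symm, hx'.2⟩
    · simp only [Finset.mem_insert, not_or]; exact ⟨fun hh => hyn.1.1 hh.symm, hy'.2⟩
    · intro z hz hzK
      obtain ⟨hze, ⟨hz1, hzP⟩ | hz2⟩ := nb z hz hzK
      · exact hz1
      · exact absurd (hz2 ▸ Finset.subset_insert _ _) heγ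

end CutRes
end ModC

section ModD
open Relation
namespace CutRes
variable {K K' : SComplex} {w w1 w2 : ℕ} {γ : Finset ℕ} {P : Finset ℕ → Prop}

theorem two0 (h : CutRes K w γ P w1 w2 K') {s : Finset ℕ} (hs : s ∈ K'.faces) (h3 : s.card = 3)
    (h1 : w1 ∉ s) (h2 : w2 ∉ s) : ∃ x y, x ≠ y ∧ x ∉ s ∧ y ∉ s ∧ insert x s ∈ K'.faces ∧
    insert y s ∈ K'.faces ∧ ∀ z, z ∉ s → insert z s ∈ K'.faces → z = x ∨ z = y := by
  have c4 : ∀ z, z ∉ s → insert z s ≠ γ := by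
    intro z hz he
    have := congrArg Finset.card he
    rw [Finset.card_insert_of_notMem hz, h.cut.hγ] at this; omega
  rcases (h.m0 s h1 h2).mp hs with ⟨hsK, hws⟩ | rfl
  · obtain ⟨x, y, hxy, hx, hy, hxK, hyK, hall⟩ := h.cut.nrm.two s hsK h3
    have hsγ : ¬ s ⊆ γ := fun hh => h.cut.hγK (h.subγ h3 hh ▸ hsK)
    have old : ∀ z, z ∉ s → z ≠ w → z ≠ w1 → z ≠ w2 →
        (insert z s ∈ K'.faces ↔ insert z s ∈ K.faces) := by
      intro z hz hzw hz1 hz2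
      rw [h.m0 _ (by simp [h1, hz1.symm]) (by simp [h2, hz2.symm])]
      constructor
      · rintro (hh | hh)
        · exact hh.1
        · exact absurd hh (c4 z hz)
      · intro hh; exact Or.inl ⟨hh, by simp [hws, hzw.symm]⟩
    have hwnot : w ∉ s → insert w s ∉ K'.faces := by
      intro hws hh
      have hw12 : w ≠ w1 ∧ w ≠ w2 := by
        obtain ⟨hK, -, -⟩ := CutData.DD_face
          (h.cut.proper_DD (s := ∅) (by simp) (by simp))
        have := h.nin hK
        simp only [Finset.mem_insert, not_or] at this
        exact ⟨fun hh => this.1.1 hh.symm, fun hh => this.2.1 hh.symm⟩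
      rw [h.m0 _ (by simp [h1, hw12.1.symm]) (by simp [h2, hw12.2.symm])] at hh
      rcases hh with hh | hh
      · exact hh.2 (by simp)
      · exact c4 w hws hh
    have nw : ∀ z, insert z s ∈ K.faces → z ≠ w1 ∧ z ≠ w2 := by
      intro z hz
      have := h.nin hz
      simp only [Finset.mem_insert, not_or] at this
      exact ⟨fun hh => this.1.1 hh.symm, fun hh => this.2.1 hh.symm⟩
    have mm1 : insert w1 s ∈ K'.faces ↔ (insert w s ∈ K.faces ∧ P s) := by
      rw [h.m1 s h1 h2]
      constructor
      · rintro (hh | hh)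
        · exact ⟨(DD_card3 h3 hh).2.1, (DD_card3 h3 hh).2.2⟩
        · exact absurd hh hsγ
      · rintro ⟨a, b⟩; exact Or.inl ⟨s, hws, h3, a, b, subset_rfl⟩
    have mm2 : insert w2 s ∈ K'.faces ↔ (insert w s ∈ K.faces ∧ ¬ P s) := by
      rw [h.m2 s h1 h2]
      constructor
      · rintro (hh | hh)
        · exact ⟨(DD_card3 h3 hh).2.1, (DD_card3 (P := fun T => ¬ P T) h3 hh).2.2⟩
        · exact absurd hh hsγ
      · rintro ⟨a, b⟩; exact Or.inl ⟨s, hws, h3, a, b, subset_rfl⟩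
    by_cases hwK : insert w s ∈ K.faces
    · have : ∃ p, p ≠ w ∧ p ∉ s ∧ insert p s ∈ K.faces ∧
          ∀ z, z ∉ s → insert z s ∈ K.faces → z = w ∨ z = p := by
        rcases hall w hws hwK with rfl | rfl
        · exact ⟨y, hxy.symm, hy, hyK, hall⟩
        · exact ⟨x, hxy, hx, hxK, fun z a b => (hall z a b).symm⟩
      obtain ⟨p, hpw, hp, hpK, hall'⟩ := this
      by_cases hPs : P s
      · refine ⟨w1, p, (nw p hpK).1.symm, h1, hp, mm1.mpr ⟨hwK, hPs⟩,
          (old p hp hpw (nw p hpK).1 (nw p hpK).2).mpr hpK, ?_⟩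
        intro z hz hzK
        by_cases z1 : z = w1
        · exact Or.inl z1
        by_cases z2 : z = w2
        · subst z2; exact absurd hPs (mm2.mp hzK).2
        by_cases zw : z = w
        · subst zw; exact absurd hzK (hwnot hws)
        rcases hall' z hz ((old z hz zw z1 z2).mp hzK) with hh | hh
        · exact absurd hh zw
        · exact Or.inr hh
      · refine ⟨w2, p, (nw p hpK).2.symm, h2, hp, mm2.mpr ⟨hwK, hPs⟩,
          (old p hp hpw (nw p hpK).1 (nw p hpK).2).mpr hpK, ?_⟩
        intro z hz hzK
        by_cases z2 : z = w2
        · exact Or.inl z2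
        by_cases z1 : z = w1
        · subst z1; exact absurd (mm1.mp hzK).2 hPs
        by_cases zw : z = w
        · subst zw; exact absurd hzK (hwnot hws)
        rcases hall' z hz ((old z hz zw z1 z2).mp hzK) with hh | hh
        · exact absurd hh zw
        · exact Or.inr hh
    · have hxw : x ≠ w := by rintro rfl; exact hwK hxK
      have hyw : y ≠ w := by rintro rfl; exact hwK hyK
      refine ⟨x, y, hxy, hx, hy, (old x hx hxw (nw x hxK).1 (nw x hxK).2).mpr hxK,
        (old y hy hyw (nw y hyK).1 (nw y hyK).2).mpr hyK, ?_⟩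
      intro z hz hzK
      by_cases z1 : z = w1
      · subst z1; exact absurd (mm1.mp hzK).1 hwK
      by_cases z2 : z = w2
      · subst z2; exact absurd (mm2.mp hzK).1 hwK
      by_cases zw : z = w
      · subst zw; exact absurd hzK (hwnot hws)
      exact hall z hz ((old z hz zw z1 z2).mp hzK)
  · refine ⟨w1, w2, h.h12, h1, h2, h.m1' (Or.inr subset_rfl), h.swap.m1' (Or.inr subset_rfl), ?_⟩
    intro z hz hzK
    by_contra hc
    rw [not_or] at hc
    rw [h.m0 _ (by simp [h1, Ne.symm hc.1]) (by simp [h2, Ne.symm hc.2])] at hzK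
    rcases hzK with hh | hh
    · exact h.cut.hγK (down hh.1 (Finset.subset_insert _ _) (by rw [← Finset.card_pos]; omega))
    · exact c4 z hz hh

/-- connectivity of links at simplices containing `w1`. -/
theorem cn1 (h : CutRes K w γ P w1 w2 K') {s : Finset ℕ} (hs : s ∈ K'.faces) (h2 : s.card ≤ 2)
    (hw : w1 ∈ s) : K'.Cn s := by
  obtain ⟨r, rfl, hr1, hr2, hr⟩ := h.m1e hs hw
  have hc : r.card ≤ 1 := by rw [Finset.card_insert_of_notMem hr1] at h2; omega
  intro x y hx hy hxK hyK
  have conv : ∀ z, z ∉ insert w1 r → insert z (insert w1 r) ∈ K'.faces →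
      z ∉ r ∧ DD K w P (insert z r) := by
    intro z hz hzK
    have hz' : z ≠ w1 ∧ z ∉ r := by simpa using hz
    have hz2 : z ≠ w2 := by rintro rfl; exact h.m12 _ hzK (by simp) (by simp)
    rw [Finset.insert_comm, h.m1 _ (by simp [hr1, hz'.1.symm]) (by simp [hr2, hz2.symm])] at hzK
    refine ⟨hz'.2, hzK.elim id (fun hh => h.cut.proper_DD hh ?_)⟩
    rw [Finset.card_insert_of_notMem hz'.2]; omega
  have adj : ∀ p q, p ∉ r → q ∉ r → (DD K w P (insert p (insert q r)) ∨ insert p (insert q r) ⊆ γ) →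
      K'.LA (insert w1 r) p q := by
    intro p q hp hq hd
    have h1 := (h.ninD hd).1
    simp only [Finset.mem_insert, not_or] at h1
    refine ⟨by simp [hp, Ne.symm h1.1], by simp [hq, Ne.symm h1.2.1], ?_⟩
    have e : insert p (insert q (insert w1 r)) = insert w1 (insert p (insert q r)) := by
      ext z; simp only [Finset.mem_insert]; tauto
    rw [e]; exact h.m1' hd
  obtain ⟨hxr, T1, a1, a2, a3, a4, a5⟩ := conv x hx hxK
  obtain ⟨hyr, T2, b1, b2, b3, b4, b5⟩ := conv y hy hyK
  have r1 : r ⊆ T1 := (Finset.subset_insert _ _).trans a5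
  have r2 : r ⊆ T2 := (Finset.subset_insert _ _).trans b5
  have hwr : w ∉ r := fun hh => a1 (r1 hh)
  have hchain := h.cut.nrm.sc (insert w r) (by rw [Finset.card_insert_of_notMem hwr]; omega)
    (insert w T1) (insert w T2) a3 b3
    (by rw [Finset.card_insert_of_notMem a1]; omega)
    (by rw [Finset.card_insert_of_notMem b1]; omega)
    (Finset.insert_subset_insert _ r1) (Finset.insert_subset_insert _ r2)
  have inT : ∀ T, w ∉ T → T.card = 3 → insert w T ∈ K.faces → P T → r ⊆ T →
      ∀ p ∈ T, ∀ q ∈ T, p ∉ r → q ∉ r → K'.LA (insert w1 r) p q := by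
    intro T t1 t2 t3 t4 t5 p hp q hq hpr hqr
    exact adj p q hpr hqr (Or.inl ⟨T, t1, t2, t3, t4,
      Finset.insert_subset hp (Finset.insert_subset hq t5)⟩)
  have inγ : r ⊆ γ → ∀ p ∈ γ, ∀ q ∈ γ, p ∉ r → q ∉ r → K'.LA (insert w1 r) p q := by
    intro t5 p hp q hq hpr hqr
    exact adj p q hpr hqr (Or.inr (Finset.insert_subset hp (Finset.insert_subset hq t5)))
  have key : ∀ H, ReflTransGen (K.FA (insert w r)) (insert w T1) H →
      (P (H.erase w) → ∀ q ∈ H.erase w, q ∉ r → ReflTransGen (K'.LA (insert w1 r)) x q) ∧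
      (¬ P (H.erase w) → r ⊆ γ ∧ ∀ q ∈ γ, q ∉ r → ReflTransGen (K'.LA (insert w1 r)) x q) := by
    intro H hH
    induction hH with
    | refl =>
      rw [Finset.erase_insert a1]
      refine ⟨fun _ q hq hqr => .single (inT T1 a1 a2 a3 a4 r1 x (a5 (by simp)) q hq hxr hqr),
        fun hh => absurd a4 hh⟩
    | tail h3 h4 ih =>
      rename_i A B
      obtain ⟨c1, c2, c3, c4, c5, c6, c7⟩ := h.cut.step hwr h4
      obtain ⟨p, hp, hpr⟩ := exists_mem_notMem_of_card (s := r)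
        (F := A.erase w ∩ B.erase w) (by omega)
      rw [Finset.mem_inter] at hp
      have rB : r ⊆ B.erase w := c1.trans Finset.inter_subset_right
      by_cases hA : P (A.erase w)
      · have hxp := ih.1 hA p hp.1 hpr
        constructor
        · intro hB q hq hqr
          exact hxp.tail (inT _ (by simp) c4 c6 hB rB p hp.2 q hq hpr hqr)
        · intro hB
          have hsub : A.erase w ∩ B.erase w ⊆ γ := by
            by_contra hh
            exact hB ((c7.mpr hh).mp hA)
          refine ⟨c1.trans hsub, fun q hq hqr => hxp.tail ?_⟩
          exact inγ (c1.trans hsub) p (hsub (Finset.mem_inter.mpr hp)) q hq hpr hqr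
      · obtain ⟨i1, i2⟩ := ih.2 hA
        constructor
        · intro hB q hq hqr
          have hsub : A.erase w ∩ B.erase w ⊆ γ := by
            by_contra hh
            exact hA ((c7.mpr hh).mpr hB)
          exact (i2 p (hsub (Finset.mem_inter.mpr hp)) hpr).tail
            (inT _ (by simp) c4 c6 hB rB p hp.2 q hq hpr hqr)
        · intro hB
          exact ⟨i1, i2⟩
  have := (key _ hchain).1
  rw [Finset.erase_insert b1] at this
  exact this b4 y (b5 (by simp)) hyr

theorem cn0 (h : CutRes K w γ P w1 w2 K') {s : Finset ℕ} (hs : s = ∅ ∨ s ∈ K'.faces)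
    (hc : s.card ≤ 2) (h1 : w1 ∉ s) (h2 : w2 ∉ s) : K'.Cn s := by
  have hsK : s = ∅ ∨ s ∈ K.faces := by
    rcases hs with hs | hs
    · exact Or.inl hs
    · rcases (h.m0 s h1 h2).mp hs with hh | hh
      · exact Or.inr hh.1
      · rw [hh, h.cut.hγ] at hc; omega
  have hws : w ∉ s := by
    rcases hs with hs | hs
    · simp [hs]
    · rcases (h.m0 s h1 h2).mp hs with hh | hh
      · exact hh.2
      · rw [hh, h.cut.hγ] at hc; omega
  have hwK : ∀ r, r = (∅ : Finset ℕ) → insert w r ∈ K.faces := by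
    rintro r rfl
    exact (CutData.DD_face (h.cut.proper_DD (s := ∅) (by simp) (by simp))).1
  -- w1 ~ w2
  have a12 : insert w1 s ∈ K'.faces → insert w2 s ∈ K'.faces →
      ReflTransGen (K'.LA s) w1 w2 ∧ ReflTransGen (K'.LA s) w2 w1 := by
    intro b1 b2
    have hsγ : s ⊆ γ := by
      rcases (h.m1 s h1 h2).mp b1 with d1 | d1
      · rcases (h.m2 s h1 h2).mp b2 with d2 | d2
        · exact h.cut.cross hc d1 d2
        · exact d2
      · exact d1
    obtain ⟨z, hz, hzs⟩ := exists_mem_notMem_of_card (s := s) (F := γ) (by rw [h.cut.hγ]; omega)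
    have e1 : K'.LA s w1 z := ⟨h1, hzs, h.m1' (Or.inr (Finset.insert_subset hz hsγ))⟩
    have e2 : K'.LA s w2 z := ⟨h2, hzs, h.swap.m1' (Or.inr (Finset.insert_subset hz hsγ))⟩
    exact ⟨.tail (.single e1) e2.symm, .tail (.single e2) e1.symm⟩
  let Rep : ℕ → ℕ → Prop := fun p p' =>
    (p ≠ w ∧ p' = p) ∨ (p = w ∧ ((p' = w1 ∧ insert w1 s ∈ K'.faces) ∨ (p' = w2 ∧ insert w2 s ∈ K'.faces)))
  have repR : ∀ p p' p'', Rep p p' → Rep p p'' → ReflTransGen (K'.LA s) p' p'' := by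
    rintro p p' p'' (⟨i1, rfl⟩ | ⟨rfl, ⟨rfl, i2⟩ | ⟨rfl, i2⟩⟩) (⟨j1, rfl⟩ | ⟨j0, ⟨rfl, j2⟩ | ⟨rfl, j2⟩⟩)
    all_goals first
      | exact .refl
      | exact absurd rfl i1
      | exact absurd rfl j1
      | exact absurd j0 i1
      | exact (a12 i2 j2).1
      | exact (a12 j2 i2).2
  have wstep : ∀ p, p ≠ w → K.LA s p w → ∃ w', Rep w w' ∧ K'.LA s p w' := by
    intro p hpw hp
    obtain ⟨i1, i2, i3⟩ := hp
    rw [Finset.insert_comm] at i3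
    rcases h.cut.DD_or i3 (by simp [hws, hpw.symm]) with hd | hd
    · have hm := h.m1' (Or.inl hd)
      refine ⟨w1, Or.inr ⟨rfl, Or.inl ⟨rfl, down hm (Finset.insert_subset_insert _ (Finset.subset_insert _ _)) (by simp)⟩⟩, ?_⟩
      exact LA.symm ⟨h1, i1, hm⟩
    · have hm := h.swap.m1' (Or.inl hd)
      refine ⟨w2, Or.inr ⟨rfl, Or.inr ⟨rfl, down hm (Finset.insert_subset_insert _ (Finset.subset_insert _ _)) (by simp)⟩⟩, ?_⟩
      exact LA.symm ⟨h2, i1, hm⟩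
  have ostep : ∀ p q, p ≠ w → q ≠ w → K.LA s p q → K'.LA s p q := by
    rintro p q hp hq ⟨i1, i2, i3⟩
    refine ⟨i1, i2, (h.m0 _ (h.nin i3).1 (h.nin i3).2).mpr (Or.inl ⟨i3, ?_⟩)⟩
    simp [hp.symm, hq.symm, hws]
  have path : ∀ x x', Rep x x' → ∀ q, ReflTransGen (K.LA s) x q → ∀ q', Rep q q' →
      ReflTransGen (K'.LA s) x' q' := by
    intro x x' hx q hq
    induction hq with
    | refl => intro q' hq'; exact repR _ _ _ hx hq'
    | tail h3 h4 ih =>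
      rename_i p q
      intro q' hq'
      by_cases hp : p = w
      · by_cases hqw : q = w
        · subst hqw; subst hp; exact ih q' hq'
        · subst hp
          obtain ⟨w', hw', hl⟩ := wstep q hqw h4.symm
          have : q' = q := by
            rcases hq' with hh | hh
            · exact hh.2
            · exact absurd hh.1 hqw
          rw [this]
          exact (ih w' hw').tail hl.symm
      · have hpp := ih p (Or.inl ⟨hp, rfl⟩)
        by_cases hqw : q = w
        · subst hqw
          obtain ⟨w', hw', hl⟩ := wstep p hp h4
          exact (hpp.tail hl).trans (repR _ _ _ hw' hq')
        · have : q' = q := by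
            rcases hq' with hh | hh
            · exact hh.2
            · exact absurd hh.1 hqw
          rw [this]
          exact hpp.tail (ostep p q hp hqw h4)
  have insw : s ⊆ γ → insert w s ∈ K.faces := fun hh =>
    (CutData.DD_face (h.cut.proper_DD hh hc)).1
  have norm : ∀ y, y ∉ s → insert y s ∈ K'.faces → ∃ q q', q ∉ s ∧ insert q s ∈ K.faces ∧
      Rep q q' ∧ ReflTransGen (K'.LA s) y q' ∧ ReflTransGen (K'.LA s) q' y := by
    intro y hy hyK
    by_cases y1 : y = w1
    · subst y1
      refine ⟨w, y, hws, ?_, Or.inr ⟨rfl, Or.inl ⟨rfl, hyK⟩⟩, .refl, .refl⟩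
      rcases (h.m1 s h1 h2).mp hyK with hd | hd
      · exact (CutData.DD_face hd).1
      · exact insw hd
    by_cases y2 : y = w2
    · subst y2
      refine ⟨w, y, hws, ?_, Or.inr ⟨rfl, Or.inr ⟨rfl, hyK⟩⟩, .refl, .refl⟩
      rcases (h.m2 s h1 h2).mp hyK with hd | hd
      · exact (CutData.DD_face hd).1
      · exact insw hd
    rcases (h.m0 _ (by simp [h1, Ne.symm y1]) (by simp [h2, Ne.symm y2])).mp hyK with hh | hh
    · refine ⟨y, y, hy, hh.1, Or.inl ⟨?_, rfl⟩, .refl, .refl⟩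
      rintro rfl; exact hh.2 (by simp)
    · have hsγ : s ⊆ γ := hh ▸ Finset.subset_insert _ _
      have hl : K'.LA s w1 y := ⟨h1, hy, by rw [hh]; exact h.m1' (Or.inr subset_rfl)⟩
      exact ⟨w, w1, hws, insw hsγ, Or.inr ⟨rfl, Or.inl ⟨rfl, h.m1' (Or.inr hsγ)⟩⟩,
        .single hl.symm, .single hl⟩
  intro x y hx hy hxK hyK
  obtain ⟨q, q', a1, a2, a3, a4, a5⟩ := norm x hx hxK
  obtain ⟨r, r', b1, b2, b3, b4, b5⟩ := norm y hy hyK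
  exact (a4.trans (path q q' a3 r (h.cut.nrm.cn s hsK hc q r a1 b1 a2 b2) r' b3)).trans b5

theorem nrm (h : CutRes K w γ P w1 w2 K') : K'.Nrm := by
  refine ⟨⟨γ, (h.m0 γ h.ninγ.1 h.ninγ.2).mpr (Or.inr rfl)⟩, fun s hs => (h.pureK hs).1,
    fun s hs => (h.pureK hs).2, ?_, ?_⟩
  · intro s hs hs3
    by_cases h1 : w1 ∈ s
    · exact h.two1 hs hs3 h1
    by_cases h2 : w2 ∈ s
    · exact h.swap.two1 hs hs3 h2
    exact h.two0 hs hs3 h1 h2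
  · intro s hs hs2
    by_cases h1 : w1 ∈ s
    · exact h.cn1 (hs.resolve_left (by rintro rfl; simp at h1)) hs2 h1
    by_cases h2 : w2 ∈ s
    · exact h.swap.cn1 (hs.resolve_left (by rintro rfl; simp at h2)) hs2 h2
    exact h.cn0 hs hs2 h1 h2

theorem g2_lt (h : CutRes K w γ P w1 w2 K') : K'.g2 < K.g2 := by
  classical
  have hwK : {w} ∈ K.faces :=
    (CutData.DD_face (h.cut.proper_DD (s := ∅) (by simp) (by simp))).1
  -- vertices
  have hv : K.fnum 0 + 1 ≤ K'.fnum 0 := by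
    have hsub : ((K.faces.filter fun s => s.card = 0 + 1).erase {w}) ∪ {{w1}, {w2}} ⊆
        K'.faces.filter fun s => s.card = 0 + 1 := by
      intro s hs
      simp only [Finset.mem_union, Finset.mem_erase, Finset.mem_filter, Finset.mem_insert,
        Finset.mem_singleton] at hs ⊢
      rcases hs with ⟨hs1, hs2, hs3⟩ | rfl | rfl
      · refine ⟨(h.m0 s (h.nin hs2).1 (h.nin hs2).2).mpr (Or.inl ⟨hs2, ?_⟩), hs3⟩
        intro hws
        obtain ⟨x, rfl⟩ := Finset.card_eq_one.mp hs3
        rw [Finset.mem_singleton] at hws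
        exact hs1 (by rw [hws])
      · exact ⟨h.m1' (s := ∅) (Or.inr (by simp)), by simp⟩
      · exact ⟨h.swap.m1' (s := ∅) (Or.inr (by simp)), by simp⟩
    have hcard := Finset.card_le_card hsub
    rw [Finset.card_union_of_disjoint, Finset.card_erase_of_mem (by simp [hwK]),
      Finset.card_pair (by simp [h.h12])] at hcard
    · have : 0 < (K.faces.filter fun s => s.card = 0 + 1).card :=
        Finset.card_pos.mpr ⟨{w}, by simp [hwK]⟩
      unfold fnum; omega
    · rw [Finset.disjoint_left]
      intro s hs hs'
      simp only [Finset.mem_insert, Finset.mem_singleton, Finset.mem_erase,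
        Finset.mem_filter] at hs hs'
      have := h.nin hs.2.1
      rcases hs' with rfl | rfl <;> simp at this
  -- edges
  set V := K.vertexSet with hV
  set A := K.faces.filter (fun s => s.card = 2 ∧ w ∉ s) with hA
  set V1 := V.filter (fun x => DD K w P {x}) with hV1
  set V2 := V.filter (fun x => DD K w (fun T => ¬ P T) {x}) with hV2
  have e1 : A.card + (V1 ∪ V2).card ≤ K.fnum 1 := by
    have hsub : A ∪ (V1 ∪ V2).image (fun x => ({w, x} : Finset ℕ)) ⊆
        K.faces.filter fun s => s.card = 1 + 1 := by
      intro s hs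
      rw [Finset.mem_union] at hs
      rcases hs with hs | hs
      · rw [hA, Finset.mem_filter] at hs
        exact Finset.mem_filter.mpr ⟨hs.1, hs.2.1⟩
      · obtain ⟨x, hx, rfl⟩ := Finset.mem_image.mp hs
        have : insert w {x} ∈ K.faces ∧ w ∉ ({x} : Finset ℕ) := by
          rw [Finset.mem_union, hV1, hV2, Finset.mem_filter, Finset.mem_filter] at hx
          rcases hx with hx | hx
          · exact ⟨(CutData.DD_face hx.2).1, (CutData.DD_face hx.2).2.1⟩
          · exact ⟨(CutData.DD_face hx.2).1, (CutData.DD_face hx.2).2.1⟩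
        exact Finset.mem_filter.mpr ⟨this.1, Finset.card_pair (by simpa using this.2)⟩
    have hcard := Finset.card_le_card hsub
    rw [Finset.card_union_of_disjoint, Finset.card_image_of_injOn] at hcard
    · exact hcard
    · intro x hx y hy hxy
      have : ∀ z ∈ V1 ∪ V2, z ≠ w := by
        intro z hz
        rw [Finset.mem_union, hV1, hV2, Finset.mem_filter, Finset.mem_filter] at hz
        rintro rfl
        rcases hz with hz | hz
        · exact (CutData.DD_face hz.2).2.1 (by simp)
        · exact (CutData.DD_face hz.2).2.1 (by simp)
      have hx' := this x hx
      have : x ∈ ({w, y} : Finset ℕ) := by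
        have hxy : ({w, x} : Finset ℕ) = {w, y} := hxy
        rw [← hxy]; simp
      simpa [hx'] using this
    · rw [Finset.disjoint_left]
      intro s hs hs'
      obtain ⟨x, hx, rfl⟩ := Finset.mem_image.mp hs'
      rw [hA, Finset.mem_filter] at hs
      exact hs.2.2 (by simp)
  have e2 : K'.fnum 1 ≤ A.card + V1.card + V2.card := by
    have hsub : (K'.faces.filter fun s => s.card = 1 + 1) ⊆
        (A ∪ V1.image (fun x => ({w1, x} : Finset ℕ))) ∪ V2.image (fun x => ({w2, x} : Finset ℕ)) := by
      intro s hs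
      rw [Finset.mem_filter] at hs
      obtain ⟨hs, hs2⟩ := hs
      have side : ∀ {w1 w2 P} (h : CutRes K w γ P w1 w2 K'), w1 ∈ s →
          s ∈ (V.filter (fun x => DD K w P {x})).image (fun x => ({w1, x} : Finset ℕ)) := by
        intro w1 w2 P h hw1
        obtain ⟨r, rfl, b1, b2, b3⟩ := h.m1e hs hw1
        rw [Finset.card_insert_of_notMem b1] at hs2
        obtain ⟨x, rfl⟩ := Finset.card_eq_one.mp (by omega : r.card = 1)
        have hd : DD K w P {x} := b3.elim id (fun hh => h.cut.proper_DD hh (by simp))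
        refine Finset.mem_image.mpr ⟨x, Finset.mem_filter.mpr ⟨?_, hd⟩, rfl⟩
        exact subset_vertexSet (CutData.DD_face hd).1 (by simp)
      by_cases h1 : w1 ∈ s
      · exact Finset.mem_union_left _ (Finset.mem_union_right _ (side h h1))
      by_cases h2 : w2 ∈ s
      · exact Finset.mem_union_right _ (side h.swap h2)
      · refine Finset.mem_union_left _ (Finset.mem_union_left _ ?_)
        rcases (h.m0 s h1 h2).mp hs with hh | hh
        · exact Finset.mem_filter.mpr ⟨hh.1, hs2, hh.2⟩
        · rw [hh, h.cut.hγ] at hs2; omega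
    have hcard := Finset.card_le_card hsub
    have c1 := Finset.card_union_le (A ∪ V1.image (fun x => ({w1, x} : Finset ℕ)))
      (V2.image (fun x => ({w2, x} : Finset ℕ)))
    have c2 := Finset.card_union_le A (V1.image (fun x => ({w1, x} : Finset ℕ)))
    have c3 := Finset.card_image_le (s := V1) (f := fun x => ({w1, x} : Finset ℕ))
    have c4 := Finset.card_image_le (s := V2) (f := fun x => ({w2, x} : Finset ℕ))
    unfold fnum; omega
  have e3 : (V1 ∩ V2).card ≤ 3 := by
    rw [← h.cut.hγ]
    refine Finset.card_le_card ?_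
    intro x hx
    rw [Finset.mem_inter, hV1, hV2, Finset.mem_filter, Finset.mem_filter] at hx
    simpa using h.cut.cross (s := {x}) (by simp) hx.1.2 hx.2.2
  have e4 := Finset.card_union_add_card_inter V1 V2
  unfold g2
  omega

end CutRes

theorem cut_false {K : SComplex} (hK : InClassR K) {w : ℕ} {γ : Finset ℕ} {P : Finset ℕ → Prop}
    (h : CutData K w γ P) : False := by
  classical
  obtain ⟨w1, hw1⟩ : ∃ w1, w1 ∉ K.vertexSet := Infinite.exists_notMem_finset _
  obtain ⟨w2, hw2⟩ : ∃ w2, w2 ∉ insert w1 K.vertexSet := Infinite.exists_notMem_finset _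
  rw [Finset.mem_insert, not_or] at hw2
  obtain ⟨h21, hw2⟩ := hw2
  have nin : ∀ {s}, s ∈ K.faces → w1 ∉ s ∧ w2 ∉ s := fun hs =>
    ⟨fun hh => hw1 (subset_vertexSet hs hh), fun hh => hw2 (subset_vertexSet hs hh)⟩
  have hwK : {w} ∈ K.faces :=
    (CutData.DD_face (h.proper_DD (s := ∅) (by simp) (by simp))).1
  have ninD : ∀ {P' s}, DD K w P' s → w1 ∉ s ∧ w2 ∉ s := by
    intro P' s hs
    have := nin (CutData.DD_face hs).1
    simp only [Finset.mem_insert, not_or] at this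
    exact ⟨this.1.2, this.2.2⟩
  have ninγ : w1 ∉ γ ∧ w2 ∉ γ := by
    constructor
    · intro hh; exact (ninD (h.proper_DD (s := {w1}) (by simpa using hh) (by simp))).1 (by simp)
    · intro hh; exact (ninD (h.proper_DD (s := {w2}) (by simpa using hh) (by simp))).2 (by simp)
  have γV : γ ⊆ K.vertexSet := by
    intro x hx
    have := (CutData.DD_face (h.proper_DD (s := {x}) (by simpa using hx) (by simp))).1
    exact subset_vertexSet this (by simp)
  have DV : ∀ {P' s}, DD K w P' s → s ⊆ K.vertexSet := by
    intro P' s hs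
    exact (Finset.subset_insert _ _).trans (subset_vertexSet (CutData.DD_face hs).1)
  let V := insert w1 (insert w2 K.vertexSet)
  have VV : K.vertexSet ⊆ V := (Finset.subset_insert _ _).trans (Finset.subset_insert _ _)
  -- predicate for M
  let pM : Finset ℕ → Prop := fun s =>
    (w1 ∉ s ∧ w2 ∉ s ∧ s ∈ K.faces ∧ w ∉ s) ∨
    (w1 ∈ s ∧ w2 ∉ s ∧ DD K w P (s.erase w1)) ∨
    (w1 ∉ s ∧ w2 ∈ s ∧ DD K w (fun T => ¬ P T) (s.erase w2)) ∨
    (w1 ∈ s ∧ w2 ∈ s ∧ (s.erase w1).erase w2 ⊆ γ ∧ (s.erase w1).erase w2 ≠ γ)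
  have DDK : ∀ {P' s}, DD K w P' s → s ≠ ∅ → s ∈ K.faces ∧ w ∉ s := by
    intro P' s hs hne
    have := CutData.DD_face hs
    exact ⟨down this.1 (Finset.subset_insert _ _) (Finset.nonempty_iff_ne_empty.mpr hne), this.2.1⟩
  have properc : ∀ s, s ⊆ γ → s ≠ γ → s.card ≤ 2 := by
    intro s hs hne
    have := Finset.card_lt_card (Finset.ssubset_iff_subset_ne.mpr ⟨hs, hne⟩)
    rw [h.hγ] at this; omega
  have hpM : ∀ s, pM s → ∀ t ⊆ s, t ≠ ∅ → pM t := by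
    intro s hs t hts hne
    by_cases t1 : w1 ∈ t
    · have s1 := hts t1
      by_cases t2 : w2 ∈ t
      · have s2 := hts t2
        rcases hs with hh | hh | hh | hh
        · exact absurd s1 hh.1
        · exact absurd s2 hh.2.1
        · exact absurd s1 hh.1
        · refine Or.inr (Or.inr (Or.inr ⟨t1, t2, ?_, ?_⟩))
          · exact (Finset.erase_subset_erase _ (Finset.erase_subset_erase _ hts)).trans hh.2.2.1
          · intro he
            apply hh.2.2.2
            refine Finset.Subset.antisymm hh.2.2.1 ?_
            rw [← he]
            exact Finset.erase_subset_erase _ (Finset.erase_subset_erase _ hts)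
      · refine Or.inr (Or.inl ⟨t1, t2, ?_⟩)
        rcases hs with hh | hh | hh | hh
        · exact absurd s1 hh.1
        · exact CutData.DD_mono hh.2.2 (Finset.erase_subset_erase _ hts)
        · exact absurd s1 hh.1
        · refine CutData.DD_mono (h.proper_DD hh.2.2.1 (properc _ hh.2.2.1 hh.2.2.2)) ?_
          intro z hz
          rw [Finset.mem_erase] at hz
          refine Finset.mem_erase.mpr ⟨?_, Finset.mem_erase.mpr ⟨hz.1, hts hz.2⟩⟩
          rintro rfl; exact t2 hz.2
    · by_cases t2 : w2 ∈ t
      · have s2 := hts t2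
        refine Or.inr (Or.inr (Or.inl ⟨t1, t2, ?_⟩))
        rcases hs with hh | hh | hh | hh
        · exact absurd s2 hh.2.1
        · exact absurd s2 hh.2.1
        · exact CutData.DD_mono hh.2.2 (Finset.erase_subset_erase _ hts)
        · refine CutData.DD_mono (h.swap.proper_DD hh.2.2.1 (properc _ hh.2.2.1 hh.2.2.2)) ?_
          intro z hz
          rw [Finset.mem_erase] at hz
          refine Finset.mem_erase.mpr ⟨hz.1, Finset.mem_erase.mpr ⟨?_, hts hz.2⟩⟩
          rintro rfl; exact t1 hz.2
      · refine Or.inl ⟨t1, t2, ?_⟩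
        rcases hs with hh | hh | hh | hh
        · exact ⟨down hh.2.2.1 hts (Finset.nonempty_iff_ne_empty.mpr hne), fun a => hh.2.2.2 (hts a)⟩
        · exact DDK (CutData.DD_mono hh.2.2 (fun z hz => Finset.mem_erase.mpr
            ⟨by rintro rfl; exact t1 hz, hts hz⟩)) hne
        · exact DDK (CutData.DD_mono hh.2.2 (fun z hz => Finset.mem_erase.mpr
            ⟨by rintro rfl; exact t2 hz, hts hz⟩)) hne
        · exact DDK (CutData.DD_mono (h.proper_DD hh.2.2.1 (properc _ hh.2.2.1 hh.2.2.2))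
            (fun z hz => Finset.mem_erase.mpr ⟨by rintro rfl; exact t2 hz, Finset.mem_erase.mpr
            ⟨by rintro rfl; exact t1 hz, hts hz⟩⟩)) hne
  let M := mk' V pM hpM
  have w1V : w1 ∈ V := by simp [V]
  have w2V : w2 ∈ V := by simp [V]
  have M0 : ∀ s, w1 ∉ s → w2 ∉ s → (s ∈ M.faces ↔ s ∈ K.faces ∧ w ∉ s) := by
    intro s h1 h2
    rw [mem_mk']
    constructor
    · rintro ⟨-, -, hh | hh | hh | hh⟩
      · exact hh.2.2
      · exact absurd hh.1 h1
      · exact absurd hh.2.1 h2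
      · exact absurd hh.1 h1
    · intro hh
      exact ⟨(subset_vertexSet hh.1).trans VV, ne_of_mem hh.1, Or.inl ⟨h1, h2, hh⟩⟩
  have M1 : ∀ s, w1 ∉ s → w2 ∉ s → (insert w1 s ∈ M.faces ↔ DD K w P s) := by
    intro s h1 h2
    have e : (insert w1 s).erase w1 = s := Finset.erase_insert h1
    have n2 : w2 ∉ insert w1 s := by simp [h2, h21]
    rw [mem_mk']
    constructor
    · rintro ⟨-, -, hh | hh | hh | hh⟩
      · exact absurd (Finset.mem_insert_self _ _) hh.1
      · rw [e] at hh; exact hh.2.2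
      · exact absurd (Finset.mem_insert_self _ _) hh.1
      · exact absurd hh.2.1 n2
    · intro hh
      exact ⟨Finset.insert_subset w1V ((DV hh).trans VV), by simp,
        Or.inr (Or.inl ⟨by simp, n2, by rw [e]; exact hh⟩)⟩
  have M2 : ∀ s, w1 ∉ s → w2 ∉ s → (insert w2 s ∈ M.faces ↔ DD K w (fun T => ¬ P T) s) := by
    intro s h1 h2
    have e : (insert w2 s).erase w2 = s := Finset.erase_insert h2
    have n1 : w1 ∉ insert w2 s := by simp [h1, Ne.symm h21]
    rw [mem_mk']
    constructor
    · rintro ⟨-, -, hh | hh | hh | hh⟩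
      · exact absurd (Finset.mem_insert_self _ _) hh.2.1
      · exact absurd (Finset.mem_insert_self _ _) hh.2.1
      · rw [e] at hh; exact hh.2.2
      · exact absurd hh.1 n1
    · intro hh
      exact ⟨Finset.insert_subset w2V ((DV hh).trans VV), by simp,
        Or.inr (Or.inr (Or.inl ⟨n1, by simp, by rw [e]; exact hh⟩))⟩
  have M12 : ∀ s, w1 ∉ s → w2 ∉ s → (insert w1 (insert w2 s) ∈ M.faces ↔ s ⊆ γ ∧ s ≠ γ) := by
    intro s h1 h2
    have e : ((insert w1 (insert w2 s)).erase w1).erase w2 = s := by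
      rw [Finset.erase_insert (by simp [h1, Ne.symm h21]), Finset.erase_insert h2]
    rw [mem_mk']
    constructor
    · rintro ⟨-, -, hh | hh | hh | hh⟩
      · exact absurd (Finset.mem_insert_self _ _) hh.1
      · exact absurd (by simp) hh.2.1
      · exact absurd (Finset.mem_insert_self _ _) hh.1
      · rw [e] at hh; exact hh.2.2
    · intro hh
      exact ⟨Finset.insert_subset w1V (Finset.insert_subset w2V ((hh.1.trans γV).trans VV)), by simp,
        Or.inr (Or.inr (Or.inr ⟨by simp, by simp, by rw [e]; exact hh⟩))⟩
  -- predicate for K'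
  let pK : Finset ℕ → Prop := fun s =>
    (¬ ({w1, w2} : Finset ℕ) ⊆ s ∧ s ∈ M.faces) ∨ s ⊆ insert w1 γ ∨ s ⊆ insert w2 γ
  have hpK : ∀ s, pK s → ∀ t ⊆ s, t ≠ ∅ → pK t := by
    intro s hs t hts hne
    rcases hs with hh | hh | hh
    · exact Or.inl ⟨fun a => hh.1 (a.trans hts), M.down_closed s hh.2 t hts hne⟩
    · exact Or.inr (Or.inl (hts.trans hh))
    · exact Or.inr (Or.inr (hts.trans hh))
  let K' := mk' V pK hpK
  have hKf : K'.faces = ((M.faces.filter fun α => ¬ ({w1, w2} : Finset ℕ) ⊆ α) ∪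
      simplexFaces (insert w1 γ)) ∪ simplexFaces (insert w2 γ) := by
    ext s
    simp only [K', mem_mk', Finset.mem_union, Finset.mem_filter, simplexFaces, Finset.mem_powerset,
      pK, ← Finset.nonempty_iff_ne_empty]
    constructor
    · rintro ⟨h1, h2, hh | hh | hh⟩
      · exact Or.inl (Or.inl ⟨hh.2, hh.1⟩)
      · exact Or.inl (Or.inr ⟨hh, h2⟩)
      · exact Or.inr ⟨hh, h2⟩
    · rintro ((hh | hh) | hh)
      · exact ⟨(mem_mk'.mp hh.1).1, (mem_mk'.mp hh.1).2.1, Or.inl ⟨hh.2, hh.1⟩⟩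
      · exact ⟨hh.1.trans (Finset.insert_subset w1V (γV.trans VV)), hh.2, Or.inr (Or.inl hh.1)⟩
      · exact ⟨hh.1.trans (Finset.insert_subset w2V (γV.trans VV)), hh.2, Or.inr (Or.inr hh.1)⟩
  have hne3 : γ ≠ ∅ := by
    intro h0; have := h.hγ; rw [h0] at this; simp at this
  have hres : CutRes K w γ P w1 w2 K' := by
    refine ⟨h, Ne.symm h21, hw1, hw2, ?_, ?_, ?_, ?_⟩
    · intro s h1 h2
      have sub : ∀ z, z ∉ s → (s ⊆ insert z γ ↔ s ⊆ γ) := fun z hz => by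
        rw [Finset.subset_insert_iff_of_notMem hz]
      have : s ∈ K'.faces ↔ s.Nonempty ∧ ((s ∈ K.faces ∧ w ∉ s) ∨ s ⊆ γ) := by
        rw [hKf]
        simp only [Finset.mem_union, Finset.mem_filter, simplexFaces, Finset.mem_powerset,
          ← Finset.nonempty_iff_ne_empty, sub w1 h1, sub w2 h2, M0 s h1 h2]
        have : ¬ ({w1, w2} : Finset ℕ) ⊆ s := fun hh => h1 (hh (by simp))
        constructor
        · rintro ((hh | hh) | hh)
          · exact ⟨ne_of_mem hh.1.1, Or.inl hh.1⟩
          · exact ⟨hh.2, Or.inr hh.1⟩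
          · exact ⟨hh.2, Or.inr hh.1⟩
        · rintro ⟨a, b | b⟩
          · exact Or.inl (Or.inl ⟨b, this⟩)
          · exact Or.inl (Or.inr ⟨b, a⟩)
      rw [this]
      constructor
      · rintro ⟨a, b | b⟩
        · exact Or.inl b
        · by_cases hs : s = γ
          · exact Or.inr hs
          · left
            exact DDK (h.proper_DD b (properc s b hs)) (Finset.nonempty_iff_ne_empty.mp a)
      · rintro (b | rfl)
        · exact ⟨ne_of_mem b.1, Or.inl b⟩
        · exact ⟨Finset.nonempty_iff_ne_empty.mpr hne3, Or.inr subset_rfl⟩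
    · intro s h1 h2
      rw [hKf]
      simp only [Finset.mem_union, Finset.mem_filter, simplexFaces, Finset.mem_powerset, M1 s h1 h2]
      have n12 : ¬ ({w1, w2} : Finset ℕ) ⊆ insert w1 s := fun hh => by
        have := hh (show w2 ∈ _ by simp)
        simp [h21, h2] at this
      constructor
      · rintro ((hh | hh) | hh)
        · exact Or.inl hh.1
        · right
          have := Finset.erase_subset_erase w1 hh.1
          rwa [Finset.erase_insert h1, Finset.erase_insert ninγ.1] at this
        · have := hh.1 (Finset.mem_insert_self _ _)
          simp [Ne.symm h21, ninγ.1] at this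
      · rintro (hh | hh)
        · exact Or.inl (Or.inl ⟨hh, n12⟩)
        · exact Or.inl (Or.inr ⟨Finset.insert_subset_insert _ hh, by simp⟩)
    · intro s h1 h2
      rw [hKf]
      simp only [Finset.mem_union, Finset.mem_filter, simplexFaces, Finset.mem_powerset, M2 s h1 h2]
      have n12 : ¬ ({w1, w2} : Finset ℕ) ⊆ insert w2 s := fun hh => by
        have := hh (show w1 ∈ _ by simp)
        simp [Ne.symm h21, h1] at this
      constructor
      · rintro ((hh | hh) | hh)
        · exact Or.inl hh.1
        · have := hh.1 (Finset.mem_insert_self _ _)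
          simp [h21, ninγ.2] at this
        · right
          have := Finset.erase_subset_erase w2 hh.1
          rwa [Finset.erase_insert h2, Finset.erase_insert ninγ.2] at this
      · rintro (hh | hh)
        · exact Or.inl (Or.inl ⟨hh, n12⟩)
        · exact Or.inr ⟨Finset.insert_subset_insert _ hh, by simp⟩
    · intro s hs h1 h2
      rw [hKf] at hs
      simp only [Finset.mem_union, Finset.mem_filter, simplexFaces, Finset.mem_powerset] at hs
      rcases hs with (hh | hh) | hh
      · apply hh.2
        intro z hz
        simp only [Finset.mem_insert, Finset.mem_singleton] at hz
        rcases hz with rfl | rfl <;> assumption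
      · have := hh.1 h2
        simp [h21, ninγ.2] at this
      · have := hh.1 h1
        simp [Ne.symm h21, ninγ.1] at this
  have hlk12 : ∀ s, s ∈ (M.lk {w1, w2}).faces ↔ s.Nonempty ∧ s ⊆ γ ∧ s ≠ γ := by
    intro s
    rw [mem_lk']
    have e : s ∪ {w1, w2} = insert w1 (insert w2 s) := by
      ext z; simp only [Finset.mem_union, Finset.mem_insert, Finset.mem_singleton]; tauto
    rw [e]
    constructor
    · rintro ⟨a, b, c⟩
      have nn : w1 ∉ s ∧ w2 ∉ s := by
        constructor <;> intro hh
        · have : w1 ∈ s ∩ {w1, w2} := by simp [hh]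
          rw [b] at this; simp at this
        · have : w2 ∈ s ∩ {w1, w2} := by simp [hh]
          rw [b] at this; simp at this
      exact ⟨a, (M12 s nn.1 nn.2).mp c⟩
    · rintro ⟨a, b, c⟩
      have nn : w1 ∉ s ∧ w2 ∉ s := ⟨fun hh => ninγ.1 (b hh), fun hh => ninγ.2 (b hh)⟩
      refine ⟨a, ?_, (M12 s nn.1 nn.2).mpr ⟨b, c⟩⟩
      ext z
      simp only [Finset.mem_inter, Finset.mem_insert, Finset.mem_singleton, Finset.notMem_empty,
        iff_false]
      rintro ⟨hz, rfl | rfl⟩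
      · exact nn.1 hz
      · exact nn.2 hz
  have h12M : ({w1, w2} : Finset ℕ) ∈ M.faces :=
    (M12 ∅ (by simp) (by simp)).mpr ⟨by simp, Ne.symm hne3⟩
  have hcon : EdgeContraction M K := by
    refine ⟨w1, w2, h12M, Ne.symm h21, ?_, w, ?_, ?_⟩
    · ext s
      rw [hlk12, Finset.mem_inter, mem_lk', mem_lk', Finset.union_comm, ← Finset.insert_eq,
        Finset.union_comm, ← Finset.insert_eq]
      constructor
      · rintro ⟨⟨a1, a2, a3⟩, b1, b2, b3⟩
        have n1 : w1 ∉ s := by intro hh; rw [Finset.inter_singleton_of_mem hh] at a2; simp at a2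
        have n2 : w2 ∉ s := by intro hh; rw [Finset.inter_singleton_of_mem hh] at b2; simp at b2
        rw [M1 s n1 n2] at a3
        rw [M2 s n1 n2] at b3
        have c3 := (CutData.DD_face a3).2.2
        have hs2 : s.card ≤ 2 := by
          by_contra hc
          exact (CutRes.DD_card3 (P := fun T => ¬ P T) (by omega) b3).2.2
            (CutRes.DD_card3 (by omega) a3).2.2
        refine ⟨a1, h.cross hs2 a3 b3, ?_⟩
        rintro rfl
        rw [h.hγ] at hs2; omega
      · rintro ⟨a, b, c⟩
        have n1 : w1 ∉ s := fun hh => ninγ.1 (b hh)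
        have n2 : w2 ∉ s := fun hh => ninγ.2 (b hh)
        refine ⟨⟨a, by simp [n1], ?_⟩, a, by simp [n2], ?_⟩
        · rw [M1 s n1 n2]; exact h.proper_DD b (properc s b c)
        · rw [M2 s n1 n2]; exact h.swap.proper_DD b (properc s b c)
    · intro hh
      have hh := mem_vertexSet.mp hh
      have n1 : w1 ∉ ({w} : Finset ℕ) := (nin hwK).1
      have n2 : w2 ∉ ({w} : Finset ℕ) := (nin hwK).2
      exact ((M0 _ n1 n2).mp hh).2 (by simp)
    · have : (M.faces.filter fun α => w1 ∉ α ∧ w2 ∉ α) = K.faces.filter fun α => w ∉ α := by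
        ext s
        simp only [Finset.mem_filter]
        constructor
        · rintro ⟨a, b, c⟩; exact (M0 s b c).mp a
        · intro hh; exact ⟨(M0 s (nin hh.1).1 (nin hh.1).2).mpr hh, nin hh.1⟩
      rw [this, bdry_del h.nrm]
      exact cone_del w hwK
  obtain ⟨a, b, c, hab, hac, hbc, rfl⟩ := Finset.card_eq_three.mp h.hγ
  have hbis : BistellarTwoMove M K' := by
    refine ⟨w1, w2, a, b, c, h12M, Ne.symm h21, h.hγ, ninγ.1, ninγ.2, ?_, ?_, hKf⟩
    · ext s
      rw [hlk12]
      simp only [properFaces, Finset.mem_filter, Finset.mem_powerset, Finset.nonempty_iff_ne_empty]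
      tauto
    · intro hh
      exact h.hγK ((M0 _ ninγ.1 ninγ.2).mp hh).1
  have := hK.2.2.2.2 K' hres.nrm.toNormal (Or.inr (Or.inr (Or.inl ⟨M, hcon, hbis⟩)))
  have := hres.g2_lt
  omega
end ModD

section ModE
open Relation

theorem cycle_avoid (V : Finset ℕ) (R : ℕ → ℕ → Prop) (hs : ∀ a b, R a b → R b a)
    (hir : ∀ a, ¬ R a a) (hV : ∀ a b, R a b → a ∈ V)
    (h2 : ∀ a b, R a b → ∃ x y, x ≠ y ∧ R a x ∧ R a y ∧ ∀ z, R a z → z = x ∨ z = y)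
    {v p q : ℕ} (hp : R v p) (hq : ∀ z, R v z → z = p ∨ z = q) :
    ReflTransGen (fun a b => a ≠ v ∧ b ≠ v ∧ R a b) p q := by
  classical
  let G : SimpleGraph {x // x ∈ V} :=
    { Adj := fun a b => R a b
      symm := ⟨fun a b h => hs _ _ h⟩
      loopless := ⟨fun a h => hir _ h⟩ }
  have hcyc : G.IsCycles := by
    rintro a ⟨b, hb⟩
    obtain ⟨x, y, hxy, hx, hy, hall⟩ := h2 a b hb
    have : G.neighborSet a = {⟨x, hV _ _ (hs _ _ hx)⟩, ⟨y, hV _ _ (hs _ _ hy)⟩} := by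
      ext ⟨z, hz⟩
      simp only [SimpleGraph.mem_neighborSet, Set.mem_insert_iff, Set.mem_singleton_iff,
        Subtype.mk.injEq]
      constructor
      · intro h; exact hall z h
      · rintro (rfl | rfl)
        · exact hx
        · exact hy
    rw [this, Set.ncard_pair]
    simpa using hxy
  have hadj : G.Adj ⟨v, hV _ _ hp⟩ ⟨p, hV _ _ (hs _ _ hp)⟩ := hp
  have hr := (hcyc.reachable_deleteEdges hadj).symm
  rw [SimpleGraph.reachable_iff_reflTransGen] at hr
  have hpv : p ≠ v := by rintro rfl; exact hir _ hp
  set r := fun a b => a ≠ v ∧ b ≠ v ∧ R a b with hrdef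
  have key : ∀ x : {x // x ∈ V},
      ReflTransGen (G.deleteEdges {s(⟨v, hV _ _ hp⟩, ⟨p, hV _ _ (hs _ _ hp)⟩)}).Adj
        ⟨p, hV _ _ (hs _ _ hp)⟩ x →
      ((x : ℕ) ≠ v ∧ ReflTransGen r p x) ∨ ReflTransGen r p q := by
    intro x hx
    induction hx with
    | refl => exact Or.inl ⟨hpv, .refl⟩
    | tail h3 h4 ih =>
      rename_i a b
      rcases ih with ⟨i1, i2⟩ | ih
      · rw [SimpleGraph.deleteEdges_adj] at h4
        obtain ⟨h4, h5⟩ := h4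
        have h4 : R a b := h4
        by_cases hb : (b : ℕ) = v
        · have : (a : ℕ) = q := by
            rcases hq a (hb ▸ hs _ _ h4) with h | h
            · exfalso
              apply h5
              have ea : a = ⟨p, hV _ _ (hs _ _ hp)⟩ := Subtype.ext h
              have eb : b = ⟨v, hV _ _ hp⟩ := Subtype.ext hb
              rw [ea, eb, Sym2.eq_swap]; rfl
            · exact h
          exact Or.inr (this ▸ i2)
        · exact Or.inl ⟨hb, i2.tail ⟨i1, hb, h4⟩⟩
      · exact Or.inr ih
  rcases key _ hr with h | h
  · exact absurd rfl h.1
  · exact h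

/-- Link of an edge minus a vertex is connected. -/
theorem Nrm.cn_avoid {K : SComplex} (h : K.Nrm) {e : Finset ℕ} (he : e.card = 2) {v : ℕ}
    (hv : v ∉ e) (hvK : insert v e ∈ K.faces) {x y : ℕ} (hx : x ∉ e) (hy : y ∉ e) (hxv : x ≠ v)
    (hyv : y ≠ v) (hxK : insert x e ∈ K.faces) (hyK : insert y e ∈ K.faces) :
    ReflTransGen (fun a b => a ≠ v ∧ b ≠ v ∧ K.LA e a b) x y := by
  have heK : e ∈ K.faces := down hvK (Finset.subset_insert _ _) (by rw [← Finset.card_pos]; omega)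
  have c3 : ∀ a, a ∉ e → (insert a e).card = 3 := fun a ha => by
    rw [Finset.card_insert_of_notMem ha]; omega
  let R : ℕ → ℕ → Prop := fun a b => a ≠ b ∧ K.LA e a b
  have hs : ∀ a b, R a b → R b a := fun a b hab => ⟨hab.1.symm, hab.2.symm⟩
  have h2 : ∀ a, a ∉ e → insert a e ∈ K.faces →
      ∃ x y, x ≠ y ∧ R a x ∧ R a y ∧ ∀ z, R a z → z = x ∨ z = y := by
    intro a ha haK
    obtain ⟨x, y, hxy, hx, hy, hxK, hyK, hall⟩ := h.two _ haK (c3 a ha)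
    have hx' : x ≠ a ∧ x ∉ e := by simpa using hx
    have hy' : y ≠ a ∧ y ∉ e := by simpa using hy
    refine ⟨x, y, hxy, ⟨hx'.1.symm, LA.symm ⟨hx'.2, ha, hxK⟩⟩,
      ⟨hy'.1.symm, LA.symm ⟨hy'.2, ha, hyK⟩⟩, ?_⟩
    rintro z ⟨hz, hzl⟩
    have := hzl.symm
    exact hall z (by simp [hz.symm, this.1]) this.2.2
  obtain ⟨p, q, hpq, hp, hq, hall⟩ := h2 v hv hvK
  have hcy := cycle_avoid K.vertexSet R hs (fun a ha => ha.1 rfl)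
    (fun a b hab => subset_vertexSet hab.2.2.2 (by simp))
    (fun a b hab => h2 a hab.2.1 (down hab.2.2.2
      (Finset.insert_subset_insert _ (Finset.subset_insert _ _)) (by simp))) hp hall
  set r := fun a b => a ≠ v ∧ b ≠ v ∧ K.LA e a b with hr
  have hpq' : ReflTransGen r p q :=
    ReflTransGen.mono (fun a b hab => ⟨hab.1, hab.2.1, hab.2.2.2⟩) _ _ hcy
  have rs : ∀ {a b}, ReflTransGen r a b → ReflTransGen r b a := by
    intro a b hab
    induction hab with
    | refl => exact .refl
    | tail h1 h2 ih => exact .head ⟨h2.2.1, h2.1, h2.2.2.symm⟩ ih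
  have toP : ∀ x, x ∉ e → x ≠ v → insert x e ∈ K.faces → ReflTransGen r x p := by
    intro x hx hxv hxK
    have hp0 := h.cn e (Or.inr heK) (by omega) x v hx hv hxK hvK
    have key : ∀ z, ReflTransGen (K.LA e) x z →
        (z ≠ v ∧ ReflTransGen r x z) ∨ ReflTransGen r x p := by
      intro z hz
      induction hz with
      | refl => exact Or.inl ⟨hxv, .refl⟩
      | tail h3 h4 ih =>
        rename_i a b
        rcases ih with ⟨i1, i2⟩ | ih
        · by_cases hb : b = v
          · subst hb
            right
            rcases hall a ⟨i1.symm, h4.symm⟩ with rfl | rfl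
            · exact i2
            · exact i2.trans (rs hpq')
          · exact Or.inl ⟨hb, i2.tail ⟨i1, hb, h4⟩⟩
        · exact Or.inr ih
    rcases key _ hp0 with h | h
    · exact absurd rfl h.1
    · exact h
  exact (toP x hx hxv hxK).trans (rs (toP y hy hyv hyK))

/-- edges, triangles, tetrahedra as predicates -/
def E (K : SComplex) (a b : ℕ) : Prop := a ≠ b ∧ ({a, b} : Finset ℕ) ∈ K.faces
def T (K : SComplex) (a b c : ℕ) : Prop := a ≠ b ∧ a ≠ c ∧ b ≠ c ∧ ({a, b, c} : Finset ℕ) ∈ K.faces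
def Q (K : SComplex) (a b c d : ℕ) : Prop :=
  a ≠ b ∧ a ≠ c ∧ a ≠ d ∧ b ≠ c ∧ b ≠ d ∧ c ≠ d ∧ ({a, b, c, d} : Finset ℕ) ∈ K.faces

variable {K : SComplex} {a b c d : ℕ}

theorem E.symm (h : K.E a b) : K.E b a := ⟨h.1.symm, by rw [Finset.pair_comm]; exact h.2⟩
theorem T.s12 (h : K.T a b c) : K.T b a c :=
  ⟨h.1.symm, h.2.2.1, h.2.1, by rw [Finset.insert_comm]; exact h.2.2.2⟩
theorem T.s23 (h : K.T a b c) : K.T a c b :=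
  ⟨h.2.1, h.1, h.2.2.1.symm, by rw [Finset.pair_comm]; exact h.2.2.2⟩
theorem Q.s12 (h : K.Q a b c d) : K.Q b a c d := by
  obtain ⟨h1, h2, h3, h4, h5, h6, h7⟩ := h
  exact ⟨h1.symm, h4, h5, h2, h3, h6, by rw [Finset.insert_comm]; exact h7⟩
theorem Q.s23 (h : K.Q a b c d) : K.Q a c b d := by
  obtain ⟨h1, h2, h3, h4, h5, h6, h7⟩ := h
  exact ⟨h2, h1, h3, h4.symm, h6, h5, by rw [Finset.insert_comm c b]; exact h7⟩
theorem Q.s34 (h : K.Q a b c d) : K.Q a b d c := by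
  obtain ⟨h1, h2, h3, h4, h5, h6, h7⟩ := h
  exact ⟨h1, h3, h2, h5, h4, h6.symm, by rw [Finset.pair_comm d c]; exact h7⟩
theorem Q.t (h : K.Q a b c d) : K.T a b c := by
  obtain ⟨h1, h2, h3, h4, h5, h6, h7⟩ := h
  refine ⟨h1, h2, h4, down h7 ?_ (by simp)⟩
  intro z; simp only [Finset.mem_insert, Finset.mem_singleton]; tauto
theorem T.e (h : K.T a b c) : K.E a b := by
  obtain ⟨h1, h2, h3, h4⟩ := h
  refine ⟨h1, down h4 ?_ (by simp)⟩
  intro z; simp only [Finset.mem_insert, Finset.mem_singleton]; tauto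
theorem T.mem (h : K.T a b c) : ({a, b, c} : Finset ℕ) ∈ K.faces := h.2.2.2
theorem Q.mem (h : K.Q a b c d) : ({a, b, c, d} : Finset ℕ) ∈ K.faces := h.2.2.2.2.2.2

theorem card4 (h : K.Q a b c d) : ({a, b, c, d} : Finset ℕ).card = 4 := by
  obtain ⟨h1, h2, h3, h4, h5, h6, h7⟩ := h
  rw [Finset.card_insert_of_notMem (by simp [*]), Finset.card_insert_of_notMem (by simp [*]),
    Finset.card_pair h6]
theorem card3 (h1 : a ≠ b) (h2 : a ≠ c) (h3 : b ≠ c) : ({a, b, c} : Finset ℕ).card = 3 := by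
  rw [Finset.card_insert_of_notMem (by simp [*]), Finset.card_pair h3]

theorem Q_of (h : K.T a b c) (hd : insert d ({a, b, c} : Finset ℕ) ∈ K.faces)
    (hn : d ∉ ({a, b, c} : Finset ℕ)) : K.Q a b c d := by
  simp only [Finset.mem_insert, Finset.mem_singleton, not_or] at hn
  refine ⟨h.1, h.2.1, Ne.symm hn.1, h.2.2.1, Ne.symm hn.2.1, Ne.symm hn.2.2, ?_⟩
  have : ({a, b, c, d} : Finset ℕ) = insert d {a, b, c} := by
    ext z; simp only [Finset.mem_insert, Finset.mem_singleton]; tauto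
  rw [this]; exact hd

theorem Q.ins (h : K.Q a b c d) : insert d ({a, b, c} : Finset ℕ) ∈ K.faces ∧
    d ∉ ({a, b, c} : Finset ℕ) := by
  obtain ⟨h1, h2, h3, h4, h5, h6, h7⟩ := h
  have : ({a, b, c, d} : Finset ℕ) = insert d {a, b, c} := by
    ext z; simp only [Finset.mem_insert, Finset.mem_singleton]; tauto
  rw [← this]
  exact ⟨h7, by simp only [Finset.mem_insert, Finset.mem_singleton, not_or]; exact ⟨h3.symm, h5.symm, h6.symm⟩⟩

/-- triangles lie in exactly two facets -/
theorem Nrm.twoT (hK : K.Nrm) (h : K.T a b c) : ∃ x y, x ≠ y ∧ K.Q a b c x ∧ K.Q a b c y ∧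
    ∀ z, K.Q a b c z → z = x ∨ z = y := by
  obtain ⟨x, y, hxy, hx, hy, hxK, hyK, hall⟩ := hK.two _ h.mem (card3 h.1 h.2.1 h.2.2.1)
  exact ⟨x, y, hxy, Q_of h hxK hx, Q_of h hyK hy, fun z hz => hall z hz.ins.2 hz.ins.1⟩

theorem Nrm.only2 (hK : K.Nrm) {x y z : ℕ} (hx : K.Q a b c x) (hy : K.Q a b c y)
    (hxy : x ≠ y) (hz : K.Q a b c z) : z = x ∨ z = y := by
  obtain ⟨p, q, -, -, -, hall⟩ := hK.twoT hx.t
  have := hall x hx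
  have := hall y hy
  have := hall z hz
  omega

/-- The standing hypotheses. -/
structure Good (K : SComplex) : Prop where
  inR : InClassR K
  big : ∃ t, 8 ≤ K.deg {t}

theorem Good.nrm (h : Good K) : K.Nrm := ofNormal h.inR.1

theorem fnum_zero (K : SComplex) : K.fnum 0 = K.vertexSet.card := by
  unfold fnum
  rw [← Finset.card_image_of_injective K.vertexSet Finset.singleton_injective]
  congr 1
  ext s
  simp only [Finset.mem_filter, Finset.mem_image, mem_vertexSet]
  constructor
  · rintro ⟨h1, h2⟩
    obtain ⟨x, rfl⟩ := Finset.card_eq_one.mp (by omega : s.card = 1)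
    exact ⟨x, h1, rfl⟩
  · rintro ⟨x, hx, rfl⟩; exact ⟨hx, by simp⟩

/-- condition (i) -/
theorem Good.fill (h : Good K) (h1 : K.T a b c) (h2 : K.T a b d) (h3 : K.T a c d)
    (h4 : K.T b c d) : K.Q a b c d := by
  have hd : a ≠ b ∧ a ≠ c ∧ a ≠ d ∧ b ≠ c ∧ b ≠ d ∧ c ≠ d :=
    ⟨h1.1, h1.2.1, h2.2.1, h1.2.2.1, h2.2.2.1, h3.2.2.1⟩
  obtain ⟨d1, d2, d3, d4, d5, d6⟩ := hd
  refine ⟨d1, d2, d3, d4, d5, d6, ?_⟩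
  have hc : ({a, b, c, d} : Finset ℕ).card = 4 := by
    rw [Finset.card_insert_of_notMem (by simp [*]), Finset.card_insert_of_notMem (by simp [*]),
      Finset.card_pair d6]
  refine h.inR.2.2.2.1 _ hc ?_
  intro t ht
  simp only [properFaces, Finset.mem_filter, Finset.mem_powerset] at ht
  obtain ⟨t1, t2, t3⟩ := ht
  obtain ⟨x, hx, hxt⟩ : ∃ x ∈ ({a, b, c, d} : Finset ℕ), x ∉ t := by
    by_contra! hh
    exact t3 (Finset.Subset.antisymm t1 hh)
  have ne := Finset.nonempty_iff_ne_empty.mpr t2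
  have sub : ∀ z ∈ t, z ≠ x ∧ (z = a ∨ z = b ∨ z = c ∨ z = d) := by
    intro z hz
    refine ⟨by rintro rfl; exact hxt hz, ?_⟩
    simpa using t1 hz
  simp only [Finset.mem_insert, Finset.mem_singleton] at hx
  rcases hx with rfl | rfl | rfl | rfl
  · exact down h4.mem (fun z hz => by have := sub z hz; simp only [Finset.mem_insert, Finset.mem_singleton]; tauto) ne
  · exact down h3.mem (fun z hz => by have := sub z hz; simp only [Finset.mem_insert, Finset.mem_singleton]; tauto) ne
  · exact down h2.mem (fun z hz => by have := sub z hz; simp only [Finset.mem_insert, Finset.mem_singleton]; tauto) ne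
  · exact down h1.mem (fun z hz => by have := sub z hz; simp only [Finset.mem_insert, Finset.mem_singleton]; tauto) ne

theorem sub_pair_of_card {s : Finset ℕ} (hs : s ⊆ {a, b, c}) (h2 : s.card = 2) :
    s = {a, b} ∨ s = {b, c} ∨ s = {a, c} := by
  obtain ⟨x, y, hxy, rfl⟩ := Finset.card_eq_two.mp h2
  have hx : x ∈ ({a, b, c} : Finset ℕ) := hs (by simp)
  have hy : y ∈ ({a, b, c} : Finset ℕ) := hs (by simp)
  simp only [Finset.mem_insert, Finset.mem_singleton] at hx hy
  rcases hx with rfl | rfl | rfl <;> rcases hy with rfl | rfl | rfl <;>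
    first
      | exact absurd rfl hxy
      | (simp only [Finset.pair_comm]; tauto)

set_option maxHeartbeats 1000000 in
theorem Good.noDeg3 (h : Good K) {u v : ℕ} (h1 : K.Q u v a b) (h2 : K.Q u v b c)
    (h3 : K.Q u v c a) : False := by
  have hN := h.nrm
  have duv : u ≠ v := h1.1
  have dua : u ≠ a := h1.2.1
  have dub : u ≠ b := h1.2.2.1
  have dva : v ≠ a := h1.2.2.2.1
  have dvb : v ≠ b := h1.2.2.2.2.1
  have dab : a ≠ b := h1.2.2.2.2.2.1
  have duc : u ≠ c := h2.2.2.1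
  have dvc : v ≠ c := h2.2.2.2.2.1
  have dbc : b ≠ c := h2.2.2.2.2.2.1
  have dac : a ≠ c := h3.2.2.2.2.2.1.symm
  by_cases habc : ({a, b, c} : Finset ℕ) ∈ K.faces
  · -- boundary of 4-simplex
    have tabc : K.T a b c := ⟨dab, dac, dbc, habc⟩
    have qu : K.Q u a b c := h.fill h1.s23.s34.t
      (h3.s23.s34.t.s23) (h2.s23.s34.t) tabc
    have qv : K.Q v a b c := h.fill (h1.s12.s23.s34.t) (h3.s12.s23.s34.t.s23)
      (h2.s12.s23.s34.t) tabc
    set S : Finset ℕ := {u, v, a, b, c} with hS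
    have hS5 : S.card = 5 := by
      rw [hS, Finset.card_insert_of_notMem (by simp [*]), Finset.card_insert_of_notMem (by simp [*]),
        Finset.card_insert_of_notMem (by simp [*]), Finset.card_pair dbc]
    have all4 : ∀ F ⊆ S, F.card = 4 → F ∈ K.faces := by
      intro F hF hF4
      obtain ⟨x, hx, hxF⟩ := exists_mem_notMem_of_card (s := F) (F := S) (by omega)
      have hFe : F = S.erase x := by
        refine Finset.eq_of_subset_of_card_le ?_ (by rw [Finset.card_erase_of_mem hx]; omega)
        intro z hz; exact Finset.mem_erase.mpr ⟨by rintro rfl; exact hxF hz, hF hz⟩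
      have ne : F.Nonempty := by rw [← Finset.card_pos]; omega
      have sub : ∀ z ∈ F, z ≠ x ∧ (z = u ∨ z = v ∨ z = a ∨ z = b ∨ z = c) := by
        intro z hz
        refine ⟨by rintro rfl; exact hxF hz, ?_⟩
        simpa [hS] using hF hz
      simp only [hS, Finset.mem_insert, Finset.mem_singleton] at hx
      rcases hx with rfl | rfl | rfl | rfl | rfl
      · exact down qv.mem (fun z hz => by have := sub z hz; simp only [Finset.mem_insert, Finset.mem_singleton]; tauto) ne
      · exact down qu.mem (fun z hz => by have := sub z hz; simp only [Finset.mem_insert, Finset.mem_singleton]; tauto) ne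
      · exact down h2.mem (fun z hz => by have := sub z hz; simp only [Finset.mem_insert, Finset.mem_singleton]; tauto) ne
      · exact down h3.mem (fun z hz => by have := sub z hz; simp only [Finset.mem_insert, Finset.mem_singleton]; tauto) ne
      · exact down h1.mem (fun z hz => by have := sub z hz; simp only [Finset.mem_insert, Finset.mem_singleton]; tauto) ne
    have closed : ∀ G, ReflTransGen (K.FA ∅) {u, v, a, b} G → G ⊆ S := by
      intro G hG
      induction hG with
      | refl => intro z; simp only [hS, Finset.mem_insert, Finset.mem_singleton]; tauto
      | tail h3 h4 ih =>
        rename_i A B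
        obtain ⟨-, -, hA, hB, hA4, hB4, hAB⟩ := h4
        have hτS : A ∩ B ⊆ S := Finset.inter_subset_left.trans ih
        have hτK : A ∩ B ∈ K.faces :=
          down hA Finset.inter_subset_left (by rw [← Finset.card_pos]; omega)
        obtain ⟨x, y, hxy, hx, hy, hxK, hyK, hall⟩ := hN.two _ hτK hAB
        have hc2 : (S \ (A ∩ B)).card = 2 := by
          rw [Finset.card_sdiff_of_subset hτS]; omega
        obtain ⟨p, q, hpq, hpqe⟩ := Finset.card_eq_two.mp hc2
        have mem : ∀ z, z ∈ S \ (A ∩ B) → z = x ∨ z = y := by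
          intro z hz
          rw [Finset.mem_sdiff] at hz
          refine hall z hz.2 (all4 _ (Finset.insert_subset hz.1 hτS) ?_)
          rw [Finset.card_insert_of_notMem hz.2]; omega
        have hp : p ∈ S \ (A ∩ B) := by rw [hpqe]; simp
        have hq : q ∈ S \ (A ∩ B) := by rw [hpqe]; simp
        have hxS : x ∈ S ∧ y ∈ S := by
          have hp1 := (Finset.mem_sdiff.mp hp).1
          have hq1 := (Finset.mem_sdiff.mp hq).1
          rcases mem p hp with rfl | rfl <;> rcases mem q hq with rfl | rfl <;>
            first
              | exact absurd rfl hpq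
              | exact ⟨hp1, hq1⟩
              | exact ⟨hq1, hp1⟩
        obtain ⟨z, hz, hBz⟩ := insert_eq_of_card (s := A ∩ B) (F := B)
          Finset.inter_subset_right (by omega)
        have hzK : insert z (A ∩ B) ∈ K.faces := hBz ▸ hB
        rw [hBz]
        rcases hall z hz hzK with rfl | rfl
        · exact Finset.insert_subset hxS.1 hτS
        · exact Finset.insert_subset hxS.2 hτS
    obtain ⟨t, ht⟩ := h.big
    have hle : K.deg {t} ≤ 5 := by
      unfold deg
      rw [fnum_zero, ← hS5]
      refine Finset.card_le_card ?_
      intro x hx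
      have hx := (mem_lk'.mp (mem_vertexSet.mp hx)).2.2
      obtain ⟨F, hF, hxF, hF4⟩ := hN.pure _ hx
      have := hN.sc ∅ (by simp) _ _ h1.mem hF (card4 h1) hF4 (by simp) (by simp)
      exact closed F this (hxF (by simp))
    omega
  · -- cut at u
    have hγ : ({a, b, c} : Finset ℕ).card = 3 := card3 dab dac dbc
    have star : ∀ G, ReflTransGen (K.FA {u, v}) {u, v, a, b} G →
        G = {u, v, a, b} ∨ G = {u, v, b, c} ∨ G = {u, v, c, a} := by
      intro G hG
      induction hG with
      | refl => exact Or.inl rfl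
      | tail h3 h4 ih =>
        rename_i h3' A B
        obtain ⟨f1, f2, hA, hB, hA4, hB4, hAB⟩ := h4
        have uA : u ∈ A ∩ B := Finset.mem_inter.mpr ⟨f1 (by simp), f2 (by simp)⟩
        have vA : v ∈ A ∩ B := Finset.mem_inter.mpr ⟨f1 (by simp), f2 (by simp)⟩
        have sub2 : ({u, v} : Finset ℕ) ⊆ A ∩ B := by
          intro z hz; simp only [Finset.mem_insert, Finset.mem_singleton] at hz
          rcases hz with rfl | rfl <;> assumption
        obtain ⟨x, hx, hABx⟩ := insert_eq_of_card sub2 (by rw [Finset.card_pair duv]; omega)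
        obtain ⟨y, hy, hBy⟩ := insert_eq_of_card (s := A ∩ B) (F := B)
          Finset.inter_subset_right (by omega)
        have hxA : x ∈ A := Finset.inter_subset_left (s₁ := A) (s₂ := B) (by rw [hABx]; simp)
        rw [hABx] at hy
        simp only [Finset.mem_insert, Finset.mem_singleton, not_or] at hx hy
        have hBe : B = {u, v, x, y} := by
          rw [hBy, hABx]; ext z; simp only [Finset.mem_insert, Finset.mem_singleton]; tauto
        have qB : K.Q u v x y := ⟨duv, Ne.symm hx.1, Ne.symm hy.2.1, Ne.symm hx.2, Ne.symm hy.2.2,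
          Ne.symm hy.1, hBe ▸ hB⟩
        have hx3 : x = a ∨ x = b ∨ x = c := by
          rcases ih with rfl | rfl | rfl <;>
            simp only [Finset.mem_insert, Finset.mem_singleton] at hxA <;> tauto
        rw [hBe]
        rcases hx3 with rfl | rfl | rfl
        · rcases hN.only2 h1 h3'.s34 dbc qB with rfl | rfl
          · exact Or.inl rfl
          · right; right; ext z; simp only [Finset.mem_insert, Finset.mem_singleton]; tauto
        · rcases hN.only2 h1.s34 h2 dac qB with rfl | rfl
          · left; ext z; simp only [Finset.mem_insert, Finset.mem_singleton]; tauto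
          · right; left; rfl
        · rcases hN.only2 h2.s34 h3' dab.symm qB with rfl | rfl
          · right; left; ext z; simp only [Finset.mem_insert, Finset.mem_singleton]; tauto
          · right; right; rfl
    have hv3 : v ∉ ({a, b, c} : Finset ℕ) := by simp [*]
    have hu3 : u ∉ ({a, b, c} : Finset ℕ) := by simp [*]
    have fourth : ∀ e ⊆ ({a, b, c} : Finset ℕ), e.card = 2 → insert v (insert u e) ∈ K.faces := by
      intro e he he2
      rcases sub_pair_of_card he he2 with rfl | rfl | rfl
      · have := h1.s12.mem; exact this
      · have := h2.s12.mem; exact this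
      · have := h3.s12.s34.mem; exact this
    refine cut_false h.inR (w := u) (γ := {a, b, c}) (P := fun T => v ∈ T)
      ⟨hN, hγ, hu3, ?_, habc, ?_⟩
    · intro e he he2
      exact down (fourth e he he2) (Finset.subset_insert _ _) (by simp)
    · intro T1 T2 c1 w1 k1 c2 w2 k2 c12
      have one : ∀ T1 T2 : Finset ℕ, T1.card = 3 → u ∉ T1 → insert u T1 ∈ K.faces →
          (T1 ∩ T2).card = 2 → v ∈ T1 → v ∉ T2 → T1 ∩ T2 ⊆ {a, b, c} := by
        intro T1 T2 c1 w1 k1 c12 v1 v2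
        have := star _ (hN.sc {u, v} (by rw [Finset.card_pair duv]; omega) _ (insert u T1) h1.mem k1
          (card4 h1) (by rw [Finset.card_insert_of_notMem w1]; omega)
          (by intro z; simp only [Finset.mem_insert, Finset.mem_singleton]; tauto)
          (by intro z; simp only [Finset.mem_insert, Finset.mem_singleton]; rintro (rfl | rfl); exacts [Or.inl rfl, Or.inr v1]))
        intro z hz
        rw [Finset.mem_inter] at hz
        have hz1 : z ∈ insert u T1 := Finset.mem_insert_of_mem hz.1
        have zu : z ≠ u := by rintro rfl; exact w1 hz.1
        have zv : z ≠ v := by rintro rfl; exact v2 hz.2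
        rcases this with hh | hh | hh <;> rw [hh] at hz1 <;>
          simp only [Finset.mem_insert, Finset.mem_singleton] at hz1 ⊢ <;> tauto
      by_cases v1 : v ∈ T1 <;> by_cases v2 : v ∈ T2
      · exact ⟨fun _ hh => hv3 (hh (Finset.mem_inter.mpr ⟨v1, v2⟩)), fun _ => iff_of_true v1 v2⟩
      · exact ⟨fun hh => absurd (hh.mp v1) v2,
          fun hh => absurd (one T1 T2 c1 w1 k1 c12 v1 v2) hh⟩
      · refine ⟨fun hh => absurd (hh.mpr v2) v1, fun hh => absurd ?_ hh⟩
        rw [Finset.inter_comm] at c12 ⊢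
        exact one T2 T1 c2 w2 k2 c12 v2 v1
      · refine ⟨fun _ hh => ?_, fun _ => iff_of_false v1 v2⟩
        have h4 := fourth _ hh c12
        have hue : u ∉ T1 ∩ T2 := fun a => w1 (Finset.mem_inter.mp a).1
        obtain ⟨x, hx, hTx⟩ := insert_eq_of_card (s := T1 ∩ T2) (F := T1)
          Finset.inter_subset_left (by omega)
        obtain ⟨y, hy, hTy⟩ := insert_eq_of_card (s := T1 ∩ T2) (F := T2)
          Finset.inter_subset_right (by omega)
        obtain ⟨p, q, -, -, -, -, -, hall⟩ := hN.two (insert u (T1 ∩ T2))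
          (down h4 (Finset.subset_insert _ _) (by simp))
          (by rw [Finset.card_insert_of_notMem hue]; omega)
        have xT : x ∈ T1 := by rw [hTx]; simp
        have yT : y ∈ T2 := by rw [hTy]; simp
        have xu : x ≠ u := by rintro rfl; exact w1 xT
        have yu : y ≠ u := by rintro rfl; exact w2 yT
        have xv : x ≠ v := by rintro rfl; exact v1 xT
        have yv : y ≠ v := by rintro rfl; exact v2 yT
        have xy : x ≠ y := by
          rintro rfl
          exact hx (Finset.mem_inter.mpr ⟨xT, yT⟩)
        rw [hTx, Finset.insert_comm] at k1
        rw [hTy, Finset.insert_comm] at k2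
        have a1 := hall x (by simp only [Finset.mem_insert, not_or]; exact ⟨xu, hx⟩) k1
        have a2 := hall y (by simp only [Finset.mem_insert, not_or]; exact ⟨yu, hy⟩) k2
        have a3 := hall v (by simp only [Finset.mem_insert, not_or]; exact ⟨duv.symm, fun hh => v1 (Finset.mem_inter.mp hh).1⟩) h4
        omega
end ModE

section ModF
open Relation

theorem first_hit {R : ℕ → ℕ → Prop} {x v : ℕ} (h : ReflTransGen R x v) (hx : x ≠ v) :
    ∃ p, p ≠ v ∧ R p v ∧ ReflTransGen (fun a b => a ≠ v ∧ b ≠ v ∧ R a b) x p := by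
  have key : ∀ z, ReflTransGen R x z →
      (z ≠ v ∧ ReflTransGen (fun a b => a ≠ v ∧ b ≠ v ∧ R a b) x z) ∨
      ∃ p, p ≠ v ∧ R p v ∧ ReflTransGen (fun a b => a ≠ v ∧ b ≠ v ∧ R a b) x p := by
    intro z hz
    induction hz with
    | refl => exact Or.inl ⟨hx, .refl⟩
    | tail h3 h4 ih =>
      rename_i a b
      rcases ih with ⟨i1, i2⟩ | ih
      · by_cases hb : b = v
        · subst hb
          exact Or.inr ⟨a, i1, h4, i2⟩
        · exact Or.inl ⟨hb, i2.tail ⟨i1, hb, h4⟩⟩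
      · exact Or.inr ih
  rcases key _ h with h | h
  · exact absurd rfl h.1
  · exact h

theorem mem_lk1 {K : SComplex} {u x : ℕ} : x ∈ (K.lk {u}).vertexSet ↔ K.E u x := by
  rw [mem_vertexSet, mem_lk', E]
  have : ({x} ∪ {u} : Finset ℕ) = {u, x} := by
    ext z; simp only [Finset.mem_union, Finset.mem_insert, Finset.mem_singleton]; tauto
  rw [this]
  constructor
  · rintro ⟨-, h1, h2⟩
    refine ⟨?_, h2⟩
    rintro rfl; simp at h1
  · rintro ⟨h1, h2⟩
    exact ⟨by simp, by simp [h1], h2⟩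

theorem mem_lk2 {K : SComplex} {u v x : ℕ} (huv : u ≠ v) :
    x ∈ (K.lk {u, v}).vertexSet ↔ K.T u v x := by
  rw [mem_vertexSet, mem_lk', T]
  have : ({x} ∪ {u, v} : Finset ℕ) = {u, v, x} := by
    ext z; simp only [Finset.mem_union, Finset.mem_insert, Finset.mem_singleton]; tauto
  rw [this]
  constructor
  · rintro ⟨-, h1, h2⟩
    refine ⟨huv, ?_, ?_, h2⟩
    · rintro rfl
      have : u ∈ ({u} ∩ {u, v} : Finset ℕ) := by simp
      rw [h1] at this; simp at this
    · rintro rfl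
      have : v ∈ ({v} ∩ {u, v} : Finset ℕ) := by simp
      rw [h1] at this; simp at this
  · rintro ⟨-, h1, h2, h3⟩
    refine ⟨by simp, ?_, h3⟩
    ext z
    simp only [Finset.mem_inter, Finset.mem_insert, Finset.mem_singleton, Finset.notMem_empty,
      iff_false]
    omega

theorem deg_one {K : SComplex} {u : ℕ} : K.deg {u} = (K.lk {u}).vertexSet.card := fnum_zero _
theorem deg_two {K : SComplex} {u v : ℕ} : K.deg {u, v} = (K.lk {u, v}).vertexSet.card :=
  fnum_zero _

theorem Nrm.exT {K : SComplex} (h : K.Nrm) {u v : ℕ} (huv : K.E u v) : ∃ x, K.T u v x := by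
  obtain ⟨F, hF, hs, h4⟩ := h.pure _ huv.2
  obtain ⟨x, hxF, hx⟩ := exists_mem_notMem_of_card (s := {u, v}) (F := F)
    (by rw [Finset.card_pair huv.1]; omega)
  simp only [Finset.mem_insert, Finset.mem_singleton, not_or] at hx
  refine ⟨x, huv.1, Ne.symm hx.1, Ne.symm hx.2, down hF ?_ (by simp)⟩
  intro z hz
  simp only [Finset.mem_insert, Finset.mem_singleton] at hz
  rcases hz with rfl | rfl | rfl
  · exact hs (by simp)
  · exact hs (by simp)
  · exact hxF

theorem Good.deg_ge4 {K : SComplex} (h : Good K) {u v : ℕ} (huv : K.E u v) :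
    4 ≤ K.deg {u, v} := by
  obtain ⟨p, hp⟩ := h.nrm.exT huv
  obtain ⟨q, r, hqr, hq, hr, -⟩ := h.nrm.twoT hp
  obtain ⟨y, z, hyz, hy, hz, hall⟩ := h.nrm.twoT hq.s34.t
  have key : ∃ s, s ≠ p ∧ s ≠ q ∧ s ≠ r ∧ K.T u v s := by
    have h1 := hy.2.2.2.2.2.1
    have h2 := hz.2.2.2.2.2.1
    by_cases hyp : y = p
    · refine ⟨z, by omega, by omega, ?_, hz.s34.t⟩
      rintro rfl
      exact h.noDeg3 hq hz hr.s34
    · refine ⟨y, hyp, by omega, ?_, hy.s34.t⟩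
      rintro rfl
      exact h.noDeg3 hq hy hr.s34
  obtain ⟨s, s1, s2, s3, hs⟩ := key
  have hc : ({p, q, r, s} : Finset ℕ).card = 4 := by
    have h1 := hq.2.2.2.2.2.1
    have h2 := hr.2.2.2.2.2.1
    rw [Finset.card_insert_of_notMem (by simp [h1, h2, Ne.symm s1]),
      Finset.card_insert_of_notMem (by simp [hqr, Ne.symm s2]), Finset.card_pair (Ne.symm s3)]
  rw [deg_two, ← hc]
  refine Finset.card_le_card ?_
  intro z hz
  simp only [Finset.mem_insert, Finset.mem_singleton] at hz
  rw [mem_lk2 huv.1]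
  rcases hz with rfl | rfl | rfl | rfl
  exacts [hp, hq.s34.t, hr.s34.t, hs]

structure Con (K : SComplex) (u v w : ℕ) (K' : SComplex) : Prop where
  nrm : K.Nrm
  huv : K.E u v
  hw : w ∉ K.vertexSet
  lc : ∀ s, u ∉ s → v ∉ s → insert u s ∈ K.faces → insert v s ∈ K.faces →
    insert u (insert v s) ∈ K.faces
  deg4 : 4 ≤ K.deg {u, v}
  m0 : ∀ s, w ∉ s → (s ∈ K'.faces ↔ s ∈ K.faces ∧ u ∉ s ∧ v ∉ s)
  m1 : ∀ s, w ∉ s → (insert w s ∈ K'.faces ↔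
    u ∉ s ∧ v ∉ s ∧ (insert u s ∈ K.faces ∨ insert v s ∈ K.faces))

namespace Con
variable {K K' : SComplex} {u v w : ℕ}

theorem swap (h : Con K u v w K') : Con K v u w K' where
  nrm := h.nrm
  huv := h.huv.symm
  hw := h.hw
  lc := fun s a b c d => by rw [Finset.insert_comm]; exact h.lc s b a d c
  deg4 := by rw [Finset.pair_comm]; exact h.deg4
  m0 := fun s hs => by rw [h.m0 s hs]; tauto
  m1 := fun s hs => by rw [h.m1 s hs]; tauto

theorem nin (h : Con K u v w K') {s : Finset ℕ} (hs : s ∈ K.faces) : w ∉ s :=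
  fun hh => h.hw (subset_vertexSet hs hh)

theorem ninI (h : Con K u v w K') {s : Finset ℕ} {x : ℕ} (hs : insert x s ∈ K.faces) : w ∉ s :=
  fun hh => h.nin hs (by simp [hh])

theorem mU (h : Con K u v w K') {s : Finset ℕ} (hu : u ∉ s) (hv : v ∉ s)
    (hs : insert u s ∈ K.faces) : insert w s ∈ K'.faces :=
  (h.m1 s (h.ninI hs)).mpr ⟨hu, hv, Or.inl hs⟩

theorem mV (h : Con K u v w K') {s : Finset ℕ} (hu : u ∉ s) (hv : v ∉ s)
    (hs : insert v s ∈ K.faces) : insert w s ∈ K'.faces :=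
  (h.m1 s (h.ninI hs)).mpr ⟨hu, hv, Or.inr hs⟩

theorem m1e (h : Con K u v w K') {s : Finset ℕ} (hs : s ∈ K'.faces) (hw : w ∈ s) :
    ∃ r, s = insert w r ∧ w ∉ r ∧ u ∉ r ∧ v ∉ r ∧
      (insert u r ∈ K.faces ∨ insert v r ∈ K.faces) := by
  have e : insert w (s.erase w) = s := Finset.insert_erase hw
  have h2 : w ∉ s.erase w := Finset.notMem_erase _ _
  rw [← e] at hs
  exact ⟨_, e.symm, h2, (h.m1 _ h2).mp hs⟩

theorem no3 (h : Con K u v w K') {s : Finset ℕ} (h3 : s.card = 3) (hu : u ∉ s) (hv : v ∉ s)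
    (h1 : insert u s ∈ K.faces) (h2 : insert v s ∈ K.faces) : False := by
  have := h.nrm.le4 _ (h.lc s hu hv h1 h2)
  rw [Finset.card_insert_of_notMem (by simp [hu, h.huv.1]), Finset.card_insert_of_notMem hv] at this
  omega

theorem ext (h : Con K u v w K') {r : Finset ℕ} (hu : u ∉ r) (hv : v ∉ r)
    (hr : insert u r ∈ K.faces) :
    ∃ R, r ⊆ R ∧ R.card = 3 ∧ u ∉ R ∧ v ∉ R ∧ insert u R ∈ K.faces := by
  obtain ⟨F, hF, hrF, hF4⟩ := h.nrm.pure _ hr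
  have huF : u ∈ F := hrF (by simp)
  have hrF' : ∀ z ∈ r, z ∈ F := fun z hz => hrF (by simp [hz])
  by_cases hvF : v ∈ F
  · set τ := F.erase v with hτ
    have hτ3 : τ.card = 3 := by rw [hτ, Finset.card_erase_of_mem hvF]; omega
    have huτ : u ∈ τ := Finset.mem_erase.mpr ⟨h.huv.1, huF⟩
    have hvτ : v ∉ τ := Finset.notMem_erase _ _
    have hτK : τ ∈ K.faces := down hF (Finset.erase_subset _ _) ⟨u, huτ⟩
    have : ∃ x, x ≠ v ∧ x ∉ τ ∧ insert x τ ∈ K.faces := by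
      obtain ⟨x, y, hxy, hx, hy, hxK, hyK, -⟩ := h.nrm.two _ hτK hτ3
      by_cases hxv : x = v
      · exact ⟨y, by omega, hy, hyK⟩
      · exact ⟨x, hxv, hx, hxK⟩
    obtain ⟨x, hxv, hx, hxK⟩ := this
    have hxu : x ≠ u := by rintro rfl; exact hx huτ
    refine ⟨insert x (τ.erase u), ?_, ?_, ?_, ?_, ?_⟩
    · intro z hz
      refine Finset.mem_insert_of_mem (Finset.mem_erase.mpr ⟨?_, Finset.mem_erase.mpr ⟨?_, hrF' z hz⟩⟩)
      · rintro rfl; exact hu hz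
      · rintro rfl; exact hv hz
    · rw [Finset.card_insert_of_notMem (fun hh => hx (Finset.mem_of_mem_erase hh)),
        Finset.card_erase_of_mem huτ]; omega
    · simp [Ne.symm hxu]
    · simp [Ne.symm hxv, hvτ]
    · rw [Finset.insert_comm, Finset.insert_erase huτ]; exact hxK
  · refine ⟨F.erase u, ?_, ?_, Finset.notMem_erase _ _, fun hh => hvF (Finset.mem_of_mem_erase hh), ?_⟩
    · intro z hz
      exact Finset.mem_erase.mpr ⟨by rintro rfl; exact hu hz, hrF' z hz⟩
    · rw [Finset.card_erase_of_mem huF]; omega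
    · rw [Finset.insert_erase huF]; exact hF

theorem pureU (h : Con K u v w K') {r : Finset ℕ} (hu : u ∉ r) (hv : v ∉ r)
    (hr : insert u r ∈ K.faces) : ∃ F ∈ K'.faces, insert w r ⊆ F ∧ F.card = 4 := by
  obtain ⟨R, h1, h2, h3, h4, h5⟩ := h.ext hu hv hr
  exact ⟨insert w R, h.mU h3 h4 h5, Finset.insert_subset_insert _ h1,
    by rw [Finset.card_insert_of_notMem (h.ninI h5)]; omega⟩

theorem pure0 (h : Con K u v w K') {s : Finset ℕ} (hs : s ∈ K'.faces) :
    ∃ F ∈ K'.faces, s ⊆ F ∧ F.card = 4 := by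
  by_cases hw : w ∈ s
  · obtain ⟨r, rfl, h1, h2, h3, h4 | h4⟩ := h.m1e hs hw
    · exact h.pureU h2 h3 h4
    · exact h.swap.pureU h3 h2 h4
  · obtain ⟨hK, hu, hv⟩ := (h.m0 s hw).mp hs
    obtain ⟨F, hF, hsF, hF4⟩ := h.nrm.pure _ hK
    by_cases huF : u ∈ F
    · obtain ⟨G, g1, g2, g3⟩ := h.pureU hu hv (down hF (Finset.insert_subset huF hsF) (by simp))
      exact ⟨G, g1, (Finset.subset_insert _ _).trans g2, g3⟩
    by_cases hvF : v ∈ F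
    · obtain ⟨G, g1, g2, g3⟩ := h.swap.pureU hv hu
        (down hF (Finset.insert_subset hvF hsF) (by simp))
      exact ⟨G, g1, (Finset.subset_insert _ _).trans g2, g3⟩
    exact ⟨F, (h.m0 F (h.nin hF)).mpr ⟨hF, huF, hvF⟩, hsF, hF4⟩

theorem le0 (h : Con K u v w K') {s : Finset ℕ} (hs : s ∈ K'.faces) : s.card ≤ 4 := by
  by_cases hw : w ∈ s
  · obtain ⟨r, rfl, h1, h2, h3, h4 | h4⟩ := h.m1e hs hw
    · have := h.nrm.le4 _ h4
      rw [Finset.card_insert_of_notMem h1]; rw [Finset.card_insert_of_notMem h2] at this; omega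
    · have := h.nrm.le4 _ h4
      rw [Finset.card_insert_of_notMem h1]; rw [Finset.card_insert_of_notMem h3] at this; omega
  · exact h.nrm.le4 _ ((h.m0 s hw).mp hs).1

def Two (K : SComplex) (s : Finset ℕ) : Prop :=
  ∃ x y, x ≠ y ∧ x ∉ s ∧ y ∉ s ∧ insert x s ∈ K.faces ∧
    insert y s ∈ K.faces ∧ ∀ z, z ∉ s → insert z s ∈ K.faces → z = x ∨ z = y

theorem twoU (h : Con K u v w K') {e : Finset ℕ} (h2 : e.card = 2) (hu : u ∉ e) (hv : v ∉ e)
    (h3 : insert u e ∈ K.faces) (h4 : insert v e ∉ K.faces) : Two K' (insert w e) := by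
  obtain ⟨x, y, hxy, hx, hy, hxK, hyK, hall⟩ := h.nrm.two _ h3
    (by rw [Finset.card_insert_of_notMem hu]; omega)
  have aux : ∀ x, x ∉ insert u e → insert x (insert u e) ∈ K.faces →
      x ∉ insert w e ∧ insert x (insert w e) ∈ K'.faces := by
    intro x hx hxK
    simp only [Finset.mem_insert, not_or] at hx
    have hxv : x ≠ v := by
      rintro rfl
      exact h4 (down hxK (Finset.insert_subset_insert _ (Finset.subset_insert _ _)) (by simp))
    have hxw : x ≠ w := by rintro rfl; exact h.nin hxK (by simp)
    refine ⟨by simp [hxw, hx.2], ?_⟩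
    rw [Finset.insert_comm]
    refine h.mU (by simp [hu, Ne.symm hx.1]) (by simp [hv, Ne.symm hxv]) ?_
    rw [Finset.insert_comm]; exact hxK
  refine ⟨x, y, hxy, (aux x hx hxK).1, (aux y hy hyK).1, (aux x hx hxK).2, (aux y hy hyK).2, ?_⟩
  intro z hz hzK
  simp only [Finset.mem_insert, not_or] at hz
  rw [Finset.insert_comm, h.m1 _ (by simp [Ne.symm hz.1]; exact h.ninI h3)] at hzK
  obtain ⟨a1, a2, a3 | a3⟩ := hzK
  · simp only [Finset.mem_insert, not_or] at a1
    refine hall z (by simp [hz.2, Ne.symm a1.1]) ?_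
    rw [Finset.insert_comm]; exact a3
  · exact absurd (down a3 (Finset.insert_subset_insert _ (Finset.subset_insert _ _)) (by simp)) h4

theorem two0 (h : Con K u v w K') {s : Finset ℕ} (hs : s ∈ K'.faces) (h3 : s.card = 3) :
    Two K' s := by
  by_cases hw : w ∈ s
  · obtain ⟨e, rfl, h1, hu, hv, h4⟩ := h.m1e hs hw
    have h2 : e.card = 2 := by rw [Finset.card_insert_of_notMem h1] at h3; omega
    by_cases hU : insert u e ∈ K.faces
    · by_cases hV : insert v e ∈ K.faces
      · have hUV := h.lc e hu hv hU hV
        have aux : ∀ {u v : ℕ}, Con K u v w K' → u ∉ e → v ∉ e → insert u e ∈ K.faces →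
            insert u (insert v e) ∈ K.faces →
            ∃ x, x ≠ u ∧ x ≠ v ∧ x ∉ e ∧ insert u (insert x e) ∈ K.faces ∧
              ∀ z, z ≠ v → z ≠ u → z ∉ e → insert u (insert z e) ∈ K.faces → z = x := by
          intro u v h hu hv hU hUV
          obtain ⟨x, y, hxy, hx, hy, hxK, hyK, hall⟩ := h.nrm.two _ hU
            (by rw [Finset.card_insert_of_notMem hu]; omega)
          have := hall v (by simp [hv, Ne.symm h.huv.1]) (by rw [Finset.insert_comm]; exact hUV)
          simp only [Finset.mem_insert, not_or] at hx hy
          rcases this with rfl | rfl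
          · refine ⟨y, hy.1, Ne.symm hxy, hy.2, by rw [Finset.insert_comm]; exact hyK, ?_⟩
            intro z z1 z2 z3 z4
            have := hall z (by simp [z2, z3]) (by rw [Finset.insert_comm]; exact z4)
            omega
          · refine ⟨x, hx.1, hxy, hx.2, by rw [Finset.insert_comm]; exact hxK, ?_⟩
            intro z z1 z2 z3 z4
            have := hall z (by simp [z2, z3]) (by rw [Finset.insert_comm]; exact z4)
            omega
        obtain ⟨x, x1, x2, x3, x4, x5⟩ := aux h hu hv hU hUV
        obtain ⟨y, y1, y2, y3, y4, y5⟩ := aux h.swap hv hu hV (by rw [Finset.insert_comm]; exact hUV)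
        have hxw : x ≠ w := by rintro rfl; exact h.nin x4 (by simp)
        have hyw : y ≠ w := by rintro rfl; exact h.nin y4 (by simp)
        have xe : u ∉ insert x e ∧ v ∉ insert x e := by simp [hu, hv, Ne.symm x1, Ne.symm x2]
        have ye : u ∉ insert y e ∧ v ∉ insert y e := by simp [hu, hv, Ne.symm y1, Ne.symm y2]
        refine ⟨x, y, ?_, by simp [hxw, x3], by simp [hyw, y3], ?_, ?_, ?_⟩
        · rintro rfl
          exact h.no3 (s := insert x e) (by rw [Finset.card_insert_of_notMem x3]; omega)
            xe.1 xe.2 x4 y4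
        · rw [Finset.insert_comm]; exact h.mU xe.1 xe.2 x4
        · rw [Finset.insert_comm]; exact h.mV ye.1 ye.2 y4
        · intro z hz hzK
          simp only [Finset.mem_insert, not_or] at hz
          rw [Finset.insert_comm, h.m1 _ (by simp [Ne.symm hz.1, h1])] at hzK
          obtain ⟨a1, a2, a3 | a3⟩ := hzK
          · simp only [Finset.mem_insert, not_or] at a1 a2
            exact Or.inl (x5 z (Ne.symm a2.1) (Ne.symm a1.1) hz.2 a3)
          · simp only [Finset.mem_insert, not_or] at a1 a2
            exact Or.inr (y5 z (Ne.symm a1.1) (Ne.symm a2.1) hz.2 a3)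
      · exact h.twoU h2 hu hv hU hV
    · have hV : insert v e ∈ K.faces := h4.resolve_left hU
      exact h.swap.twoU h2 hv hu hV hU
  · obtain ⟨hK, hu, hv⟩ := (h.m0 s hw).mp hs
    obtain ⟨x, y, hxy, hx, hy, hxK, hyK, hall⟩ := h.nrm.two _ hK h3
    have aux : ∀ x, x ∉ s → insert x s ∈ K.faces → ∃ x', x' ∉ s ∧ insert x' s ∈ K'.faces ∧
        ((x = u ∧ x' = w) ∨ (x = v ∧ x' = w) ∨ (x ≠ u ∧ x ≠ v ∧ x' = x)) := by
      intro x hx hxK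
      by_cases xu : x = u
      · subst xu; exact ⟨w, hw, h.mU hu hv hxK, by simp⟩
      by_cases xv : x = v
      · subst xv; exact ⟨w, hw, h.mV hu hv hxK, by simp⟩
      refine ⟨x, hx, (h.m0 _ (h.nin hxK)).mpr ⟨hxK, by simp [hu, Ne.symm xu], by simp [hv, Ne.symm xv]⟩,
        Or.inr (Or.inr ⟨xu, xv, rfl⟩)⟩
    have hxw : x ≠ w := by rintro rfl; exact h.nin hxK (by simp)
    have hyw : y ≠ w := by rintro rfl; exact h.nin hyK (by simp)
    obtain ⟨x', x1, x2, x3⟩ := aux x hx hxK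
    obtain ⟨y', y1, y2, y3⟩ := aux y hy hyK
    have hnot : ¬ (insert u s ∈ K.faces ∧ insert v s ∈ K.faces) := fun hh => h.no3 h3 hu hv hh.1 hh.2
    refine ⟨x', y', ?_, x1, y1, x2, y2, ?_⟩
    · intro e
      apply hnot
      rcases x3 with ⟨rfl, e1⟩ | ⟨rfl, e1⟩ | ⟨a, b, e1⟩ <;> rcases y3 with ⟨rfl, e2⟩ | ⟨rfl, e2⟩ | ⟨a, b, e2⟩ <;>
        first
          | exact ⟨hxK, hyK⟩
          | exact ⟨hyK, hxK⟩
          | (exfalso; omega)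
    · intro z hz hzK
      by_cases hzw : z = w
      · subst hzw
        rw [h.m1 _ hw] at hzK
        obtain ⟨-, -, a | a⟩ := hzK
        · have := hall u hu a; omega
        · have := hall v hv a; omega
      · rw [h.m0 _ (by simp [hw, Ne.symm hzw])] at hzK
        obtain ⟨a, b, c⟩ := hzK
        simp only [Finset.mem_insert, not_or] at b c
        have := hall z hz a
        omega

theorem rsymm {s : Finset ℕ} {a b : ℕ} (h : ReflTransGen (K.LA s) a b) :
    ReflTransGen (K.LA s) b a := by
  induction h with
  | refl => exact .refl
  | tail h1 h2 ih => exact .head h2.symm ih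

theorem laU (h : Con K u v w K') {r : Finset ℕ} (hu : u ∉ r) (hv : v ∉ r) {a b : ℕ} (ha : a ≠ v)
    (hb : b ≠ v) (hab : K.LA (insert u r) a b) : K'.LA (insert w r) a b := by
  obtain ⟨h1, h2, h3⟩ := hab
  have haw : a ≠ w := by rintro rfl; exact h.nin h3 (by simp)
  have hbw : b ≠ w := by rintro rfl; exact h.nin h3 (by simp)
  simp only [Finset.mem_insert, not_or] at h1 h2
  refine ⟨by simp [haw, h1.2], by simp [hbw, h2.2], ?_⟩
  have e : ∀ z : ℕ, insert a (insert b (insert z r)) = insert z (insert a (insert b r)) := by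
    intro z
    rw [Finset.insert_comm b z, Finset.insert_comm a z]
  rw [e] at h3 ⊢
  exact h.mU (by simp [hu, Ne.symm h1.1, Ne.symm h2.1]) (by simp [hv, Ne.symm ha, Ne.symm hb]) h3

theorem cnw (h : Con K u v w K') {x y : ℕ} (hx : x ≠ u) (hx' : x ≠ v) (hy : y ≠ u) (hy' : y ≠ v)
    (hxK : K.E u x ∨ K.E v x) (hyK : K.E u y ∨ K.E v y) : ReflTransGen (K'.LA {w}) x y := by
  have toP : ∀ {u v : ℕ}, Con K u v w K' → ∀ {x}, x ≠ v → K.E u x →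
      ∃ p, K.T u v p ∧ ReflTransGen (K'.LA {w}) x p := by
    intro u v h x hx hxK
    have h0 := h.nrm.cn {u} (Or.inr (down hxK.2 (by simp) (by simp))) (by simp) x v
      (by simpa using hxK.1.symm) (by simpa using h.huv.1.symm)
      (by rw [Finset.pair_comm]; exact hxK.2) (by rw [Finset.pair_comm]; exact h.huv.2)
    obtain ⟨p, p1, p2, p3⟩ := first_hit h0 hx
    refine ⟨p, ?_, ?_⟩
    · obtain ⟨a, b, c⟩ := p2
      refine ⟨h.huv.1, fun e => a (by simp [e]), Ne.symm p1, ?_⟩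
      have : ({u, v, p} : Finset ℕ) = {p, v, u} := by
        ext z; simp only [Finset.mem_insert, Finset.mem_singleton]; tauto
      rw [this]; exact c
    · refine ReflTransGen.mono (fun a b hab => ?_) _ _ p3
      exact h.laU (r := ∅) (by simp) (by simp) hab.1 hab.2.1 hab.2.2
  have toP2 : ∀ {x}, x ≠ u → x ≠ v → (K.E u x ∨ K.E v x) →
      ∃ p, K.T u v p ∧ ReflTransGen (K'.LA {w}) x p := by
    intro x hx hx' hxK
    rcases hxK with hxK | hxK
    · exact toP h hx' hxK
    · obtain ⟨p, p1, p2⟩ := toP h.swap hx hxK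
      exact ⟨p, p1.s12, p2⟩
  obtain ⟨p, p1, p2⟩ := toP2 hx hx' hxK
  obtain ⟨q, q1, q2⟩ := toP2 hy hy' hyK
  refine p2.trans (ReflTransGen.trans ?_ (rsymm q2))
  have e : ∀ p : ℕ, insert p ({u, v} : Finset ℕ) = {u, v, p} := by
    intro p; ext z; simp only [Finset.mem_insert, Finset.mem_singleton]; tauto
  have := h.nrm.cn {u, v} (Or.inr h.huv.2) (by rw [Finset.card_pair h.huv.1]) p q
    (by simp [p1.2.1.symm, p1.2.2.1.symm]) (by simp [q1.2.1.symm, q1.2.2.1.symm])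
    (by rw [e]; exact p1.mem) (by rw [e]; exact q1.mem)
  refine ReflTransGen.mono (fun a b hab => ?_) _ _ this
  obtain ⟨a1, a2, a3⟩ := hab
  simp only [Finset.mem_insert, Finset.mem_singleton, not_or] at a1 a2
  refine h.laU (r := ∅) (by simp) (by simp) a1.2 a2.2 ⟨by simp [a1.1], by simp [a2.1], down a3 ?_ (by simp)⟩
  intro z; simp only [Finset.mem_insert, Finset.mem_singleton, insert_empty_eq]; tauto

theorem cnwy (h : Con K u v w K') {y : ℕ} (hyu : y ≠ u) (hyv : y ≠ v) {p q : ℕ}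
    (hp : K.T u y p ∨ K.T v y p) (hq : K.T u y q ∨ K.T v y q)
    (hpu : p ≠ u) (hpv : p ≠ v) (hqu : q ≠ u) (hqv : q ≠ v) :
    ReflTransGen (K'.LA {w, y}) p q := by
  have ePQ : ∀ u p : ℕ, insert p ({u, y} : Finset ℕ) = {u, y, p} := by
    intro u p; ext z; simp only [Finset.mem_insert, Finset.mem_singleton]; tauto
  have one : ∀ {u v : ℕ}, Con K u v w K' → y ≠ u → y ≠ v → ∀ {p q}, p ≠ v → q ≠ v →
      K.T u y p → K.T u y q → ReflTransGen (K'.LA {w, y}) p q := by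
    intro u v h hyu hyv p q hpv hqv hp hq
    have hpe : p ∉ ({u, y} : Finset ℕ) := by simp [hp.2.1.symm, hp.2.2.1.symm]
    have hqe : q ∉ ({u, y} : Finset ℕ) := by simp [hq.2.1.symm, hq.2.2.1.symm]
    by_cases hv : K.T u y v
    · have := h.nrm.cn_avoid (e := {u, y}) (Finset.card_pair (Ne.symm hyu)) (v := v)
        (by simp [h.huv.1.symm, Ne.symm hyv]) (by rw [ePQ]; exact hv.mem) hpe hqe hpv hqv
        (by rw [ePQ]; exact hp.mem) (by rw [ePQ]; exact hq.mem)
      refine ReflTransGen.mono (fun a b hab => ?_) _ _ this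
      exact h.laU (r := {y}) (by simp [Ne.symm hyu]) (by simp [Ne.symm hyv]) hab.1 hab.2.1 hab.2.2
    · have := h.nrm.cn {u, y} (Or.inr hp.e.2) (by rw [Finset.card_pair (Ne.symm hyu)]) p q hpe hqe
        (by rw [ePQ]; exact hp.mem) (by rw [ePQ]; exact hq.mem)
      refine ReflTransGen.mono (fun a b hab => ?_) _ _ this
      have nv : ∀ a b, K.LA {u, y} a b → a ≠ v := by
        rintro a b hab rfl
        refine hv ⟨Ne.symm hyu, h.huv.1, hyv, down hab.2.2 ?_ (by simp)⟩
        intro z; simp only [Finset.mem_insert, Finset.mem_singleton]; tauto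
      exact h.laU (r := {y}) (by simp [Ne.symm hyu]) (by simp [Ne.symm hyv]) (nv _ _ hab)
        (nv _ _ hab.symm) hab
  have mix : ∀ {u v : ℕ}, Con K u v w K' → y ≠ u → y ≠ v → ∀ {p q}, p ≠ u → p ≠ v → q ≠ u → q ≠ v →
      K.T u y p → K.T v y q → ReflTransGen (K'.LA {w, y}) p q := by
    intro u v h hyu hyv p q hpu hpv hqu hqv hp hq
    have huvy : K.T u v y := ⟨h.huv.1, Ne.symm hyu, Ne.symm hyv,
      h.lc {y} (by simp [Ne.symm hyu]) (by simp [Ne.symm hyv]) hp.e.2 hq.e.2⟩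
    obtain ⟨x, -, -, hx, -, -⟩ := h.nrm.twoT huvy
    have t1 : K.T u y x := hx.s23.s34.t
    have t2 : K.T v y x := hx.s12.s23.s34.t
    exact (one h hyu hyv hpv t2.2.1.symm hp t1).trans (one h.swap hyv hyu t1.2.1.symm hqu t2 hq)
  rcases hp with hp | hp <;> rcases hq with hq | hq
  · exact one h hyu hyv hpv hqv hp hq
  · exact mix h hyu hyv hpu hpv hqu hqv hp hq
  · exact mix h.swap hyv hyu hpv hpu hqv hqu hp hq
  · exact one h.swap hyv hyu hpu hqu hp hq

theorem cn0 (h : Con K u v w K') {s : Finset ℕ} (hs : s = ∅ ∨ s ∈ K'.faces) (h2 : s.card ≤ 2) :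
    K'.Cn s := by
  intro x y hx hy hxK hyK
  by_cases hw : w ∈ s
  · have hsK : s ∈ K'.faces := by
      rcases hs with rfl | hs
      · simp at hw
      · exact hs
    obtain ⟨r, rfl, h1, hu, hv, -⟩ := h.m1e hsK hw
    have aux : ∀ x, x ∉ insert w r → insert x (insert w r) ∈ K'.faces → x ∉ r ∧ x ≠ u ∧ x ≠ v ∧
        (insert u (insert x r) ∈ K.faces ∨ insert v (insert x r) ∈ K.faces) := by
      intro x hx hxK
      simp only [Finset.mem_insert, not_or] at hx
      rw [Finset.insert_comm, h.m1 _ (by simp [Ne.symm hx.1, h1])] at hxK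
      obtain ⟨a, b, c⟩ := hxK
      simp only [Finset.mem_insert, not_or] at a b
      exact ⟨hx.2, Ne.symm a.1, Ne.symm b.1, c⟩
    obtain ⟨x1, x2, x3, x4⟩ := aux x hx hxK
    obtain ⟨y1, y2, y3, y4⟩ := aux y hy hyK
    have hc : r.card ≤ 1 := by rw [Finset.card_insert_of_notMem h1] at h2; omega
    rcases Nat.lt_or_ge r.card 1 with hc0 | hc0
    · have : r = ∅ := Finset.card_eq_zero.mp (by omega)
      subst this
      refine h.cnw x2 x3 y2 y3 ?_ ?_
      · exact x4.imp (fun hh => ⟨Ne.symm x2, hh⟩) (fun hh => ⟨Ne.symm x3, hh⟩)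
      · exact y4.imp (fun hh => ⟨Ne.symm y2, hh⟩) (fun hh => ⟨Ne.symm y3, hh⟩)
    · obtain ⟨z, rfl⟩ := Finset.card_eq_one.mp (show r.card = 1 by omega)
      simp only [Finset.mem_singleton] at hu hv x1 y1
      rw [Finset.pair_comm] at x4 y4
      rw [Finset.pair_comm] at y4
      refine h.cnwy (Ne.symm hu) (Ne.symm hv) ?_ ?_ x2 x3 y2 y3
      · rw [Finset.pair_comm z x] at x4
        have e : ∀ t : ℕ, insert t ({x, z} : Finset ℕ) = {t, z, x} := fun t => by rw [Finset.pair_comm]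
        rw [e, e] at x4
        exact x4.imp (fun hh => ⟨hu, Ne.symm x2, Ne.symm x1, hh⟩) (fun hh => ⟨hv, Ne.symm x3, Ne.symm x1, hh⟩)
      · have e : ∀ t : ℕ, insert t ({y, z} : Finset ℕ) = {t, z, y} := fun t => by rw [Finset.pair_comm]
        rw [e, e] at y4
        exact y4.imp (fun hh => ⟨hu, Ne.symm y2, Ne.symm y1, hh⟩) (fun hh => ⟨hv, Ne.symm y3, Ne.symm y1, hh⟩)
  · have hs' : (s = ∅ ∨ s ∈ K.faces) ∧ u ∉ s ∧ v ∉ s := by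
      rcases hs with rfl | hs
      · simp
      · have := (h.m0 s hw).mp hs; exact ⟨Or.inr this.1, this.2⟩
    obtain ⟨hsK, hu, hv⟩ := hs'
    classical
    let φ : ℕ → ℕ := fun a => if a = u ∨ a = v then w else a
    have lift : ∀ a, a ∉ s → insert a s ∈ K'.faces → ∃ a', a' ∉ s ∧ insert a' s ∈ K.faces ∧ φ a' = a := by
      intro a ha haK
      by_cases haw : a = w
      · subst haw
        obtain ⟨-, -, c | c⟩ := (h.m1 s hw).mp haK
        · exact ⟨u, hu, c, by simp [φ]⟩
        · exact ⟨v, hv, c, by simp [φ]⟩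
      · obtain ⟨a1, a2, a3⟩ := (h.m0 _ (by simp [hw, Ne.symm haw])).mp haK
        simp only [Finset.mem_insert, not_or] at a2 a3
        exact ⟨a, ha, a1, by simp [φ, Ne.symm a2.1, Ne.symm a3.1]⟩
    have push : ∀ a b, K.LA s a b → ReflTransGen (K'.LA s) (φ a) (φ b) := by
      have half : ∀ a b, K.LA s a b → (a = u ∨ a = v) → ReflTransGen (K'.LA s) (φ a) (φ b) := by
        intro a b hab ha
        by_cases hb : b = u ∨ b = v
        · simp only [φ, ha, hb, if_true]; exact .refl
        · have hb' := hb
          simp only [φ, ha, hb, if_true, if_false]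
          rw [not_or] at hb'
          refine .single ⟨hw, hab.2.1, ?_⟩
          have b1 : u ∉ insert b s := by simp [hu, Ne.symm hb'.1]
          have b2 : v ∉ insert b s := by simp [hv, Ne.symm hb'.2]
          rcases ha with rfl | rfl
          · exact h.mU b1 b2 hab.2.2
          · exact h.mV b1 b2 hab.2.2
      intro a b hab
      by_cases ha : a = u ∨ a = v
      · exact half a b hab ha
      by_cases hb : b = u ∨ b = v
      · exact rsymm (half b a hab.symm hb)
      have ha' := ha
      have hb' := hb
      simp only [φ, ha, hb, if_false]
      rw [not_or] at ha' hb'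
      refine .single ⟨hab.1, hab.2.1, (h.m0 _ (h.nin hab.2.2)).mpr ⟨hab.2.2, ?_, ?_⟩⟩
      · simp [hu, Ne.symm ha'.1, Ne.symm hb'.1]
      · simp [hv, Ne.symm ha'.2, Ne.symm hb'.2]
    obtain ⟨x', x1, x2, rfl⟩ := lift x hx hxK
    obtain ⟨y', y1, y2, rfl⟩ := lift y hy hyK
    have hp := h.nrm.cn s hsK h2 x' y' x1 y1 x2 y2
    clear hx hy hxK hyK y1 y2
    induction hp with
    | refl => exact .refl
    | tail h3 h4 ih => exact ih.trans (push _ _ h4)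

theorem nrm' (h : Con K u v w K') : K'.Nrm where
  ne := ⟨{w}, (h.m1 ∅ (by simp)).mpr ⟨by simp, by simp, Or.inl (down h.huv.2 (by simp) (by simp))⟩⟩
  pure := fun _ hs => h.pure0 hs
  le4 := fun _ hs => h.le0 hs
  two := fun _ hs h3 => h.two0 hs h3
  cn := fun _ hs h2 => h.cn0 hs h2

end Con
end ModF

section ModG
open Relation
namespace Con
variable {K K' : SComplex} {u v w : ℕ}

theorem bdry (h : Con K u v w K') (s : Finset ℕ) :
    s ∈ bdryFaces (K.faces.filter fun α => u ∉ α ∧ v ∉ α) 3 ↔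
      s.Nonempty ∧ u ∉ s ∧ v ∉ s ∧ (insert u s ∈ K.faces ∨ insert v s ∈ K.faces) := by
  simp only [bdryFaces, Finset.mem_filter]
  constructor
  · rintro ⟨⟨hs, hu, hv⟩, r, ⟨hr, hur, hvr⟩, hsr, hr3, hcard⟩
    refine ⟨ne_of_mem hs, hu, hv, ?_⟩
    by_contra hcon
    rw [not_or] at hcon
    obtain ⟨x, y, hxy, hx, hy, hxK, hyK, -⟩ := h.nrm.two _ hr hr3
    obtain ⟨F, hF⟩ := Finset.card_eq_one.mp hcard
    have aux : ∀ x, x ∉ r → insert x r ∈ K.faces → insert x r = F := by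
      intro x hx hxK
      have hxu : x ≠ u := by
        rintro rfl
        exact hcon.1 (down hxK (Finset.insert_subset_insert _ hsr) (by simp))
      have hxv : x ≠ v := by
        rintro rfl
        exact hcon.2 (down hxK (Finset.insert_subset_insert _ hsr) (by simp))
      rw [← Finset.mem_singleton, ← hF]
      simp only [Finset.mem_filter]
      refine ⟨⟨hxK, by simp [hur, Ne.symm hxu], by simp [hvr, Ne.symm hxv]⟩,
        by rw [Finset.card_insert_of_notMem hx]; omega, Finset.subset_insert _ _⟩
    exact hxy (insert_inj_right hx ((aux x hx hxK).trans (aux y hy hyK).symm))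
  · rintro ⟨hne, hu, hv, hh⟩
    have aux : ∀ {u v : ℕ}, Con K u v w K' → u ∉ s → v ∉ s → insert u s ∈ K.faces →
        ∃ r, ((r ∈ K.faces ∧ u ∉ r ∧ v ∉ r) ∧ s ⊆ r ∧ r.card = 3 ∧
          ((K.faces.filter fun α => u ∉ α ∧ v ∉ α).filter fun t => t.card = 3 + 1 ∧ r ⊆ t).card = 1) := by
      intro u v h hu hv hK
      obtain ⟨R, h1, h2, h3, h4, h5⟩ := h.ext hu hv hK
      have hRne : R.Nonempty := by rw [← Finset.card_pos]; omega
      have hRK : R ∈ K.faces := down h5 (Finset.subset_insert _ _) hRne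
      refine ⟨R, ⟨hRK, h3, h4⟩, h1, h2, ?_⟩
      have : ∃ x, x ≠ u ∧ x ∉ R ∧ insert x R ∈ K.faces ∧
          ∀ z, z ∉ R → z ≠ u → insert z R ∈ K.faces → z = x := by
        obtain ⟨x, y, hxy, hx, hy, hxK, hyK, hall⟩ := h.nrm.two _ hRK h2
        rcases hall u h3 h5 with rfl | rfl
        · refine ⟨y, Ne.symm hxy, hy, hyK, fun z z1 z2 z3 => ?_⟩
          have := hall z z1 z3; omega
        · refine ⟨x, hxy, hx, hxK, fun z z1 z2 z3 => ?_⟩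
          have := hall z z1 z3; omega
      obtain ⟨x, x1, x2, x3, x4⟩ := this
      have hxv : x ≠ v := by rintro rfl; exact h.no3 h2 h3 h4 h5 x3
      rw [Finset.card_eq_one]
      refine ⟨insert x R, ?_⟩
      ext F
      simp only [Finset.mem_filter, Finset.mem_singleton]
      constructor
      · rintro ⟨⟨a1, a2, a3⟩, a4, a5⟩
        obtain ⟨z, hz, rfl⟩ := insert_eq_of_card a5 (by omega)
        rw [x4 z hz (by rintro rfl; simp at a2) a1]
      · rintro rfl
        exact ⟨⟨x3, by simp [h3, Ne.symm x1], by simp [h4, Ne.symm hxv]⟩,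
          by rw [Finset.card_insert_of_notMem x2]; omega, Finset.subset_insert _ _⟩
    rcases hh with hh | hh
    · obtain ⟨r, h1, h2, h3, h4⟩ := aux h hu hv hh
      exact ⟨⟨down hh (Finset.subset_insert _ _) hne, hu, hv⟩, r, h1, h2, h3, h4⟩
    · obtain ⟨r, h1, h2, h3, h4⟩ := aux h.swap hv hu hh
      refine ⟨⟨down hh (Finset.subset_insert _ _) hne, hu, hv⟩, r, ⟨h1.1, h1.2.2, h1.2.1⟩, h2, h3, ?_⟩
      have e : (K.faces.filter fun α => u ∉ α ∧ v ∉ α) = K.faces.filter fun α => v ∉ α ∧ u ∉ α := by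
        ext s; simp only [Finset.mem_filter]; tauto
      rw [e]; exact h4

theorem contr (h : Con K u v w K') : EdgeContraction K K' := by
  refine ⟨u, v, h.huv.2, h.huv.1, ?_, w, h.hw, ?_⟩
  · ext s
    rw [Finset.mem_inter, mem_lk', mem_lk', mem_lk']
    have e1 : ∀ z : ℕ, s ∪ {z} = insert z s := fun z => by rw [Finset.union_comm, ← Finset.insert_eq]
    have e2 : s ∪ {u, v} = insert u (insert v s) := by
      ext z; simp only [Finset.mem_union, Finset.mem_insert, Finset.mem_singleton]; tauto
    have e3 : ∀ z : ℕ, s ∩ {z} = ∅ ↔ z ∉ s := by 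
      intro z
      rw [Finset.eq_empty_iff_forall_notMem]
      simp only [Finset.mem_inter, Finset.mem_singleton]
      constructor
      · intro hh a; exact hh z ⟨a, rfl⟩
      · rintro a y ⟨hy, rfl⟩; exact a hy
    have e4 : s ∩ {u, v} = ∅ ↔ u ∉ s ∧ v ∉ s := by
      rw [Finset.eq_empty_iff_forall_notMem]
      simp only [Finset.mem_inter, Finset.mem_insert, Finset.mem_singleton]
      constructor
      · intro hh; exact ⟨fun a => hh u ⟨a, Or.inl rfl⟩, fun a => hh v ⟨a, Or.inr rfl⟩⟩
      · rintro ⟨a, b⟩ z ⟨hz, rfl | rfl⟩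
        exacts [a hz, b hz]
    rw [e1, e1, e2, e3, e3, e4]
    constructor
    · rintro ⟨⟨a1, a2, a3⟩, b1, b2, b3⟩
      exact ⟨a1, ⟨a2, b2⟩, h.lc s a2 b2 a3 b3⟩
    · rintro ⟨a1, ⟨a2, a3⟩, a4⟩
      refine ⟨⟨a1, a2, ?_⟩, a1, a3, down a4 (Finset.subset_insert _ _) (by simp)⟩
      exact down a4 (Finset.insert_subset_insert _ (Finset.subset_insert _ _)) (by simp)
  · ext s
    simp only [coneFaces, Finset.mem_union, Finset.mem_image, Finset.mem_singleton, h.bdry]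
    rw [Finset.mem_filter]
    by_cases hw : w ∈ s
    · have nf : ¬ s ∈ K.faces := fun hh => h.nin hh hw
      constructor
      · intro hs
        obtain ⟨r, rfl, h1, h2, h3, h4⟩ := h.m1e hs hw
        rcases r.eq_empty_or_nonempty with rfl | hr
        · right; right; rfl
        · right; left; right; exact ⟨r, ⟨hr, h2, h3, h4⟩, rfl⟩
      · rintro (hs | (⟨_, -, -, hs⟩ | ⟨r, ⟨hr, h2, h3, h4⟩, rfl⟩) | rfl)
        · exact absurd hs.1 nf
        · exact absurd hw (hs.elim h.ninI h.ninI)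
        · exact (h.m1 r (h4.elim h.ninI h.ninI)).mpr ⟨h2, h3, h4⟩
        · exact h.mU (s := ∅) (by simp) (by simp) (down h.huv.2 (by simp) (by simp))
    · rw [h.m0 s hw]
      constructor
      · intro hs; exact Or.inl hs
      · rintro (hs | (⟨a, b, c, hs⟩ | ⟨r, -, rfl⟩) | rfl)
        · exact hs
        · exact ⟨hs.elim (fun hh => down hh (Finset.subset_insert _ _) a)
            (fun hh => down hh (Finset.subset_insert _ _) a), b, c⟩
        · simp at hw
        · simp at hw

theorem f0 (h : Con K u v w K') : K'.fnum 0 + 1 = K.fnum 0 := by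
  rw [fnum_zero, fnum_zero]
  have hu : u ∈ K.vertexSet := subset_vertexSet h.huv.2 (by simp)
  have hv : v ∈ K.vertexSet := subset_vertexSet h.huv.2 (by simp)
  have : K'.vertexSet = insert w ((K.vertexSet.erase u).erase v) := by
    ext x
    rw [Finset.mem_insert, Finset.mem_erase, Finset.mem_erase, mem_vertexSet, mem_vertexSet]
    by_cases hx : x = w
    · subst hx
      simp only [true_or, iff_true]
      exact h.mU (s := ∅) (by simp) (by simp) (down h.huv.2 (by simp) (by simp))
    · rw [h.m0 _ (by simpa using Ne.symm hx)]
      simp only [Finset.mem_singleton, hx, false_or]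
      tauto
  rw [this, Finset.card_insert_of_notMem, Finset.card_erase_of_mem, Finset.card_erase_of_mem hu]
  · have : 2 ≤ K.vertexSet.card := by
      rw [← Finset.card_pair h.huv.1]
      exact Finset.card_le_card (subset_vertexSet h.huv.2)
    omega
  · exact Finset.mem_erase.mpr ⟨h.huv.1.symm, hv⟩
  · intro hh
    exact h.hw (Finset.mem_of_mem_erase (Finset.mem_of_mem_erase hh))

theorem inj_pair (u : ℕ) (A : Finset ℕ) (hA : u ∉ A) :
    (A.image fun x => ({u, x} : Finset ℕ)).card = A.card := by
  refine Finset.card_image_of_injOn ?_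
  intro x hx y hy hxy
  have : x ∈ ({u, y} : Finset ℕ) := by rw [← show ({u, x} : Finset ℕ) = {u, y} from hxy]; simp
  simp only [Finset.mem_insert, Finset.mem_singleton] at this
  rcases this with rfl | rfl
  · exact absurd hx hA
  · rfl

theorem f1 (h : Con K u v w K') : K'.fnum 1 + 1 + K.deg {u, v} = K.fnum 1 := by
  classical
  set A := (K.lk {u}).vertexSet with hA
  set B := (K.lk {v}).vertexSet with hB
  set E0 := K.faces.filter fun s => s.card = 2 ∧ u ∉ s ∧ v ∉ s with hE0
  have uA : u ∉ A := fun hh => (mem_lk1.mp hh).1 rfl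
  have vB : v ∉ B := fun hh => (mem_lk1.mp hh).1 rfl
  have vA : v ∈ A := mem_lk1.mpr h.huv
  have uB : u ∈ B := mem_lk1.mpr h.huv.symm
  have hAB : K.deg {u, v} = (A.erase v ∩ B.erase u).card := by
    rw [deg_two]
    congr 1
    ext x
    rw [mem_lk2 h.huv.1, Finset.mem_inter, Finset.mem_erase, Finset.mem_erase, hA, hB, mem_lk1, mem_lk1]
    constructor
    · intro t; exact ⟨⟨t.2.2.1.symm, t.s23.e⟩, t.2.1.symm, t.s12.s23.e⟩
    · rintro ⟨⟨a, b⟩, c, d⟩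
      exact ⟨h.huv.1, Ne.symm c, Ne.symm a, h.lc {x} (by simp [Ne.symm c]) (by simp [Ne.symm a]) b.2 d.2⟩
  have e1 : K.fnum 1 = E0.card + (A.card + (B.erase u).card) := by
    unfold fnum
    rw [← inj_pair u A uA, ← inj_pair v (B.erase u) (fun hh => vB (Finset.mem_of_mem_erase hh)),
      ← Finset.card_union_of_disjoint, ← Finset.card_union_of_disjoint]
    · congr 1
      ext s
      simp only [Finset.mem_filter, Finset.mem_union, Finset.mem_image, hE0, Finset.mem_erase, hA, hB, mem_lk1]
      constructor
      · rintro ⟨hs, h2⟩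
        by_cases hu : u ∈ s
        · right; left
          obtain ⟨x, hx, rfl⟩ := insert_eq_of_card (s := {u}) (F := s) (by simpa using hu) (by simpa using h2)
          rw [Finset.pair_comm] at hs
          refine ⟨x, ⟨by simpa using Ne.symm (by simpa using hx), hs⟩, Finset.pair_comm _ _⟩
        · by_cases hv : v ∈ s
          · right; right
            obtain ⟨x, hx, rfl⟩ := insert_eq_of_card (s := {v}) (F := s) (by simpa using hv) (by simpa using h2)
            rw [Finset.pair_comm] at hs
            refine ⟨x, ⟨?_, by simpa using Ne.symm (by simpa using hx), hs⟩, Finset.pair_comm _ _⟩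
            rintro rfl; simp at hu
          · left; exact ⟨hs, h2, hu, hv⟩
      · rintro (hs | ⟨x, hx, rfl⟩ | ⟨x, hx, rfl⟩)
        · exact ⟨hs.1, hs.2.1⟩
        · exact ⟨hx.2, Finset.card_pair hx.1⟩
        · exact ⟨hx.2.2, Finset.card_pair hx.2.1⟩
    · rw [Finset.disjoint_left]
      intro s hs hs'
      rw [hE0, Finset.mem_filter] at hs
      simp only [Finset.mem_union, Finset.mem_image] at hs'
      rcases hs' with ⟨x, -, rfl⟩ | ⟨x, -, rfl⟩
      · exact hs.2.2.1 (by simp)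
      · exact hs.2.2.2 (by simp)
    · rw [Finset.disjoint_left]
      intro s hs hs'
      simp only [Finset.mem_image] at hs hs'
      obtain ⟨x, hx, rfl⟩ := hs
      obtain ⟨y, hy, hxy⟩ := hs'
      have : u ∈ ({v, y} : Finset ℕ) := by rw [hxy]; simp
      simp only [Finset.mem_insert, Finset.mem_singleton] at this
      rcases this with hh | rfl
      · exact h.huv.1 hh
      · simp at hy
  have e2 : K'.fnum 1 = E0.card + (A.erase v ∪ B.erase u).card := by
    unfold fnum
    have wn : w ∉ A.erase v ∪ B.erase u := by
      intro hh
      simp only [Finset.mem_union, Finset.mem_erase, hA, hB, mem_lk1] at hh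
      rcases hh with hh | hh
      · exact h.nin hh.2.2 (by simp)
      · exact h.nin hh.2.2 (by simp)
    rw [← inj_pair w _ wn, ← Finset.card_union_of_disjoint]
    · congr 1
      ext s
      simp only [Finset.mem_filter, Finset.mem_union, Finset.mem_image, hE0, Finset.mem_erase, hA, hB, mem_lk1]
      constructor
      · rintro ⟨hs, h2⟩
        by_cases hw : w ∈ s
        · right
          obtain ⟨r, rfl, h1, hu, hv, h4⟩ := h.m1e hs hw
          rw [Finset.card_insert_of_notMem h1] at h2
          obtain ⟨x, rfl⟩ := Finset.card_eq_one.mp (show r.card = 1 by omega)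
          simp only [Finset.mem_singleton] at hu hv
          exact ⟨x, h4.imp (fun hh => ⟨Ne.symm hv, hu, hh⟩) (fun hh => ⟨Ne.symm hu, hv, hh⟩), rfl⟩
        · left
          have := (h.m0 s hw).mp hs
          exact ⟨this.1, h2, this.2⟩
      · rintro (hs | ⟨x, hx, rfl⟩)
        · exact ⟨(h.m0 s (h.nin hs.1)).mpr ⟨hs.1, hs.2.2⟩, hs.2.1⟩
        · rcases hx with hx | hx
          · refine ⟨h.mU (by simpa using hx.2.1) (by simpa using Ne.symm hx.1) hx.2.2, ?_⟩
            refine Finset.card_pair ?_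
            rintro rfl; exact h.nin hx.2.2 (by simp)
          · refine ⟨h.mV (by simpa using Ne.symm hx.1) (by simpa using hx.2.1) hx.2.2, ?_⟩
            refine Finset.card_pair ?_
            rintro rfl; exact h.nin hx.2.2 (by simp)
    · rw [Finset.disjoint_left]
      intro s hs hs'
      rw [hE0, Finset.mem_filter] at hs
      simp only [Finset.mem_image] at hs'
      obtain ⟨x, -, rfl⟩ := hs'
      exact h.nin hs.1 (by simp)
  have e3 := Finset.card_union_add_card_inter (A.erase v) (B.erase u)
  have e4 := Finset.card_erase_add_one vA
  omega

theorem g2_lt (h : Con K u v w K') : K'.g2 < K.g2 := by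
  have := h.f0
  have := h.f1
  have := h.deg4
  unfold g2
  omega

end Con

/-- every edge has a vertex completing a missing triangle -/
theorem Good.miss {K : SComplex} (h : Good K) {u v : ℕ} (huv : K.E u v) :
    ∃ z, K.E u z ∧ K.E v z ∧ ¬ K.T u v z := by
  by_contra hcon
  push Not at hcon
  have lc1 : ∀ z, K.E u z → K.E v z → K.T u v z := hcon
  have lc2 : ∀ a b, K.T u a b → K.T v a b → K.Q u v a b := by
    intro a b h1 h2
    exact h.fill (lc1 a h1.e h2.e) (lc1 b h1.s23.e h2.s23.e) h1 h2
  obtain ⟨w, hw⟩ := Infinite.exists_notMem_finset K.vertexSet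
  have lc : ∀ s, u ∉ s → v ∉ s → insert u s ∈ K.faces → insert v s ∈ K.faces →
    insert u (insert v s) ∈ K.faces := by
    intro s hu hv h1 h2
    have h3 : s.card ≤ 3 := by
      have := h.nrm.le4 _ h1
      rw [Finset.card_insert_of_notMem hu] at this; omega
    interval_cases hc : s.card
    · rw [Finset.card_eq_zero] at hc; subst hc; exact huv.2
    · obtain ⟨x, rfl⟩ := Finset.card_eq_one.mp hc
      simp only [Finset.mem_singleton] at hu hv
      exact (lc1 x ⟨hu, h1⟩ ⟨hv, h2⟩).mem
    · obtain ⟨x, y, hxy, rfl⟩ := Finset.card_eq_two.mp hc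
      simp only [Finset.mem_insert, Finset.mem_singleton, not_or] at hu hv
      exact (lc2 x y ⟨hu.1, hu.2, hxy, h1⟩ ⟨hv.1, hv.2, hxy, h2⟩).mem
    · exfalso
      obtain ⟨x, y, z, hxy, hxz, hyz, rfl⟩ := Finset.card_eq_three.mp hc
      simp only [Finset.mem_insert, Finset.mem_singleton, not_or] at hu hv
      have q1 : K.Q u x y z := ⟨hu.1, hu.2.1, hu.2.2, hxy, hxz, hyz, h1⟩
      have q2 : K.Q v x y z := ⟨hv.1, hv.2.1, hv.2.2, hxy, hxz, hyz, h2⟩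
      exact h.noDeg3 (lc2 x y q1.t q2.t) (lc2 y z q1.s23.s34.t q2.s23.s34.t)
        (lc2 z x q1.s34.t.s23 q2.s34.t.s23)
  let p : Finset ℕ → Prop := fun s => (w ∉ s ∧ s ∈ K.faces ∧ u ∉ s ∧ v ∉ s) ∨
    (w ∈ s ∧ u ∉ s.erase w ∧ v ∉ s.erase w ∧
      (insert u (s.erase w) ∈ K.faces ∨ insert v (s.erase w) ∈ K.faces))
  have hp : ∀ s, p s → ∀ t ⊆ s, t ≠ ∅ → p t := by
    intro s hs t hts ht
    have htn := Finset.nonempty_iff_ne_empty.mpr ht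
    rcases hs with ⟨a, b, c, d⟩ | ⟨a, b, c, d⟩
    · exact Or.inl ⟨fun hh => a (hts hh), down b hts htn, fun hh => c (hts hh), fun hh => d (hts hh)⟩
    · have hte : t.erase w ⊆ s.erase w := Finset.erase_subset_erase _ hts
      by_cases hwt : w ∈ t
      · refine Or.inr ⟨hwt, fun hh => b (hte hh), fun hh => c (hte hh), ?_⟩
        exact d.imp (fun hh => down hh (Finset.insert_subset_insert _ hte) (by simp))
          (fun hh => down hh (Finset.insert_subset_insert _ hte) (by simp))
      · rw [Finset.erase_eq_of_notMem hwt] at hte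
        refine Or.inl ⟨hwt, ?_, fun hh => b (hte hh), fun hh => c (hte hh)⟩
        exact d.elim (fun hh => down hh (hte.trans (Finset.subset_insert _ _)) htn)
          (fun hh => down hh (hte.trans (Finset.subset_insert _ _)) htn)
  let K' := mk' (insert w K.vertexSet) p hp
  have con : Con K u v w K' := by
    refine ⟨h.nrm, huv, hw, lc, h.deg_ge4 huv, ?_, ?_⟩
    · intro s hs
      rw [mem_mk']
      constructor
      · rintro ⟨-, -, ⟨-, a⟩ | ⟨a, -⟩⟩
        · exact a
        · exact absurd a hs
      · intro a
        exact ⟨(subset_vertexSet a.1).trans (Finset.subset_insert _ _), ne_of_mem a.1, Or.inl ⟨hs, a⟩⟩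
    · intro s hs
      rw [mem_mk']
      have e : (insert w s).erase w = s := Finset.erase_insert hs
      constructor
      · rintro ⟨-, -, ⟨a, -⟩ | ⟨-, a⟩⟩
        · simp at a
        · rw [e] at a; exact a
      · intro a
        refine ⟨Finset.insert_subset_insert _ ?_, by simp, Or.inr ⟨by simp, by rw [e]; exact a⟩⟩
        exact a.2.2.elim (fun hh => (Finset.subset_insert _ _).trans (subset_vertexSet hh))
          (fun hh => (Finset.subset_insert _ _).trans (subset_vertexSet hh))
  have := h.inR.2.2.2.2 K' con.nrm'.toNormal (Or.inr (Or.inl con.contr))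
  have := con.g2_lt
  omega
end ModG

section ModT
section Sphere
open Topology

abbrev S2 := ↥(Metric.sphere (0 : EuclideanSpace ℝ (Fin 3)) 1)

theorem lift_half {X E : Type*} [TopologicalSpace X] [TopologicalSpace E] {p : E → X}
    (hp : IsCoveringMap p) (f : C(S2, X)) (v : S2) (a : S2) (ha : a ≠ v) (e₀ : E) (he : p e₀ = f a) :
    ∃ s : S2 → E, ContinuousOn s {v}ᶜ ∧ (∀ x, x ≠ v → p (s x) = f x) ∧ s a = e₀ := by
  have hv : ‖(v : EuclideanSpace ℝ (Fin 3))‖ = 1 := norm_eq_of_mem_sphere v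
  set st := stereographic hv with hst
  have hsrc : st.source = {v}ᶜ := stereographic_source hv
  haveI : SimplyConnectedSpace ((ℝ ∙ (v : EuclideanSpace ℝ (Fin 3)))ᗮ : Submodule ℝ _) :=
    SimplyConnectedSpace.ofContractible _
  let g : C(((ℝ ∙ (v : EuclideanSpace ℝ (Fin 3)))ᗮ : Submodule ℝ _), X) :=
    f.comp ⟨st.symm, (isOpenEmbedding_stereographic_symm hv).continuous⟩
  have hg : ∀ x, x ≠ v → g (st x) = f x := by
    intro x hx
    show f (st.symm (st x)) = f x
    rw [st.left_inv (by rw [hsrc]; exact hx)]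
  obtain ⟨F, ⟨hF0, hF⟩, -⟩ := hp.existsUnique_continuousMap_lifts g (st a) e₀
    (by rw [he, hg a ha])
  refine ⟨F ∘ st, ?_, ?_, hF0⟩
  · rw [← hsrc]
    exact F.continuous.comp_continuousOn st.continuousOn
  · intro x hx
    have := congrFun hF (st x)
    rw [← hg x hx]; exact this

theorem sphere_two_pts (v : S2) : IsConnected ({v}ᶜ ∩ {-v}ᶜ : Set S2) := by
  have hv : ‖(v : EuclideanSpace ℝ (Fin 3))‖ = 1 := norm_eq_of_mem_sphere v
  set st := stereographic hv with hst
  have hsrc : st.source = {v}ᶜ := stereographic_source hv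
  have h0 : st (-v) = 0 := stereographic_apply_neg v
  haveI : Fact (Module.finrank ℝ (EuclideanSpace ℝ (Fin 3)) = 2 + 1) := ⟨by simp⟩
  have hr : Module.finrank ℝ ((ℝ ∙ (v : EuclideanSpace ℝ (Fin 3)))ᗮ : Submodule ℝ _) = 2 :=
    Submodule.finrank_orthogonal_span_singleton (n := 2) (by
      intro h; rw [h] at hv; simp at hv)
  have hc : IsConnected ({0}ᶜ : Set ((ℝ ∙ (v : EuclideanSpace ℝ (Fin 3)))ᗮ : Submodule ℝ _)) := by
    apply isConnected_compl_singleton_of_one_lt_rank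
    rw [← Module.finrank_eq_rank, hr]
    norm_num
  have := hc.image st.symm (isOpenEmbedding_stereographic_symm hv).continuous.continuousOn
  convert this using 1
  have hne : -v ≠ v := by
    intro h
    exact ne_neg_of_mem_unit_sphere ℝ v h.symm
  have h1 : st.symm 0 = -v := by
    rw [← h0, st.left_inv]; rw [hsrc]; exact hne
  ext x
  simp only [Set.mem_inter_iff, Set.mem_compl_iff, Set.mem_singleton_iff, Set.mem_image]
  constructor
  · rintro ⟨hx, hx'⟩
    have hl := st.left_inv (x := x) (by rw [hsrc]; exact hx)
    refine ⟨st x, ?_, hl⟩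
    intro h; rw [h, h1] at hl; exact hx' hl.symm
  · rintro ⟨y, hy, rfl⟩
    refine ⟨?_, ?_⟩
    · have : st.symm y ∈ st.source := st.map_target (by simp [st])
      rw [hsrc] at this; exact this
    · rw [← h1]; intro h
      exact hy ((isOpenEmbedding_stereographic_symm hv).injective h)

theorem sphere_section {X E : Type*} [TopologicalSpace X] [TopologicalSpace E] {p : E → X}
    (hp : IsCoveringMap p) (hsurj : Function.Surjective p) (f : C(S2, X)) :
    ∃ s : S2 → E, Continuous s ∧ ∀ x, p (s x) = f x := by
  let v : S2 := ⟨EuclideanSpace.single 0 1, by simp⟩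
  obtain ⟨⟨a, ha1, ha2⟩, hcon⟩ := sphere_two_pts v
  have hne : -v ≠ v := by
    intro h
    exact ne_neg_of_mem_unit_sphere ℝ v h.symm
  obtain ⟨e₀, he⟩ := hsurj (f a)
  obtain ⟨s1, c1, l1, b1⟩ := lift_half hp f v a ha1 e₀ he
  obtain ⟨s2, c2, l2, b2⟩ := lift_half hp f (-v) a ha2 e₀ he
  have heq : Set.EqOn s1 s2 ({v}ᶜ ∩ {-v}ᶜ) :=
    hp.eqOn_of_comp_eqOn hcon (c1.mono Set.inter_subset_left) (c2.mono Set.inter_subset_right)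
      (fun x hx => by simp only [Function.comp]; rw [l1 x hx.1, l2 x hx.2]) ⟨ha1, ha2⟩
      (b1.trans b2.symm)
  classical
  refine ⟨fun x => if x = v then s2 x else s1 x, ?_, ?_⟩
  · rw [continuous_iff_continuousAt]
    intro x
    by_cases hx : x = v
    · have hopen : IsOpen ({-v}ᶜ : Set S2) := isOpen_compl_singleton
      have hmem : ({-v}ᶜ : Set S2) ∈ 𝓝 x := hopen.mem_nhds (by rw [hx]; exact hne.symm)
      refine ((c2.continuousAt hmem)).congr ?_
      filter_upwards [hmem] with y hy
      by_cases hyv : y = v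
      · simp [hyv]
      · simp only [hyv, if_false]; exact (heq ⟨hyv, hy⟩).symm
    · have hopen : IsOpen ({v}ᶜ : Set S2) := isOpen_compl_singleton
      have hmem : ({v}ᶜ : Set S2) ∈ 𝓝 x := hopen.mem_nhds hx
      refine ((c1.continuousAt hmem)).congr ?_
      filter_upwards [hmem] with y hy
      simp only [if_neg (show ¬ y = v from hy)]
  · intro x
    by_cases hx : x = v
    · simp only [hx, if_true]; exact l2 v hne.symm
    · simp only [hx, if_false]; exact l1 x hx

end Sphere
end ModT

section ModU
section Cocycle
open Topology

theorem faces_of_pos {L : SComplex} (p : L.realSpace) {s : Finset ℕ} (hs : s.Nonempty)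
    (h : ∀ x ∈ s, 0 < p.1 x) : s ∈ L.faces := by
  obtain ⟨hp, F, hF, hv, hsum⟩ := p.2
  exact down hF (fun x hx => hv x (h x hx).ne') hs

theorem exists_pos {L : SComplex} (p : L.realSpace) : ∃ x, 0 < p.1 x := by
  obtain ⟨hp, F, hF, hv, hsum⟩ := p.2
  by_contra! hc
  have : ∑ v ∈ F, p.1 v ≤ 0 := Finset.sum_nonpos fun v _ => hc v
  linarith

/-- The two-fold cover determined by a cocycle. -/
noncomputable def cover (L : SComplex) (g : ℕ → ℕ → ZMod 2)
    (hg : ∀ x y z, ({x, y, z} : Finset ℕ) ∈ L.faces → g x y + g y z = g x z) :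
    FiberBundleCore ℕ L.realSpace (ZMod 2) where
  baseSet x := {p | 0 < p.1 x}
  isOpen_baseSet x := isOpen_lt continuous_const ((continuous_apply x).comp continuous_subtype_val)
  indexAt p := (exists_pos p).choose
  mem_baseSet_at p := (exists_pos p).choose_spec
  coordChange x y _ a := a + g x y
  coordChange_self x p hp a := by
    have := hg x x x (faces_of_pos p (by simp) (by simpa using hp))
    simpa using this
  continuousOn_coordChange x y := by
    apply Continuous.continuousOn
    exact (continuous_of_discreteTopology (f := fun a : ZMod 2 => a + g x y)).comp continuous_snd
  coordChange_comp x y z p hp a := by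
    have := hg x y z (faces_of_pos p (by simp) (by
      intro w hw
      simp only [Finset.mem_insert, Finset.mem_singleton] at hw
      rcases hw with rfl | rfl | rfl
      · exact hp.1.1
      · exact hp.1.2
      · exact hp.2))
    rw [add_assoc, this]

theorem star_preconnected (L : SComplex) (x : ℕ) :
    IsPreconnected {p : L.realSpace | 0 < p.1 x} := by
  classical
  by_cases hx : ({x} : Finset ℕ) ∈ L.faces
  swap
  · convert isPreconnected_empty
    ext p
    simp only [Set.mem_ofPred_eq, Set.mem_empty_iff_false, iff_false]
    intro h
    exact hx (faces_of_pos p (by simp) (by simpa using h))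
  have hmem : ∀ (p : L.realSpace), 0 < p.1 x → ∀ τ : unitInterval,
      ((τ : ℝ) • p.1 + (1 - (τ : ℝ)) • (Pi.single x 1 : ℕ → ℝ)) ∈ L.realSpace := by
    rintro p hpx τ
    obtain ⟨hp, F, hF, hv, hsum⟩ := p.2
    have h0 := τ.2.1
    have h1 := τ.2.2
    refine ⟨?_, F, hF, ?_, ?_⟩
    · intro v
      simp only [Pi.add_apply, Pi.smul_apply, smul_eq_mul]
      have h2 : 0 ≤ (Pi.single x 1 : ℕ → ℝ) v := by
        by_cases h : v = x
        · subst h; simp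
        · simp [h]
      have := hp v
      have h3 : 0 ≤ 1 - (τ : ℝ) := by linarith
      positivity
    · intro v hv'
      by_cases h : v = x
      · subst h; exact hv v hpx.ne'
      · apply hv
        intro h4
        apply hv'
        simp [h4, h]
    · simp only [Pi.add_apply, Pi.smul_apply, smul_eq_mul]
      rw [Finset.sum_add_distrib, ← Finset.mul_sum, ← Finset.mul_sum, hsum]
      have : ∑ i ∈ F, (Pi.single x 1 : ℕ → ℝ) i = 1 := by
        rw [Finset.sum_pi_single']
        simp [hv x hpx.ne']
      rw [this]; ring
  rcases Set.eq_empty_or_nonempty {p : L.realSpace | 0 < p.1 x} with h | ⟨p0, hp0⟩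
  · rw [h]; exact isPreconnected_empty
  have hc : (Pi.single x 1 : ℕ → ℝ) ∈ L.realSpace := by
    have := hmem p0 hp0 0
    simpa using this
  apply isPreconnected_of_forall (⟨Pi.single x 1, hc⟩ : L.realSpace)
  intro p hp
  refine ⟨Set.range fun τ : unitInterval => (⟨_, hmem p hp τ⟩ : L.realSpace), ?_, ⟨0, ?_⟩, ⟨1, ?_⟩, ?_⟩
  · rintro _ ⟨τ, rfl⟩
    have h0 := τ.2.1
    have h1 := τ.2.2
    have hp' : 0 < p.1 x := hp
    simp only [Set.mem_ofPred_eq, Pi.add_apply, Pi.smul_apply, smul_eq_mul, Pi.single_eq_same, mul_one]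
    rcases h1.lt_or_eq with h | h
    · have : 0 ≤ (τ : ℝ) * p.1 x := by positivity
      linarith
    · rw [h]; simpa using hp'
  · simp
  · simp
  · apply isPreconnected_range
    apply Continuous.subtype_mk
    fun_prop

theorem coboundary {L : SComplex} (e : L.realSpace ≃ₜ S2) (g : ℕ → ℕ → ZMod 2)
    (hg : ∀ x y z, ({x, y, z} : Finset ℕ) ∈ L.faces → g x y + g y z = g x z) :
    ∃ h : ℕ → ZMod 2, ∀ x y, ({x, y} : Finset ℕ) ∈ L.faces → g x y = h x + h y := by
  classical
  let Z := cover L g hg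
  have hcov : IsCoveringMap (Bundle.TotalSpace.proj : Z.TotalSpace → L.realSpace) :=
    FiberBundle.isCoveringMap
  obtain ⟨s', hs', hps'⟩ := sphere_section hcov (fun b => ⟨⟨b, (0 : ZMod 2)⟩, rfl⟩)
    ⟨e.symm, e.symm.continuous⟩
  let s : L.realSpace → Z.TotalSpace := s' ∘ e
  have hs : Continuous s := hs'.comp e.continuous
  have hps : ∀ p, (s p).1 = p := by
    intro p
    have h1 := hps' (e p)
    have h2 : e.symm (e p) = p := e.symm_apply_apply p
    exact h1.trans h2
  let c : ℕ → L.realSpace → ZMod 2 := fun x p => (Z.localTriv x (s p)).2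
  have hc : ∀ x p, c x p = (show ZMod 2 from (s p).2) + g (Z.indexAt p) x := by
    intro x p
    show (Z.localTriv x (s p)).2 = _
    rw [FiberBundleCore.localTriv_apply]
    show (show ZMod 2 from (s p).2) + g (Z.indexAt (s p).1) x = _
    rw [hps]
  have hcc : ∀ x, ContinuousOn (c x) {p | 0 < p.1 x} := by
    intro x
    apply continuous_snd.comp_continuousOn
    apply (Z.localTriv x).continuousOn.comp hs.continuousOn
    intro p hp
    rw [FiberBundleCore.mem_localTriv_source]
    show 0 < (s p).1.1 x
    rw [hps]; exact hp
  have hconst : ∀ x, ∃ h : ZMod 2, ∀ p : L.realSpace, 0 < p.1 x → c x p = h := by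
    intro x
    rcases Set.eq_empty_or_nonempty {p : L.realSpace | 0 < p.1 x} with h | ⟨p0, hp0⟩
    · refine ⟨0, fun p hp => ?_⟩
      have : p ∈ {p : L.realSpace | 0 < p.1 x} := hp
      rw [h] at this; exact this.elim
    · exact ⟨c x p0, fun p hp => (star_preconnected L x).constant (hcc x) hp hp0⟩
  choose h hh using hconst
  refine ⟨h, fun x y hxy => ?_⟩
  obtain ⟨p, hpx, hpy⟩ : ∃ p : L.realSpace, 0 < p.1 x ∧ 0 < p.1 y := by
    by_cases hne : x = y
    · subst hne
      refine ⟨⟨Pi.single x 1, ?_, {x}, by simpa using hxy, ?_, ?_⟩, ?_, ?_⟩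
      · intro v
        by_cases h : v = x
        · subst h; simp
        · simp [h]
      · intro v hv
        by_contra h
        exact hv (by simp at h; simp [h])
      · simp
      · simp
      · simp
    · refine ⟨⟨fun v => if v = x then 1/2 else if v = y then 1/2 else 0, ?_, {x, y}, hxy, ?_, ?_⟩,
        ?_, ?_⟩
      · intro v; dsimp only; split_ifs <;> norm_num
      · intro v hv
        by_contra h
        simp at h
        apply hv; simp [h.1, h.2]
      · rw [Finset.sum_pair hne]; simp [Ne.symm hne]; norm_num
      · simp
      · simp [Ne.symm hne]
  have h1 := hh x p hpx
  have h2 := hh y p hpy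
  rw [hc] at h1 h2
  have hi : 0 < p.1 (Z.indexAt p) := Z.mem_baseSet_at p
  have h3 := hg (Z.indexAt p) x y (faces_of_pos p (by simp) (by
      intro w hw
      simp only [Finset.mem_insert, Finset.mem_singleton] at hw
      rcases hw with rfl | rfl | rfl
      · exact hi
      · exact hpx
      · exact hpy))
  rw [← h1, ← h2]
  generalize g (Z.indexAt p) x = A at *
  generalize g (Z.indexAt p) y = B at *
  generalize g x y = C at *
  have : ∀ (k A B C : ZMod 2), A + C = B → C = (k + A) + (k + B) := by decide
  exact this _ _ _ _ h3

end Cocycle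
end ModU

section ModV
section Duality

/-- mod 2 boundary operator from triangles to edges of a complex -/
noncomputable def bd (L : SComplex) : (Finset ℕ → ZMod 2) →ₗ[ZMod 2] (Finset ℕ → ZMod 2) where
  toFun t e := if e.card = 2 then
    ∑ T ∈ L.faces.filter (fun T => T.card = 3 ∧ e ⊆ T), t T else 0
  map_add' s t := by
    funext e
    by_cases h : e.card = 2
    · simp [h, Finset.sum_add_distrib]
    · simp [h]
  map_smul' k t := by
    funext e
    by_cases h : e.card = 2
    · simp [h, Finset.mul_sum]
    · simp [h]

theorem bd_apply (L : SComplex) (t : Finset ℕ → ZMod 2) (e : Finset ℕ) :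
    L.bd t e = if e.card = 2 then
    ∑ T ∈ L.faces.filter (fun T => T.card = 3 ∧ e ⊆ T), t T else 0 := rfl

theorem card2_sub_iff {a b c : ℕ} (hab : a ≠ b) (hac : a ≠ c) (hbc : b ≠ c) (e : Finset ℕ) :
    (e.card = 2 ∧ e ⊆ {a, b, c}) ↔ e = {a, b} ∨ e = {b, c} ∨ e = {a, c} := by
  constructor
  · rintro ⟨h2, hs⟩
    obtain ⟨x, y, hxy, rfl⟩ := Finset.card_eq_two.mp h2
    have hx : x ∈ ({a, b, c} : Finset ℕ) := hs (by simp)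
    have hy : y ∈ ({a, b, c} : Finset ℕ) := hs (by simp)
    simp only [Finset.mem_insert, Finset.mem_singleton] at hx hy
    rcases hx with rfl | rfl | rfl <;> rcases hy with rfl | rfl | rfl <;>
      simp_all [Finset.pair_comm]
  · rintro (rfl | rfl | rfl)
    · exact ⟨Finset.card_pair hab, by intro x; simp; tauto⟩
    · exact ⟨Finset.card_pair hbc, by intro x; simp; tauto⟩
    · exact ⟨Finset.card_pair hac, by intro x; simp; tauto⟩

/-- indicator of the edges inside a set -/
noncomputable def ind (γ : Finset ℕ) : Finset ℕ → ZMod 2 :=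
  fun e => if e.card = 2 ∧ e ⊆ γ then 1 else 0

theorem ind_eq {a b c : ℕ} (hab : a ≠ b) (hac : a ≠ c) (hbc : b ≠ c) :
    ind {a, b, c} = Pi.single {a, b} 1 + Pi.single {b, c} 1 + Pi.single {a, c} 1 := by
  funext e
  simp only [ind, card2_sub_iff hab hac hbc, Pi.add_apply]
  have h1 : ({a, b} : Finset ℕ) ≠ {b, c} := by
    intro h; have : a ∈ ({b, c} : Finset ℕ) := by rw [← h]; simp
    simp [hab, hac] at this
  have h2 : ({a, b} : Finset ℕ) ≠ {a, c} := by
    intro h; have : b ∈ ({a, c} : Finset ℕ) := by rw [← h]; simp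
    simp [hab.symm, hbc] at this
  have h3 : ({b, c} : Finset ℕ) ≠ {a, c} := by
    intro h; have : b ∈ ({a, c} : Finset ℕ) := by rw [← h]; simp
    simp [hab.symm, hbc] at this
  by_cases e1 : e = {a, b}
  · subst e1; simp [h1, h2]
  by_cases e2 : e = {b, c}
  · subst e2; simp [h1.symm, h3]
  by_cases e3 : e = {a, c}
  · subst e3; simp [h2.symm, h3.symm]
  simp [e1, e2, e3]

theorem bd_single {L : SComplex} {T : Finset ℕ} (hT : T ∈ L.faces) (h3 : T.card = 3) :
    L.bd (Pi.single T 1) = ind T := by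
  classical
  funext e
  rw [bd_apply]
  simp only [ind]
  by_cases h2 : e.card = 2
  · simp only [h2, if_true, true_and]
    rw [Finset.sum_pi_single']
    simp [hT, h3]
  · simp [h2]

theorem exists_chain {L : SComplex} (e : L.realSpace ≃ₜ S2) {a b c : ℕ}
    (hab : a ≠ b) (hac : a ≠ c) (hbc : b ≠ c) (h1 : {a, b} ∈ L.faces) (h2 : {b, c} ∈ L.faces)
    (h3 : {a, c} ∈ L.faces) : ∃ t, L.bd t = ind {a, b, c} := by
  classical
  by_contra hc
  have hn : ind {a, b, c} ∉ LinearMap.range L.bd := by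
    rintro ⟨t, ht⟩; exact hc ⟨t, ht⟩
  obtain ⟨φ, hφ, hk⟩ := Submodule.exists_le_ker_of_notMem hn
  have hz : ∀ t, φ (L.bd t) = 0 := fun t => hk ⟨t, rfl⟩
  let g : ℕ → ℕ → ZMod 2 := fun x y => if x = y then 0 else φ (Pi.single {x, y} 1)
  have gs : ∀ x y, g x y = g y x := by
    intro x y
    by_cases h : x = y
    · subst h; rfl
    · simp only [g, h, Ne.symm h, if_false, Finset.pair_comm]
  have gr : ∀ x, g x x = 0 := by intro x; simp [g]
  have two : ∀ k : ZMod 2, k + k = 0 := by decide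
  have hsum : ∀ x y z, x ≠ y → x ≠ z → y ≠ z → φ (ind {x, y, z}) = g x y + g y z + g x z := by
    intro x y z hxy hxz hyz
    rw [ind_eq hxy hxz hyz, map_add, map_add]
    simp [g, hxy, hxz, hyz]
  have hg : ∀ x y z, ({x, y, z} : Finset ℕ) ∈ L.faces → g x y + g y z = g x z := by
    intro x y z hF
    by_cases hxy : x = y
    · subst hxy; rw [gr, zero_add]
    by_cases hyz : y = z
    · subst hyz; rw [gr, add_zero]
    by_cases hxz : x = z
    · subst hxz; rw [gs y x, gr, two]
    have h4 := hz (Pi.single {x, y, z} 1)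
    rw [bd_single hF (card3 hxy hxz hyz), hsum x y z hxy hxz hyz] at h4
    have : ∀ p q : ZMod 2, p + q = 0 → p = q := by decide
    exact this _ _ h4
  obtain ⟨h, hh⟩ := coboundary e g hg
  apply hφ
  rw [hsum a b c hab hac hbc, hh _ _ h1, hh _ _ h2, hh _ _ h3]
  generalize h a = A
  generalize h b = B
  generalize h c = C
  revert A B C; decide

theorem Good.tri {K : SComplex} (hK : Good K) {w a b c : ℕ} (hs : K.HasSphereLink 3 w)
    (h1 : K.T w a b) (h2 : K.T w b c) (h3 : K.T w a c) : K.T a b c := by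
  classical
  by_contra hn
  obtain ⟨e⟩ := hs
  have hab : a ≠ b := h1.2.2.1
  have hbc : b ≠ c := h2.2.2.1
  have hac : a ≠ c := h3.2.2.1
  have lkE : ∀ {x y}, K.T w x y → ({x, y} : Finset ℕ) ∈ (K.lk {w}).faces := by
    intro x y h
    rw [mem_lk']
    refine ⟨by simp, ?_, ?_⟩
    · have := h.1; have := h.2.1
      ext z; simp; rintro (rfl | rfl) <;> simp_all [Ne.symm]
    · have := h.mem
      convert this using 1
      ext z; simp; tauto
  obtain ⟨t, ht⟩ := exists_chain e hab hac hbc (lkE h1) (lkE h2) (lkE h3)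
  have hcut : CutData K w {a, b, c} (fun T => t T = 1) := by
    refine ⟨hK.nrm, card3 hab hac hbc, ?_, ?_, ?_, ?_⟩
    · simp [h1.1, h1.2.1, h2.2.1]
    · intro f hf hf2
      rcases (card2_sub_iff hab hac hbc f).mp ⟨hf2, hf⟩ with rfl | rfl | rfl
      · exact h1.mem
      · exact h2.mem
      · exact h3.mem
    · intro h; exact hn ⟨hab, hac, hbc, h⟩
    · intro T1 T2 c1 w1 f1 c2 w2 f2 hI
      have hb := congrFun ht (T1 ∩ T2)
      rw [bd_apply, if_pos hI] at hb
      have hne : T1 ≠ T2 := by rintro rfl; simp at hI; omega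
      have hset : (K.lk {w}).faces.filter (fun T => T.card = 3 ∧ T1 ∩ T2 ⊆ T) = {T1, T2} := by
        have hwI : w ∉ T1 ∩ T2 := by simp [w1]
        have hI3 : (insert w (T1 ∩ T2)).card = 3 := by
          rw [Finset.card_insert_of_notMem hwI, hI]
        have hIf : insert w (T1 ∩ T2) ∈ K.faces :=
          down f1 (Finset.insert_subset_insert _ Finset.inter_subset_left) (by simp)
        obtain ⟨x, y, hxy, hx, hy, -, -, hall⟩ := hK.nrm.two _ hIf hI3
        have key : ∀ T : Finset ℕ, T.card = 3 → w ∉ T → insert w T ∈ K.faces → T1 ∩ T2 ⊆ T →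
            ∃ z, (z = x ∨ z = y) ∧ T = insert z (T1 ∩ T2) := by
          intro T hT hw hTf hsub
          obtain ⟨z, hz, hz'⟩ := exists_mem_notMem_of_card (s := T1 ∩ T2) (F := T) (by omega)
          have hTe : insert z (T1 ∩ T2) = T := by
            apply Finset.eq_of_subset_of_card_le
            · intro q hq
              rcases Finset.mem_insert.mp hq with rfl | hq
              · exact hz
              · exact hsub hq
            · rw [Finset.card_insert_of_notMem hz']; omega
          refine ⟨z, hall z ?_ ?_, hTe.symm⟩
          · rw [Finset.mem_insert]; rintro (rfl | h)
            · exact hw hz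
            · exact hz' h
          · rw [Finset.insert_comm, hTe]; exact hTf
        obtain ⟨z1, hz1, e1⟩ := key T1 c1 w1 f1 Finset.inter_subset_left
        obtain ⟨z2, hz2, e2⟩ := key T2 c2 w2 f2 Finset.inter_subset_right
        have mlk : ∀ T : Finset ℕ, T.card = 3 → w ∉ T → insert w T ∈ K.faces →
            T ∈ (K.lk {w}).faces := by
          intro T hT hw hTf
          rw [mem_lk']
          refine ⟨Finset.card_pos.mp (by omega), by simp [hw], ?_⟩
          rw [Finset.union_comm]; exact hTf
        have hz12 : z1 ≠ z2 := by
          rintro rfl; exact hne (e1.trans e2.symm)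
        ext T
        simp only [Finset.mem_filter, Finset.mem_insert, Finset.mem_singleton]
        constructor
        · rintro ⟨hT, hT3, hsub⟩
          rw [mem_lk'] at hT
          have hw : w ∉ T := by
            intro h
            have : w ∈ T ∩ {w} := by simp [h]
            rw [hT.2.1] at this; simp at this
          have hTf : insert w T ∈ K.faces := by
            have := hT.2.2; rw [Finset.union_comm] at this; exact this
          obtain ⟨z, hz, ez⟩ := key T hT3 hw hTf hsub
          have hzz : z = z1 ∨ z = z2 := by omega
          rcases hzz with rfl | rfl
          · left; rw [ez, ← e1]
          · right; rw [ez, ← e2]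
        · rintro (rfl | rfl)
          · exact ⟨mlk _ c1 w1 f1, c1, Finset.inter_subset_left⟩
          · exact ⟨mlk _ c2 w2 f2, c2, Finset.inter_subset_right⟩
      rw [hset, Finset.sum_pair hne] at hb
      simp only [ind, hI, true_and] at hb
      by_cases hs : T1 ∩ T2 ⊆ {a, b, c}
      · simp only [hs, if_true, not_true, iff_false] at hb ⊢
        have : ∀ p q : ZMod 2, p + q = 1 → ¬ (p = 1 ↔ q = 1) := by decide
        exact this _ _ hb
      · simp only [hs, if_false, not_false_iff, iff_true] at hb ⊢
        have : ∀ p q : ZMod 2, p + q = 0 → (p = 1 ↔ q = 1) := by decide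
        exact this _ _ hb
  exact cut_false hK.inR hcut

end Duality
end ModV

section ModH
section Sus
variable {K : SComplex}

/-- neighbours -/
noncomputable def N1 (K : SComplex) (v : ℕ) : Finset ℕ := (K.lk {v}).vertexSet
noncomputable def N2 (K : SComplex) (u v : ℕ) : Finset ℕ := (K.lk {u, v}).vertexSet

theorem mN1 {v x : ℕ} : x ∈ K.N1 v ↔ K.E v x := mem_lk1
theorem mN2 {u v x : ℕ} (h : u ≠ v) : x ∈ K.N2 u v ↔ K.T u v x := mem_lk2 h

theorem T.e13 {a b c : ℕ} (h : K.T a b c) : K.E a c := h.s23.e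
theorem T.e23 {a b c : ℕ} (h : K.T a b c) : K.E b c := h.s12.s23.e
theorem T.s13 {a b c : ℕ} (h : K.T a b c) : K.T c b a := h.s12.s23.s12
theorem T.rot {a b c : ℕ} (h : K.T a b c) : K.T b c a := h.s12.s23

theorem N2_comm {u v : ℕ} : K.N2 u v = K.N2 v u := by
  unfold N2; rw [Finset.pair_comm]

theorem N2_sub {v x : ℕ} (h : v ≠ x) : K.N2 v x ⊆ (K.N1 v).erase x := by
  intro y hy
  rw [mN2 h] at hy
  exact Finset.mem_erase.mpr ⟨hy.2.2.1.symm, mN1.mpr hy.e13⟩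

theorem Good.N2_ge (hK : Good K) {v x : ℕ} (h : K.E v x) : 4 ≤ (K.N2 v x).card := by
  have := hK.deg_ge4 h
  rw [deg_two] at this; exact this

theorem Good.N2_le (hK : Good K) {v x : ℕ} (h : K.E v x) : (K.N2 v x).card + 2 ≤ (K.N1 v).card := by
  obtain ⟨z, hz1, hz2, hz3⟩ := hK.miss h
  have h1 : K.N2 v x ⊆ ((K.N1 v).erase x).erase z := by
    intro y hy
    refine Finset.mem_erase.mpr ⟨?_, N2_sub h.1 hy⟩
    rintro rfl
    exact hz3 ((mN2 h.1).mp hy)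
  have h2 := Finset.card_le_card h1
  have h3 : z ∈ (K.N1 v).erase x := Finset.mem_erase.mpr ⟨hz2.1.symm, mN1.mpr hz1⟩
  have h4 : x ∈ K.N1 v := mN1.mpr h
  rw [Finset.card_erase_of_mem h3, Finset.card_erase_of_mem h4] at h2
  have h5 : 0 < ((K.N1 v).erase x).card := Finset.card_pos.mpr ⟨z, h3⟩
  rw [Finset.card_erase_of_mem h4] at h5
  omega

/-- triangles and tetrahedra at `v` -/
theorem sum_even (hK : K.Nrm) (v : ℕ) : 6 ∣ ∑ x ∈ K.N1 v, (K.N2 v x).card := by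
  classical
  set E3 := K.faces.filter (fun s => s.card = 3 ∧ v ∈ s) with hE3
  set E4 := K.faces.filter (fun s => s.card = 4 ∧ v ∈ s) with hE4
  have h1 : ∑ x ∈ K.N1 v, (E3.filter (fun e => x ∈ e)).card = 2 * E3.card := by
    have := Finset.sum_card_bipartiteAbove_eq_sum_card_bipartiteBelow (s := K.N1 v) (t := E3)
      (fun x e => x ∈ e)
    simp only [Finset.bipartiteAbove, Finset.bipartiteBelow] at this
    rw [this, Finset.sum_const_nat (m := 2), mul_comm]
    intro e he
    rw [hE3, Finset.mem_filter] at he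
    have : (K.N1 v).filter (fun x => x ∈ e) = e.erase v := by
      ext x
      simp only [Finset.mem_filter, Finset.mem_erase, mN1]
      constructor
      · rintro ⟨h, hx⟩; exact ⟨h.1.symm, hx⟩
      · rintro ⟨h, hx⟩
        refine ⟨⟨h.symm, down he.1 ?_ (by simp)⟩, hx⟩
        intro y hy
        rcases Finset.mem_insert.mp hy with rfl | hy
        · exact he.2.2
        · rw [Finset.mem_singleton.mp hy]; exact hx
    rw [this, Finset.card_erase_of_mem he.2.2]; omega
  have h2 : ∀ x ∈ K.N1 v, (K.N2 v x).card = (E3.filter (fun e => x ∈ e)).card := by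
    intro x hx
    rw [mN1] at hx
    apply Finset.card_bij (fun y _ => ({v, x, y} : Finset ℕ))
    · intro y hy
      rw [mN2 hx.1] at hy
      simp only [hE3, Finset.mem_filter]
      exact ⟨⟨hy.mem, card3 hy.1 hy.2.1 hy.2.2.1, by simp⟩, by simp⟩
    · intro y hy z hz h
      rw [mN2 hx.1] at hy hz
      have : y ∈ ({v, x, z} : Finset ℕ) := by rw [← h]; simp
      simp only [Finset.mem_insert, Finset.mem_singleton] at this
      rcases this with h | h | h
      · exact absurd h.symm hy.2.1
      · exact absurd h.symm hy.2.2.1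
      · exact h
    · intro e he
      simp only [hE3, Finset.mem_filter] at he
      obtain ⟨⟨he, h3, hv⟩, hxe⟩ := he
      have hsub : ({v, x} : Finset ℕ) ⊆ e := by
        intro y hy
        rcases Finset.mem_insert.mp hy with rfl | hy
        · exact hv
        · rw [Finset.mem_singleton.mp hy]; exact hxe
      obtain ⟨y, hy, hy'⟩ := exists_mem_notMem_of_card (s := {v, x}) (F := e)
        (by rw [Finset.card_pair hx.1]; omega)
      simp only [Finset.mem_insert, Finset.mem_singleton, not_or] at hy'
      have heq : ({v, x, y} : Finset ℕ) = e := by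
        apply Finset.eq_of_subset_of_card_le
        · intro z hz
          simp only [Finset.mem_insert, Finset.mem_singleton] at hz
          rcases hz with rfl | rfl | rfl
          · exact hv
          · exact hxe
          · exact hy
        · rw [card3 hx.1 (Ne.symm hy'.1) (Ne.symm hy'.2)]; omega
      exact ⟨y, (mN2 hx.1).mpr ⟨hx.1, Ne.symm hy'.1, Ne.symm hy'.2, by rw [heq]; exact he⟩, heq⟩
  have h3 : 2 * E3.card = 3 * E4.card := by
    have := Finset.sum_card_bipartiteAbove_eq_sum_card_bipartiteBelow (s := E3) (t := E4)
      (fun e F => e ⊆ F)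
    simp only [Finset.bipartiteAbove, Finset.bipartiteBelow] at this
    rw [Finset.sum_const_nat (m := 2), Finset.sum_const_nat (m := 3)] at this
    · omega
    · intro F hF
      simp only [hE4, Finset.mem_filter] at hF
      have : E3.filter (fun e => e ⊆ F) = (F.erase v).image (fun x => F.erase x) := by
        ext e
        simp only [hE3, Finset.mem_filter, Finset.mem_image, Finset.mem_erase]
        constructor
        · rintro ⟨⟨he, h3, hv⟩, hs⟩
          obtain ⟨y, hy, hy'⟩ := exists_mem_notMem_of_card (s := e) (F := F) (by omega)
          refine ⟨y, ⟨by rintro rfl; exact hy' hv, hy⟩, ?_⟩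
          symm
          apply Finset.eq_of_subset_of_card_le
          · intro z hz
            exact Finset.mem_erase.mpr ⟨by rintro rfl; exact hy' hz, hs hz⟩
          · rw [Finset.card_erase_of_mem hy]; omega
        · rintro ⟨x, ⟨hxv, hx⟩, rfl⟩
          have hv : v ∈ F.erase x := Finset.mem_erase.mpr ⟨Ne.symm hxv, hF.2.2⟩
          refine ⟨⟨down hF.1 (Finset.erase_subset _ _) ⟨v, hv⟩, ?_, hv⟩, Finset.erase_subset _ _⟩
          rw [Finset.card_erase_of_mem hx]; omega
      rw [this, Finset.card_image_of_injOn, Finset.card_erase_of_mem hF.2.2]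
      · omega
      · intro x hx y hy hxy
        by_contra hne
        have hx' := (Finset.mem_erase.mp hx).2
        have : x ∈ F.erase y := Finset.mem_erase.mpr ⟨hne, hx'⟩
        dsimp only at hxy
        rw [← hxy] at this
        simp at this
    · intro e he
      simp only [hE3, Finset.mem_filter] at he
      obtain ⟨x, y, hxy, hx, hy, hxK, hyK, hall⟩ := hK.two e he.1 he.2.1
      have : E4.filter (fun F => e ⊆ F) = {insert x e, insert y e} := by
        ext F
        simp only [hE4, Finset.mem_filter, Finset.mem_insert, Finset.mem_singleton]
        constructor
        · rintro ⟨⟨hF, h4, hv⟩, hs⟩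
          obtain ⟨z, hz, hz'⟩ := exists_mem_notMem_of_card (s := e) (F := F) (by omega)
          have heq : insert z e = F := by
            apply Finset.eq_of_subset_of_card_le
            · intro q hq
              rcases Finset.mem_insert.mp hq with rfl | hq
              · exact hz
              · exact hs hq
            · rw [Finset.card_insert_of_notMem hz']; omega
          rcases hall z hz' (by rw [heq]; exact hF) with rfl | rfl
          · exact Or.inl heq.symm
          · exact Or.inr heq.symm
        · rintro (rfl | rfl)
          · exact ⟨⟨hxK, by rw [Finset.card_insert_of_notMem hx]; omega,
              Finset.mem_insert_of_mem he.2.2⟩, Finset.subset_insert _ _⟩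
          · exact ⟨⟨hyK, by rw [Finset.card_insert_of_notMem hy]; omega,
              Finset.mem_insert_of_mem he.2.2⟩, Finset.subset_insert _ _⟩
      rw [this, Finset.card_pair]
      intro h; exact hxy (insert_inj_right hx h)
  rw [Finset.sum_congr rfl h2, h1]
  omega

/-- The link of `v` is the suspension with apexes `u`, `s` of the cycle `C`. -/
structure Sus (K : SComplex) (u v s : ℕ) (C : Finset ℕ) : Prop where
  uv : K.E u v
  sv : K.E s v
  us : K.E u s
  nt : ¬ K.T u v s
  Cu : ∀ x, K.T u v x ↔ x ∈ C
  Cs : ∀ x, K.T s v x ↔ x ∈ C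
  nb : ∀ x, K.E v x → x = u ∨ x = s ∨ x ∈ C
  qu : ∀ x y, x ∈ C → y ∈ C → K.T v x y → K.Q u v x y
  qs : ∀ x y, x ∈ C → y ∈ C → K.T v x y → K.Q s v x y
  ch : ∀ x ∈ C, ∃ y ∈ C, K.E x y ∧ ¬ K.T v x y

theorem Good.sus_aux (hK : Good K) {u v s : ℕ} {C : Finset ℕ} (uv : K.E u v) (sv : K.E s v)
    (hus : u ≠ s)
    (hCu : ∀ x, K.T u v x ↔ x ∈ C) (hCs : ∀ x, K.T s v x ↔ x ∈ C)
    (nb : ∀ x, K.E v x → x = u ∨ x = s ∨ x ∈ C)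
    (h4 : ∀ x ∈ C, (K.N2 v x).card = 4) : K.Sus u v s C := by
  classical
  have key : ∀ u s, u ≠ s → K.E u v → (∀ x, K.T u v x ↔ x ∈ C) → (∀ x, K.T s v x ↔ x ∈ C) →
      ¬ K.T u v s → ∀ x y, x ∈ C → y ∈ C → K.T v x y → K.Q u v x y := by
    intro u s hus uv hCu hCs nt x y hx hy hxy
    obtain ⟨p, q, hpq, hp, hq, -⟩ := hK.nrm.twoT ((hCu x).mpr hx)
    have hpT : K.T u v p := hp.s34.t
    have hqT : K.T u v q := hq.s34.t
    have hpT' : K.T v x p := hp.s12.s23.s34.t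
    have hqT' : K.T v x q := hq.s12.s23.s34.t
    have hxu := (hCu x).mpr hx
    have hxs := (hCs x).mpr hx
    have hsub : ({u, s, p, q} : Finset ℕ) ⊆ K.N2 v x := by
      intro z hz
      rw [mN2 hxu.2.2.1]
      simp only [Finset.mem_insert, Finset.mem_singleton] at hz
      rcases hz with rfl | rfl | rfl | rfl
      · exact hxu.rot
      · exact hxs.rot
      · exact hpT'
      · exact hqT'
    have hps : p ≠ s := by rintro rfl; exact nt hpT
    have hqs : q ≠ s := by rintro rfl; exact nt hqT
    have hpu : p ≠ u := hpT.2.1.symm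
    have hqu : q ≠ u := hqT.2.1.symm
    have hc : ({u, s, p, q} : Finset ℕ).card = 4 := by
      rw [Finset.card_insert_of_notMem, card3 hps.symm hqs.symm hpq]
      simp [hus, hpu.symm, hqu.symm]
    have heq := Finset.eq_of_subset_of_card_le hsub (by rw [h4 x hx, hc])
    have hy' : y ∈ ({u, s, p, q} : Finset ℕ) := by
      rw [heq, mN2 hxu.2.2.1]; exact hxy
    have hyu := (hCu y).mpr hy
    simp only [Finset.mem_insert, Finset.mem_singleton] at hy'
    rcases hy' with rfl | rfl | rfl | rfl
    · exact absurd rfl hyu.2.1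
    · exact absurd hyu nt
    · exact hp
    · exact hq
  have nt : ¬ K.T u v s := by
    intro h; exact (hCs s).mpr ((hCu s).mp h) |>.2.1 rfl
  have nt' : ¬ K.T s v u := by
    intro h; exact nt h.s13
  have us : K.E u s := by
    obtain ⟨z, hz1, hz2, hz3⟩ := hK.miss uv
    rcases nb z hz2 with rfl | rfl | h
    · exact absurd rfl hz1.1
    · exact hz1
    · exact absurd ((hCu z).mpr h) hz3
  refine ⟨uv, sv, us, nt, hCu, hCs, nb, key u s hus uv hCu hCs nt, key s u hus.symm sv hCs hCu nt', ?_⟩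
  intro x hx
  obtain ⟨z, hz1, hz2, hz3⟩ := hK.miss ((hCu x).mpr hx).e23
  rcases nb z hz1 with rfl | rfl | h
  · exact absurd ((hCu x).mpr hx).rot hz3
  · exact absurd ((hCs x).mpr hx).rot hz3
  · exact ⟨z, h, hz2, hz3⟩

theorem Good.susA (hK : Good K) {u v : ℕ} (huv : K.E u v) (h6 : (K.N1 v).card = 6) :
    ∃ s, K.Sus u v s (K.N2 u v) ∧ (K.N2 u v).card = 4 := by
  classical
  have h4 : ∀ x, K.E v x → (K.N2 v x).card = 4 := by
    intro x hx
    have := hK.N2_ge hx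
    have := hK.N2_le hx
    omega
  -- nonneighbour
  have hn : ∀ x, K.E v x → ∃ z, K.E v z ∧ z ≠ x ∧ ¬ K.T v x z ∧
      ∀ y, K.E v y → y = x ∨ y = z ∨ K.T v x y := by
    intro x hx
    have hc : (((K.N1 v).erase x) \ K.N2 v x).card = 1 := by
      rw [Finset.card_sdiff_of_subset (N2_sub hx.1), Finset.card_erase_of_mem (mN1.mpr hx),
        h4 x hx, h6]
    obtain ⟨z, hz⟩ := Finset.card_eq_one.mp hc
    have hzm : z ∈ (((K.N1 v).erase x) \ K.N2 v x) := by rw [hz]; simp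
    simp only [Finset.mem_sdiff, Finset.mem_erase, mN1, mN2 hx.1] at hzm
    refine ⟨z, hzm.1.2, hzm.1.1, hzm.2, ?_⟩
    intro y hy
    by_cases hyx : y = x
    · exact Or.inl hyx
    by_cases hT : K.T v x y
    · exact Or.inr (Or.inr hT)
    right; left
    have : y ∈ (((K.N1 v).erase x) \ K.N2 v x) := by
      simp only [Finset.mem_sdiff, Finset.mem_erase, mN1, mN2 hx.1]
      exact ⟨⟨hyx, hy⟩, hT⟩
    rw [hz] at this; simpa using this
  obtain ⟨s, hs1, hs2, hs3, hs4⟩ := hn u huv.symm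
  obtain ⟨z, hz1, hz2, hz3, hz4⟩ := hn s hs1
  have hzu : u = z := by
    rcases hz4 u huv.symm with h | h | h
    · exact absurd h.symm hs2
    · exact h
    · exact absurd h.s23 hs3
  subst hzu
  refine ⟨s, hK.sus_aux huv hs1.symm hs2.symm (fun x => (mN2 huv.1).symm) ?_ ?_ ?_, ?_⟩
  · intro x
    rw [mN2 huv.1]
    constructor
    · intro h
      rcases hs4 x h.e23 with rfl | rfl | h'
      · exact absurd h.rot hs3
      · exact absurd rfl h.2.1
      · exact h'.s12
    · intro h
      rcases hz4 x h.e23 with rfl | rfl | h'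
      · exact absurd h.s12 hs3
      · exact absurd rfl h.2.1
      · exact h'.s12
  · intro x hx
    rw [mN2 huv.1]
    rcases hs4 x hx with h | h | h
    · exact Or.inl h
    · exact Or.inr (Or.inl h)
    · exact Or.inr (Or.inr h.s12)
  · intro x hx
    rw [mN2 huv.1] at hx
    exact h4 x hx.e23
  · rw [N2_comm]; exact h4 u huv.symm

theorem Good.sum7 (hK : Good K) {v : ℕ} (h7 : (K.N1 v).card = 7) :
    (∀ x ∈ K.N1 v, (K.N2 v x).card = 4 ∨ (K.N2 v x).card = 5) ∧
    ((K.N1 v).filter fun x => (K.N2 v x).card = 5).card = 2 := by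
  have h45 : ∀ x ∈ K.N1 v, (K.N2 v x).card = 4 ∨ (K.N2 v x).card = 5 := by
    intro x hx
    rw [mN1] at hx
    have := hK.N2_ge hx
    have := hK.N2_le hx
    omega
  refine ⟨h45, ?_⟩
  have h6 := sum_even hK.nrm v
  have hs : ∑ x ∈ K.N1 v, (K.N2 v x).card =
      ∑ x ∈ K.N1 v, (4 + if (K.N2 v x).card = 5 then 1 else 0) := by
    apply Finset.sum_congr rfl
    intro x hx
    rcases h45 x hx with h | h <;> simp [h]
  rw [hs, Finset.sum_add_distrib, Finset.sum_const, h7, ← Finset.card_filter] at h6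
  have hle : ((K.N1 v).filter fun x => (K.N2 v x).card = 5).card ≤ 7 := by
    rw [← h7]; exact Finset.card_filter_le _ _
  simp only [smul_eq_mul] at h6
  omega

theorem Good.susB (hK : Good K) {u v : ℕ} (huv : K.E u v) (h7 : (K.N1 v).card = 7)
    (h5 : (K.N2 v u).card = 5) :
    ∃ s, K.Sus u v s (K.N2 u v) ∧ (K.N2 u v).card = 5 := by
  classical
  obtain ⟨h45, hc2⟩ := hK.sum7 h7
  have three : ∀ x y z, K.E v x → K.E v y → K.E v z → x ≠ y → x ≠ z → y ≠ z →
      (K.N2 v x).card = 5 → (K.N2 v y).card = 5 → (K.N2 v z).card = 5 → False := by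
    intro x y z hx hy hz hxy hxz hyz h1 h2 h3
    have : ({x, y, z} : Finset ℕ) ⊆ (K.N1 v).filter fun x => (K.N2 v x).card = 5 := by
      intro w hw
      simp only [Finset.mem_insert, Finset.mem_singleton] at hw
      rw [Finset.mem_filter, mN1]
      rcases hw with rfl | rfl | rfl
      · exact ⟨hx, h1⟩
      · exact ⟨hy, h2⟩
      · exact ⟨hz, h3⟩
    have := Finset.card_le_card this
    rw [card3 hxy hxz hyz, hc2] at this
    omega
  have hc : (((K.N1 v).erase u) \ K.N2 v u).card = 1 := by
    rw [Finset.card_sdiff_of_subset (N2_sub huv.symm.1),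
      Finset.card_erase_of_mem (mN1.mpr huv.symm), h5, h7]
  obtain ⟨s, hs⟩ := Finset.card_eq_one.mp hc
  have hsm : s ∈ (((K.N1 v).erase u) \ K.N2 v u) := by rw [hs]; simp
  simp only [Finset.mem_sdiff, Finset.mem_erase, mN1, mN2 huv.symm.1] at hsm
  obtain ⟨⟨hsu, hvs⟩, hnT⟩ := hsm
  have nb : ∀ x, K.E v x → x = u ∨ x = s ∨ x ∈ K.N2 u v := by
    intro y hy
    by_cases hyx : y = u
    · exact Or.inl hyx
    by_cases hT : K.T u v y
    · exact Or.inr (Or.inr ((mN2 huv.1).mpr hT))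
    right; left
    have : y ∈ (((K.N1 v).erase u) \ K.N2 v u) := by
      simp only [Finset.mem_sdiff, Finset.mem_erase, mN1, mN2 huv.symm.1]
      exact ⟨⟨hyx, hy⟩, fun h => hT h.s12⟩
    rw [hs] at this; simpa using this
  have hsC : ∀ x, K.T s v x → K.T u v x := by
    intro x h
    rcases nb x h.e23 with rfl | rfl | h'
    · exact absurd h.rot hnT
    · exact absurd rfl h.2.1
    · exact (mN2 huv.1).mp h'
  have hCs : ∀ x, K.T u v x → K.T s v x := by
    intro c0 hc0
    by_contra hno
    -- s has degree 4 and misses exactly u, c0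
    have hsub : K.N2 v s ⊆ (K.N2 u v).erase c0 := by
      intro x hx
      rw [mN2 hvs.1] at hx
      rw [Finset.mem_erase, mN2 huv.1]
      exact ⟨by rintro rfl; exact hno hx.s12, hsC x hx.s12⟩
    have hc0m : c0 ∈ K.N2 u v := (mN2 huv.1).mpr hc0
    have hcard : ((K.N2 u v).erase c0).card = 4 := by
      rw [Finset.card_erase_of_mem hc0m, N2_comm, h5]
    have heq := Finset.eq_of_subset_of_card_le hsub (by rw [hcard]; exact hK.N2_ge hvs)
    have hall : ∀ x, K.T u v x → x ≠ c0 → K.T s v x := by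
      intro x hx hne
      have : x ∈ K.N2 v s := by
        rw [heq, Finset.mem_erase, mN2 huv.1]; exact ⟨hne, hx⟩
      rw [mN2 hvs.1] at this; exact this.s12
    obtain ⟨p, q, hpq, hp, hq, -⟩ := hK.nrm.twoT hc0
    have five : ∀ p, K.Q u v c0 p → (K.N2 v p).card = 5 := by
      intro p hp
      have hpT : K.T u v p := hp.s34.t
      have hpc : p ≠ c0 := by rintro rfl; exact (hp.s12.s23.s34.t).2.2.1 rfl
      have hps := hall p hpT hpc
      obtain ⟨x, y, hxy, hx, hy, -⟩ := hK.nrm.twoT hps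
      have hxT : K.T s v x := hx.s34.t
      have hyT : K.T s v y := hy.s34.t
      have hsub : ({u, s, c0, x, y} : Finset ℕ) ⊆ K.N2 v p := by
        intro z hz
        rw [mN2 hpT.2.2.1]
        simp only [Finset.mem_insert, Finset.mem_singleton] at hz
        rcases hz with rfl | rfl | rfl | rfl | rfl
        · exact hpT.rot
        · exact hps.rot
        · exact hp.s12.s23.s34.t.s23
        · exact hx.s12.s23.s34.t
        · exact hy.s12.s23.s34.t
      have hxc : x ≠ c0 := by rintro rfl; exact hno hxT
      have hyc : y ≠ c0 := by rintro rfl; exact hno hyT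
      have hxu : x ≠ u := (hsC x hxT).2.1.symm
      have hyu : y ≠ u := (hsC y hyT).2.1.symm
      have hxs : x ≠ s := hxT.2.1.symm
      have hys : y ≠ s := hyT.2.1.symm
      have hcu : c0 ≠ u := hc0.2.1.symm
      have hcs : c0 ≠ s := by rintro rfl; exact hnT hc0.s12
      have hc5 : ({u, s, c0, x, y} : Finset ℕ).card = 5 := by
        rw [Finset.card_insert_of_notMem, Finset.card_insert_of_notMem,
          card3 hxc.symm hyc.symm hxy]
        · simp [hcs.symm, hxs.symm, hys.symm]
        · simp [hsu.symm, hcu.symm, hxu.symm, hyu.symm]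
      have := Finset.card_le_card hsub
      have h4 := h45 p (mN1.mpr hpT.e23)
      omega
    have hpT : K.T u v p := hp.s34.t
    have hqT : K.T u v q := hq.s34.t
    exact three u p q huv.symm hpT.e23 hqT.e23 hpT.2.1 hqT.2.1 hpq h5 (five p hp) (five q hq)
  have hiff : ∀ x, K.T s v x ↔ x ∈ K.N2 u v := by
    intro x; rw [mN2 huv.1]; exact ⟨hsC x, hCs x⟩
  have hs5 : (K.N2 v s).card = 5 := by
    rw [← h5, N2_comm (u := v) (v := u)]
    congr 1
    ext x
    rw [mN2 hvs.1, ← hiff]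
    exact ⟨fun h => h.s12, fun h => h.s12⟩
  refine ⟨s, hK.sus_aux huv hvs.symm (Ne.symm hsu) (fun x => (mN2 huv.1).symm) hiff nb ?_, ?_⟩
  · intro x hx
    rcases h45 x (mN1.mpr ((hiff x).mpr hx).e23) with h | h
    · exact h
    · exact (three u s x huv.symm hvs ((hiff x).mpr hx).e23 (Ne.symm hsu)
        ((mN2 huv.1).mp hx).2.1 ((hiff x).mpr hx).2.1 h5 hs5 h).elim
  · rw [N2_comm]; exact h5

end Sus
end ModH

section ModI
section Ind
variable {K : SComplex} {a b c d : ℕ}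

theorem Q.p1243 (h : K.Q a b c d) : K.Q a b d c := h.s34
theorem Q.p1324 (h : K.Q a b c d) : K.Q a c b d := h.s23
theorem Q.p2134 (h : K.Q a b c d) : K.Q b a c d := h.s12
theorem Q.p1342 (h : K.Q a b c d) : K.Q a c d b := h.s23.s34
theorem Q.p1423 (h : K.Q a b c d) : K.Q a d b c := h.s34.s23
theorem Q.p1432 (h : K.Q a b c d) : K.Q a d c b := h.s23.s34.s23
theorem Q.p2143 (h : K.Q a b c d) : K.Q b a d c := h.s12.s34
theorem Q.p2314 (h : K.Q a b c d) : K.Q b c a d := h.s12.s23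
theorem Q.p2341 (h : K.Q a b c d) : K.Q b c d a := h.s12.s23.s34
theorem Q.p2413 (h : K.Q a b c d) : K.Q b d a c := h.s12.s34.s23
theorem Q.p2431 (h : K.Q a b c d) : K.Q b d c a := h.s12.s23.s34.s23
theorem Q.p3124 (h : K.Q a b c d) : K.Q c a b d := h.s23.s12
theorem Q.p3142 (h : K.Q a b c d) : K.Q c a d b := h.s23.s12.s34
theorem Q.p3214 (h : K.Q a b c d) : K.Q c b a d := h.s12.s23.s12
theorem Q.p3241 (h : K.Q a b c d) : K.Q c b d a := h.s12.s23.s12.s34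
theorem Q.p3412 (h : K.Q a b c d) : K.Q c d a b := h.s23.s12.s34.s23
theorem Q.p3421 (h : K.Q a b c d) : K.Q c d b a := h.s12.s23.s12.s34.s23
theorem Q.p4123 (h : K.Q a b c d) : K.Q d a b c := h.s34.s23.s12
theorem Q.p4132 (h : K.Q a b c d) : K.Q d a c b := h.s23.s34.s23.s12
theorem Q.p4213 (h : K.Q a b c d) : K.Q d b a c := h.s12.s34.s23.s12
theorem Q.p4231 (h : K.Q a b c d) : K.Q d b c a := h.s12.s23.s34.s23.s12
theorem Q.p4312 (h : K.Q a b c d) : K.Q d c a b := h.s23.s12.s34.s23.s12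
theorem Q.p4321 (h : K.Q a b c d) : K.Q d c b a := h.s12.s23.s12.s34.s23.s12
theorem T.rot2 (h : K.T a b c) : K.T c a b := h.rot.rot

structure Ctx (K : SComplex) (u : ℕ) : Prop where
  good : Good K
  sph : ∀ s, K.E u s → K.HasSphereLink 3 u ∨ K.HasSphereLink 3 s

/-- The special neighbours of `u`. -/
def II (K : SComplex) (u v : ℕ) : Prop :=
  K.E u v ∧ ((K.N1 v).card = 6 ∨ ((K.N1 v).card = 7 ∧ (K.N2 v u).card = 5))

theorem Good.getSus (hK : Good K) {u v : ℕ} (h : K.II u v) :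
    ∃ s, K.Sus u v s (K.N2 u v) ∧ 4 ≤ (K.N2 u v).card ∧ (K.N2 u v).card ≤ 5 ∧
      ((K.N1 v).card = 6 → (K.N2 u v).card = 4) ∧ ((K.N1 v).card = 7 → (K.N2 u v).card = 5) := by
  rcases h with ⟨huv, h6 | ⟨h7, h5⟩⟩
  · obtain ⟨s, h1, h2⟩ := hK.susA huv h6
    exact ⟨s, h1, by omega, by omega, by omega, by omega⟩
  · obtain ⟨s, h1, h2⟩ := hK.susB huv h7 h5
    exact ⟨s, h1, by omega, by omega, by omega, by omega⟩

theorem Sus.q1 (hK : Good K) {u v s : ℕ} {C : Finset ℕ} (h : K.Sus u v s C) {x y : ℕ}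
    (hx : K.T u s x) (hy : K.T u s y) (hq : K.Q u v x y) : False := by
  have hxC : x ∈ C := (h.Cu x).mp hq.t
  have hyC : y ∈ C := (h.Cu y).mp hq.s34.t
  have hq2 : K.Q s v x y := h.qs x y hxC hyC hq.p2341.t
  have h3 : K.T u x y := hq.p1342.t
  have h4 : K.T s x y := hq2.p1342.t
  have h5 : K.Q u s x y := hK.fill hx hy h3 h4
  exact hK.noDeg3 hq.p3412 hq2.p3421 h5.p3421

theorem Nrm.only3 (h : K.Nrm) {a b c x y z : ℕ} (hx : K.Q a b c x) (hy : K.Q a b c y)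
    (hz : K.Q a b c z) (hxy : x ≠ y) (hxz : x ≠ z) (hyz : y ≠ z) : False := by
  rcases h.only2 hx hy hxy hz with h | h
  · exact hxz h.symm
  · exact hyz h.symm

theorem Ctx.indep {u : ℕ} (hc : Ctx K u) {v v' : ℕ} (h : K.II u v) (h' : K.II u v') :
    ¬ K.T u v v' := by
  intro ht
  have hK := hc.good
  obtain ⟨s, hs, -⟩ := hK.getSus h
  obtain ⟨s', hs', -⟩ := hK.getSus h'
  set C := K.N2 u v
  set C' := K.N2 u v'
  have hv' : v' ∈ C := (hs.Cu _).mp ht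
  have hv : v ∈ C' := (hs'.Cu _).mp ht.s23
  obtain ⟨p, -, -, hp, -⟩ := hK.nrm.twoT ht
  have hpC : p ∈ C := (hs.Cu _).mp hp.s34.t
  have hq : K.Q s v v' p := hs.qs _ _ hv' hpC hp.p2341.t
  have hss : s = s' := by
    rcases hs'.nb s hq.p3124.t.e with e | e | e
    · exact absurd e.symm hs.us.1
    · exact e
    · have h1 : K.Q u v' v s := hs'.qu v s hv e hq.p3214.t
      exact absurd h1.p1342.t hs.nt
  subst hss
  obtain ⟨y, hyC, hE, hnt⟩ := hs.ch v' hv'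
  have hy' : y ∈ C' := by
    have hTy := (hs.Cu y).mpr hyC
    have hTsy := (hs.Cs y).mpr hyC
    rcases hs'.nb y hE with e | e | e
    · exact absurd e.symm hTy.2.1
    · exact absurd e.symm hTsy.2.1
    · exact e
  have hTy := (hs.Cu y).mpr hyC
  have hTsy := (hs.Cs y).mpr hyC
  have hTy' := (hs'.Cu y).mpr hy'
  have hTsy' := (hs'.Cs y).mpr hy'
  rcases hc.sph s hs.us with e | e
  · exact hnt (hK.tri e ht hTy' hTy)
  · exact hnt (hK.tri e ((hs.Cs _).mpr hv') hTsy' hTsy)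

theorem Sus.q3 (hK : Good K) {u v s : ℕ} {C : Finset ℕ} (h : K.Sus u v s C) (hC : C.card ≤ 5)
    {x y z : ℕ} (hx : K.T u s x) (hy : K.T u s y) (hz : K.T u s z) (xC : x ∈ C) (yC : y ∈ C)
    (zC : z ∈ C) (hxy : x ≠ y) (hxz : x ≠ z) (hyz : y ≠ z) : False := by
  have hS : (C \ {x, y, z}).card ≤ 2 := by
    rw [Finset.card_sdiff_of_subset (by
      intro w; simp only [Finset.mem_insert, Finset.mem_singleton]
      rintro (rfl | rfl | rfl) <;> assumption),
      Finset.card_eq_three.mpr ⟨x, y, z, hxy, hxz, hyz, rfl⟩]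
    omega
  have key : ∀ w, w ∈ C → K.T u s w → ∀ r, K.Q u v w r → (r ≠ x ∧ r ≠ y ∧ r ≠ z) ∧ r ∈ C := by
    intro w _ hw r hr
    refine ⟨⟨?_, ?_, ?_⟩, (h.Cu r).mp hr.s34.t⟩
    · rintro rfl; exact h.q1 hK hw hx hr
    · rintro rfl; exact h.q1 hK hw hy hr
    · rintro rfl; exact h.q1 hK hw hz hr
  have full : ∀ w, w ∈ C → K.T u s w → ∀ r ∈ C \ {x, y, z}, K.Q u v w r := by
    intro w wC hw r hr
    obtain ⟨p, q, hpq, hp, hq, -⟩ := hK.nrm.twoT ((h.Cu w).mpr wC)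
    by_contra hn
    have h3 : ({p, q, r} : Finset ℕ) ⊆ C \ {x, y, z} := by
      intro w'; simp only [Finset.mem_insert, Finset.mem_singleton]
      rintro (rfl | rfl | rfl)
      · have := key w wC hw _ hp; simp [this]
      · have := key w wC hw _ hq; simp [this]
      · exact hr
    have := Finset.card_le_card h3
    rw [Finset.card_eq_three.mpr ⟨p, q, r, hpq, by rintro rfl; exact hn hp,
      by rintro rfl; exact hn hq, rfl⟩] at this
    omega
  obtain ⟨p, -, -, hp, -⟩ := hK.nrm.twoT ((h.Cu x).mpr xC)
  have hpS : p ∈ C \ {x, y, z} := by have := key x xC hx p hp; simp [this]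
  exact hK.nrm.only3 (full x xC hx p hpS).s34 (full y yC hy p hpS).s34 (full z zC hz p hpS).s34
    hxy hxz hyz

theorem Sus.dc (hK : Good K) {u v s : ℕ} {C : Finset ℕ} (h : K.Sus u v s C) (hC : C.card ≤ 5) :
    (K.N2 u s ∩ C).card ≤ 2 := by
  by_contra hn
  obtain ⟨x, y, z, hx, hy, hz, hxy, hxz, hyz⟩ :=
    Finset.two_lt_card_iff.mp (not_le.mp hn)
  simp only [Finset.mem_inter, mN2 h.us.1] at hx hy hz
  exact h.q3 hK hC hx.1 hy.1 hz.1 hx.2 hy.2 hz.2 hxy hxz hyz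

theorem Sus.s_big (hK : Good K) {u v s : ℕ} {C : Finset ℕ} (h : K.Sus u v s C) (hC : C.card ≤ 5)
    (hC4 : 4 ≤ C.card) : 8 ≤ (K.N1 s).card := by
  have h1 := hK.N2_ge h.us
  have h2 := h.dc hK hC
  have h3 : 2 ≤ (K.N2 u s \ C).card := by
    have := Finset.card_sdiff_add_card_inter (K.N2 u s) C
    omega
  have h4 : insert u (insert v (C ∪ (K.N2 u s \ C))) ⊆ K.N1 s := by
    intro x
    simp only [Finset.mem_insert, Finset.mem_union, Finset.mem_sdiff, mN1, mN2 h.us.1]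
    rintro (rfl | rfl | hx | hx)
    · exact h.us.symm
    · exact h.sv
    · exact ((h.Cs x).mpr hx).e13
    · exact hx.1.e23
  have h5 := Finset.card_le_card h4
  rw [Finset.card_insert_of_notMem, Finset.card_insert_of_notMem,
    Finset.card_union_of_disjoint Finset.disjoint_sdiff] at h5
  · omega
  · simp only [Finset.mem_union, Finset.mem_sdiff, mN2 h.us.1, not_or]
    refine ⟨fun hv => ((h.Cu v).mpr hv).2.2.1 rfl, fun hv => h.nt hv.1.s23⟩
  · simp only [Finset.mem_insert, Finset.mem_union, Finset.mem_sdiff, mN2 h.us.1, not_or]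
    refine ⟨h.uv.1, fun hv => ((h.Cu u).mpr hv).2.1 rfl, fun hv => hv.1.2.1 rfl⟩

open Classical in
noncomputable def IS (K : SComplex) (u : ℕ) : Finset ℕ := (K.N1 u).filter (fun v => K.II u v)

theorem mIS {u v : ℕ} : v ∈ K.IS u ↔ K.II u v := by
  simp only [IS, Finset.mem_filter, mN1]
  exact ⟨fun h => h.2, fun h => ⟨h.1, h⟩⟩

theorem Ctx.count {u : ℕ} (hc : Ctx K u) {v s : ℕ} (hv : K.II u v) (h : K.Sus u v s (K.N2 u v))
    (hC : (K.N2 u v).card ≤ 5) (hC4 : 4 ≤ (K.N2 u v).card) :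
    (K.IS u).card + (K.N2 u v).card + 1 ≤ (K.N1 u).card ∧
    ((K.IS u).card + (K.N2 u v).card + 1 = (K.N1 u).card →
      ∀ x, K.E u x → x = s ∨ x ∈ K.N2 u v ∨ K.II u x) := by
  have hK := hc.good
  have hsb := h.s_big hK hC hC4
  have h4 : insert s (K.IS u ∪ K.N2 u v) ⊆ K.N1 u := by
    intro x
    simp only [Finset.mem_insert, Finset.mem_union, mIS, mN1]
    rintro (rfl | hx | hx)
    · exact h.us
    · exact hx.1
    · exact ((h.Cu x).mpr hx).e13
  have h5 : (insert s (K.IS u ∪ K.N2 u v)).card = (K.IS u).card + (K.N2 u v).card + 1 := by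
    rw [Finset.card_insert_of_notMem, Finset.card_union_of_disjoint]
    · rw [Finset.disjoint_left]
      intro x hx hx'
      exact hc.indep hv (mIS.mp hx) ((h.Cu x).mpr hx')
    · simp only [Finset.mem_union, mIS, not_or]
      refine ⟨fun hs => ?_, fun hs => h.nt ((h.Cu s).mpr hs)⟩
      rcases hs.2 with h6 | h6 <;> omega
  refine ⟨h5 ▸ Finset.card_le_card h4, fun he x hx => ?_⟩
  have := Finset.eq_of_subset_of_card_le h4 (by omega)
  rw [← mN1, ← this] at hx
  simpa only [Finset.mem_insert, Finset.mem_union, mIS, or_comm (a := x ∈ K.N2 u v)] using hx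

theorem Ctx.four {u : ℕ} (hc : Ctx K u) {v s : ℕ} (h : K.Sus u v s (K.N2 u v))
    (hC : (K.N2 u v).card ≤ 5)
    (H : ∀ x, K.E u x → x = s ∨ x ∈ K.N2 u v ∨ K.II u x) :
    ∃ a b e f, a ≠ b ∧ e ≠ f ∧ a ∈ K.N2 u v ∧ b ∈ K.N2 u v ∧ K.II u e ∧ K.II u f ∧
      K.Q u s e a ∧ K.Q u s e b ∧ K.Q u s f a ∧ K.Q u s f b ∧
      ∀ x, K.T u s x → x = a ∨ x = b ∨ x = e ∨ x = f := by
  have hK := hc.good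
  set C := K.N2 u v
  have h1 := hK.N2_ge h.us
  have h2 := h.dc hK hC
  have h3 : 2 ≤ (K.N2 u s \ C).card := by
    have := Finset.card_sdiff_add_card_inter (K.N2 u s) C
    omega
  have hD : ∀ x, x ∈ K.N2 u s \ C → K.T u s x ∧ K.II u x := by
    intro x hx
    simp only [Finset.mem_sdiff, mN2 h.us.1] at hx
    refine ⟨hx.1, ?_⟩
    rcases H x hx.1.e13 with e | e | e
    · exact absurd e.symm hx.1.2.2.1
    · exact absurd e hx.2
    · exact e
  obtain ⟨e, he, f, hf, hef⟩ := Finset.one_lt_card.mp (by omega : 1 < (K.N2 u s \ C).card)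
  have nbr : ∀ e, e ∈ K.N2 u s \ C → ∀ r, K.Q u s e r → r ∈ K.N2 u s ∩ C := by
    intro e he r hr
    simp only [Finset.mem_inter, mN2 h.us.1]
    refine ⟨hr.s34.t, ?_⟩
    by_contra hn
    have hr' : r ∈ K.N2 u s \ C := by
      simp only [Finset.mem_sdiff, mN2 h.us.1]; exact ⟨hr.s34.t, hn⟩
    exact hc.indep (hD e he).2 (hD r hr').2 hr.p1342.t
  obtain ⟨a, b, hab, ha, hb, -⟩ := hK.nrm.twoT (hD e he).1
  have hS : K.N2 u s ∩ C = {a, b} := by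
    symm
    apply Finset.eq_of_subset_of_card_le
    · intro x; simp only [Finset.mem_insert, Finset.mem_singleton]
      rintro (rfl | rfl)
      · exact nbr e he _ ha
      · exact nbr e he _ hb
    · rw [Finset.card_pair hab]; exact h2
  have nbr2 : ∀ f, f ∈ K.N2 u s \ C → K.Q u s f a ∧ K.Q u s f b := by
    intro f hf
    obtain ⟨a', b', hab', ha', hb', -⟩ := hK.nrm.twoT (hD f hf).1
    have h5 := nbr f hf _ ha'
    have h6 := nbr f hf _ hb'
    rw [hS] at h5 h6
    simp only [Finset.mem_insert, Finset.mem_singleton] at h5 h6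
    rcases h5 with rfl | rfl <;> rcases h6 with rfl | rfl
    · exact absurd rfl hab'
    · exact ⟨ha', hb'⟩
    · exact ⟨hb', ha'⟩
    · exact absurd rfl hab'
  have haS : a ∈ K.N2 u s ∩ C := nbr e he _ ha
  have hbS : b ∈ K.N2 u s ∩ C := nbr e he _ hb
  refine ⟨a, b, e, f, hab, hef, (Finset.mem_inter.mp haS).2, (Finset.mem_inter.mp hbS).2,
    (hD e he).2, (hD f hf).2, ha, hb, (nbr2 f hf).1, (nbr2 f hf).2, fun x hx => ?_⟩
  by_cases hxC : x ∈ C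
  · have : x ∈ K.N2 u s ∩ C := by simp only [Finset.mem_inter, mN2 h.us.1]; exact ⟨hx, hxC⟩
    rw [hS] at this
    simp only [Finset.mem_insert, Finset.mem_singleton] at this
    tauto
  · have hx' : x ∈ K.N2 u s \ C := by
      simp only [Finset.mem_sdiff, mN2 h.us.1]; exact ⟨hx, hxC⟩
    by_contra hn
    simp only [not_or] at hn
    exact hK.nrm.only3 ha.s34 (nbr2 f hf).1.s34 (nbr2 x hx').1.s34 hef
      (fun h => hn.2.2.1 h.symm) (fun h => hn.2.2.2 h.symm)

end Ind
end ModI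

section ModJ
section Alpha
variable {K : SComplex}

theorem Ctx.alpha_aux {u : ℕ} (hc : Ctx K u) {v e f g a b p q : ℕ}
    (hve : v ≠ e) (hvf : v ≠ f) (hvg : v ≠ g) (heg : e ≠ g) (hfg : f ≠ g)
    (hvap : K.Q u v a p) (hvaq : K.Q u v a q)
    (heap : K.Q u e a p) (hfaq : K.Q u f a q)
    (hga : K.T u g a) (hgn : ∀ x, K.T u g x → x = a ∨ x = b ∨ x = p ∨ x = q) : False := by
  have hK := hc.good
  have key : ∀ z, K.Q u g a z → z = b := by
    intro z hz
    rcases hgn z hz.s34.t with rfl | rfl | rfl | rfl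
    · exact absurd rfl hz.2.2.2.2.2.1
    · rfl
    · exact (hK.nrm.only3 hvap.p1342 heap.p1342 hz.p1342 hve hvg heg).elim
    · exact (hK.nrm.only3 hvaq.p1342 hfaq.p1342 hz.p1342 hvf hvg hfg).elim
  obtain ⟨x, y, hxy, hx, hy, -⟩ := hK.nrm.twoT hga
  exact hxy ((key x hx).trans (key y hy).symm)

theorem Ctx.cov {u : ℕ} (hc : Ctx K u) {s : ℕ} {C : Finset ℕ}
    (H : ∀ x, K.E u x → x = s ∨ x ∈ C ∨ K.II u x) {x y : ℕ} (hx : K.II u x) (h : K.T u x y) :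
    y = s ∨ y ∈ C := by
  rcases H y h.e13 with e | e | e
  · exact .inl e
  · exact .inr e
  · exact (hc.indep hx e h).elim

theorem Ctx.alpha {u : ℕ} (hc : Ctx K u) (h9 : (K.N1 u).card = 9) (h4 : (K.IS u).card = 4)
    (h6 : ∀ v, K.II u v → (K.N1 v).card = 6) : False := by
  have hK := hc.good
  have hd4 : ∀ v, K.II u v → (K.N2 u v).card = 4 := by
    intro v hv
    obtain ⟨-, -, -, -, h, -⟩ := hK.getSus hv
    exact h (h6 v hv)
  obtain ⟨v, hv⟩ := Finset.card_pos.mp (by omega : 0 < (K.IS u).card)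
  rw [mIS] at hv
  obtain ⟨s, hs, -⟩ := hK.getSus hv
  have hC := hd4 v hv
  have H := (hc.count hv hs (by omega) (by omega)).2 (by omega)
  obtain ⟨a, b, e, f, hab, hef, ha, hb, he, hf, hea, heb, hfa, hfb, hS⟩ := hc.four hs (by omega) H
  have cov : ∀ x y, K.II u x → K.T u x y → y = s ∨ y ∈ K.N2 u v := fun x y hx h => hc.cov H hx h
  have hve : v ≠ e := by rintro rfl; exact hs.nt hea.p1324.t
  have hvf : v ≠ f := by rintro rfl; exact hs.nt hfa.p1324.t
  obtain ⟨g, hg⟩ : ∃ g ∈ K.IS u, g ∉ ({v, e, f} : Finset ℕ) :=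
    exists_mem_notMem_of_card (by rw [h4, card3 hve hvf hef]; omega)
  rw [mIS] at hg
  obtain ⟨hg, hg'⟩ := hg
  simp only [Finset.mem_insert, Finset.mem_singleton, not_or] at hg'
  have hCard : (K.N2 u v \ {a, b}).card = 2 := by
    rw [Finset.card_sdiff_of_subset (by
      intro w; simp only [Finset.mem_insert, Finset.mem_singleton]
      rintro (rfl | rfl) <;> assumption), Finset.card_pair hab]
    omega
  obtain ⟨p, q, hpq, hCpq⟩ := Finset.card_eq_two.mp hCard
  have hCm : ∀ x, x ∈ K.N2 u v ↔ x = a ∨ x = b ∨ x = p ∨ x = q := by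
    intro x
    have h1 : x ∈ K.N2 u v \ {a, b} ↔ x ∈ ({p, q} : Finset ℕ) := by rw [hCpq]
    simp only [Finset.mem_sdiff, Finset.mem_insert, Finset.mem_singleton, not_or] at h1
    constructor
    · intro hx; by_cases h2 : x = a
      · exact .inl h2
      · by_cases h3 : x = b
        · exact .inr (.inl h3)
        · exact .inr (.inr (h1.mp ⟨hx, h2, h3⟩))
    · rintro (rfl | rfl | h)
      · exact ha
      · exact hb
      · exact (h1.mpr h).1
  have hpn : p ≠ a ∧ p ≠ b := by
    have : p ∈ K.N2 u v \ {a, b} := by rw [hCpq]; simp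
    simpa using (Finset.mem_sdiff.mp this).2
  have hqn : q ≠ a ∧ q ≠ b := by
    have : q ∈ K.N2 u v \ {a, b} := by rw [hCpq]; simp
    simpa using (Finset.mem_sdiff.mp this).2
  have hsC : s ∉ K.N2 u v := fun h => hs.nt ((hs.Cu s).mpr h)
  have hsp : s ≠ p := by rintro rfl; exact hsC ((hCm _).mpr (by simp))
  have hsq : s ≠ q := by rintro rfl; exact hsC ((hCm _).mpr (by simp))
  have hva : K.Q u v a p ∧ K.Q u v a q := by
    have key : ∀ z, K.Q u v a z → z = p ∨ z = q := by
      intro z hz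
      rcases (hCm z).mp ((hs.Cu z).mp hz.s34.t) with rfl | rfl | h
      · exact absurd rfl hz.2.2.2.2.2.1
      · exact (hs.q1 hK hea.s34.t heb.s34.t hz).elim
      · exact h
    obtain ⟨x, y, hxy, hx, hy, -⟩ := hK.nrm.twoT ((hs.Cu a).mpr ha)
    rcases key x hx with rfl | rfl <;> rcases key y hy with rfl | rfl
    · exact absurd rfl hxy
    · exact ⟨hx, hy⟩
    · exact ⟨hy, hx⟩
    · exact absurd rfl hxy
  have ty : ∀ e, K.II u e → K.Q u s e a → K.Q u s e b → K.Q u e a p ∨ K.Q u e a q := by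
    intro e he hea heb
    obtain ⟨x, y, hxy, hx, hy, -⟩ := hK.nrm.twoT hea.p1342.t
    have key : ∀ z, K.Q u e a z → z ≠ s → z = p ∨ z = q := by
      intro z hz hzs
      rcases cov e z he hz.s34.t with h | h
      · exact absurd h hzs
      · rcases (hCm z).mp h with rfl | rfl | h
        · exact absurd rfl hz.2.2.2.2.2.1
        · exact (hK.noDeg3 hea.p1324 hz heb.p1342).elim
        · exact h
    by_cases hxs : x = s
    · rcases key y hy (by rintro rfl; exact hxy hxs) with rfl | rfl
      · exact .inl hy
      · exact .inr hy
    · rcases key x hx hxs with rfl | rfl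
      · exact .inl hx
      · exact .inr hx
  have hgs : ∀ x, K.T u g x → x = a ∨ x = b ∨ x = p ∨ x = q := by
    intro x hx
    rcases cov g x hg hx with rfl | h
    · exfalso
      rcases hS g hx.s23 with rfl | rfl | rfl | rfl
      · exact hc.indep hv hg ((hs.Cu _).mpr ha)
      · exact hc.indep hv hg ((hs.Cu _).mpr hb)
      · exact hg'.2.1 rfl
      · exact hg'.2.2 rfl
    · exact (hCm x).mp h
  have hga : K.T u g a := by
    have hsub : K.N2 u g ⊆ K.N2 u v := by
      intro x hx
      rw [mN2 hg.1.1] at hx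
      exact (hCm x).mpr (hgs x hx)
    have := Finset.eq_of_subset_of_card_le hsub (by rw [hC, hd4 g hg])
    rw [← mN2 hg.1.1, this]; exact ha
  rcases ty e he hea heb with h1 | h1 <;> rcases ty f hf hfa hfb with h2 | h2
  · exact hK.nrm.only3 hva.1.p1342 h1.p1342 h2.p1342 hve hvf hef
  · exact hc.alpha_aux hve hvf (Ne.symm hg'.1) (Ne.symm hg'.2.1) (Ne.symm hg'.2.2) hva.1 hva.2 h1 h2
      hga hgs
  · exact hc.alpha_aux hvf hve (Ne.symm hg'.1) (Ne.symm hg'.2.2) (Ne.symm hg'.2.1) hva.1 hva.2 h2 h1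
      hga hgs
  · exact hK.nrm.only3 hva.2.p1342 h1.p1342 h2.p1342 hve hvf hef

end Alpha
end ModJ

section ModK
section Beta
variable {K : SComplex} {u v e f s a m b p q : ℕ}

def Nd (u v e f s a m b p q : ℕ) : Prop :=
  u ≠ v ∧ u ≠ e ∧ u ≠ f ∧ u ≠ s ∧ u ≠ a ∧ u ≠ m ∧ u ≠ b ∧ u ≠ p ∧ u ≠ q ∧ v ≠ e ∧ v ≠ f ∧ v ≠ s ∧
  v ≠ a ∧ v ≠ m ∧ v ≠ b ∧ v ≠ p ∧ v ≠ q ∧ e ≠ f ∧ e ≠ s ∧ e ≠ a ∧ e ≠ m ∧ e ≠ b ∧ e ≠ p ∧ e ≠ q ∧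
  f ≠ s ∧ f ≠ a ∧ f ≠ m ∧ f ≠ b ∧ f ≠ p ∧ f ≠ q ∧ s ≠ a ∧ s ≠ m ∧ s ≠ b ∧ s ≠ p ∧ s ≠ q ∧ a ≠ m ∧
  a ≠ b ∧ a ≠ p ∧ a ≠ q ∧ m ≠ b ∧ m ≠ p ∧ m ≠ q ∧ b ≠ p ∧ b ≠ q ∧ p ≠ q

structure Beta (K : SComplex) (u v e f s a m b p q : ℕ) : Prop where
  ctx : Ctx K u
  n9 : (K.N1 u).card = 9
  nd : Nd u v e f s a m b p q
  all : ∀ x, K.E u x → x = v ∨ x = e ∨ x = f ∨ x = s ∨ x = a ∨ x = m ∨ x = b ∨ x = p ∨ x = q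
  sus : K.Sus u v s (K.N2 u v)
  vn : ∀ x, K.T u v x → x = a ∨ x = m ∨ x = b ∨ x = p ∨ x = q
  sn : ∀ x, K.T u s x → x = a ∨ x = b ∨ x = e ∨ x = f
  en : ∀ x, K.T u e x → x = s ∨ x = a ∨ x = m ∨ x = b ∨ x = p ∨ x = q
  fn : ∀ x, K.T u f x → x = s ∨ x = a ∨ x = m ∨ x = b ∨ x = p ∨ x = q
  vI : K.II u v
  eI : K.II u e
  fI : K.II u f
  vam : K.Q u v a m
  vmb : K.Q u v m b
  vbp : K.Q u v b p
  vpq : K.Q u v p q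
  vqa : K.Q u v q a
  sea : K.Q u s e a
  seb : K.Q u s e b
  sfa : K.Q u s f a
  sfb : K.Q u s f b

theorem Beta.swap (X : Beta K u v e f s a m b p q) : Beta K u v f e s a m b p q where
  ctx := X.ctx
  n9 := X.n9
  nd := by have := X.nd; unfold Nd at *; grind
  all := fun x hx => by have := X.all x hx; tauto
  sus := X.sus
  vn := X.vn
  sn := fun x hx => by have := X.sn x hx; tauto
  en := X.fn
  fn := X.en
  vI := X.vI
  eI := X.fI
  fI := X.eI
  vam := X.vam
  vmb := X.vmb
  vbp := X.vbp
  vpq := X.vpq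
  vqa := X.vqa
  sea := X.sfa
  seb := X.sfb
  sfa := X.sea
  sfb := X.seb

theorem Beta.mirror (X : Beta K u v e f s a m b p q) : Beta K u v e f s b m a q p where
  ctx := X.ctx
  n9 := X.n9
  nd := by have := X.nd; unfold Nd at *; grind
  all := fun x hx => by have := X.all x hx; tauto
  sus := X.sus
  vn := fun x hx => by have := X.vn x hx; tauto
  sn := fun x hx => by have := X.sn x hx; tauto
  en := fun x hx => by have := X.en x hx; tauto
  fn := fun x hx => by have := X.fn x hx; tauto
  vI := X.vI
  eI := X.eI
  fI := X.fI
  vam := X.vmb.s34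
  vmb := X.vam.s34
  vbp := X.vqa.s34
  vpq := X.vpq.s34
  vqa := X.vbp.s34
  sea := X.seb
  seb := X.sea
  sfa := X.sfb
  sfb := X.sfa

/-- an edge of the link of `u` lies in three triangles -/
theorem Beta.thr (X : Beta K u v e f s a m b p q) {x y : ℕ} (h1 : K.Q u v x y) (h2 : K.Q u e x y)
    (h3 : K.Q u f x y) : False := by
  have nd := X.nd
  unfold Nd at nd
  exact X.ctx.good.nrm.only3 h1.p1342 h2.p1342 h3.p1342 (by grind) (by grind) (by grind)

/-- The general shape of the link of the edge `ue`. -/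
theorem Beta.shape (X : Beta K u v e f s a m b p q) :
    ∃ r r', (r = m ∨ r = p ∨ r = q) ∧ (r' = m ∨ r' = p ∨ r' = q) ∧ K.Q u e a r ∧ K.Q u e b r' ∧
      ((r = r' ∧ ∀ x, K.T u e x ↔ x = s ∨ x = a ∨ x = b ∨ x = r) ∨
       (r ≠ r' ∧ K.Q u e r r' ∧ ∀ x, K.T u e x ↔ x = s ∨ x = a ∨ x = b ∨ x = r ∨ x = r')) ∧
      ∃ z, (z = m ∨ z = p ∨ z = q) ∧ ¬ K.T u e z ∧ K.Sus u e z (K.N2 u e) := by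
  have hK := X.ctx.good
  have nd := X.nd
  unfold Nd at nd
  have hab : a ≠ b := by grind
  have hsa : s ≠ a := by grind
  have hsb : s ≠ b := by grind
  have ham : a ≠ m ∧ a ≠ p ∧ a ≠ q := by grind
  have hbm : b ≠ m ∧ b ≠ p ∧ b ≠ q := by grind
  clear nd
  have noab : ¬ K.Q u e a b := fun h => hK.noDeg3 X.sea.p1324 h X.seb.p1342
  have sz : ∀ x, K.Q u e s x → x = a ∨ x = b := fun x hx =>
    hK.nrm.only2 X.sea.p1324 X.seb.p1324 hab hx
  obtain ⟨z, hz, hc4, hc5, -⟩ := hK.getSus X.eI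
  have other : ∀ x, K.T u e x → ∀ y, ∃ w, w ≠ y ∧ K.Q u e x w := by
    intro x hx y
    obtain ⟨w, w', hww, hw, hw', -⟩ := hK.nrm.twoT hx
    by_cases h : w = y
    · exact ⟨w', by rintro rfl; exact hww h, hw'⟩
    · exact ⟨w, h, hw⟩
  have Tea : K.T u e a := X.sea.p1342.t
  have Teb : K.T u e b := X.seb.p1342.t
  have Tes : K.T u e s := X.sea.p1324.t
  obtain ⟨r, hrs, hr⟩ := other a Tea s
  obtain ⟨r', hrs', hr'⟩ := other b Teb s
  have az : ∀ x, K.Q u e a x → x = s ∨ x = r := fun x hx =>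
    hK.nrm.only2 X.sea.p1342 hr hrs.symm hx
  have bz : ∀ x, K.Q u e b x → x = s ∨ x = r' := fun x hx =>
    hK.nrm.only2 X.seb.p1342 hr' hrs'.symm hx
  have hrm : r = m ∨ r = p ∨ r = q := by
    rcases X.en r hr.s34.t with h | h | h | h | h | h
    · exact absurd h hrs
    · exact absurd h.symm hr.2.2.2.2.2.1
    · exact .inl h
    · subst h; exact absurd hr noab
    · exact .inr (.inl h)
    · exact .inr (.inr h)
  have hrm' : r' = m ∨ r' = p ∨ r' = q := by
    rcases X.en r' hr'.s34.t with h | h | h | h | h | h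
    · exact absurd h hrs'
    · subst h; exact absurd hr'.s34 noab
    · exact .inl h
    · exact absurd h.symm hr'.2.2.2.2.2.1
    · exact .inr (.inl h)
    · exact .inr (.inr h)
  refine ⟨r, r', hrm, hrm', hr, hr', ?_, z, ?_, hz.nt, hz⟩
  · by_cases hrr : r = r'
    · subst hrr
      refine .inl ⟨rfl, fun x => ⟨fun hx => ?_, ?_⟩⟩
      · by_contra hn
        simp only [not_or] at hn
        have hex : ∀ y, K.Q u e x y → ∀ c, (∀ w, K.Q u e c w → w = s ∨ w = r ∨ w = a ∨ w = b) → y ≠ c := by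
          rintro y hy c h rfl
          rcases h x hy.s34 with h | h | h | h
          · exact hn.1 h
          · exact hn.2.2.2 h
          · exact hn.2.1 h
          · exact hn.2.2.1 h
        have rz : ∀ w, K.Q u e r w → w = a ∨ w = b := fun w hw =>
          hK.nrm.only2 hr.s34 hr'.s34 hab hw
        -- completions of `x` all lie in `{m,p,q} \ {x, r}`
        obtain ⟨y, y', hyy, hy, hy', -⟩ := hK.nrm.twoT hx
        have f1 : ∀ y, K.Q u e x y → y ≠ s ∧ y ≠ a ∧ y ≠ b ∧ y ≠ r ∧ y ≠ x ∧ (y = m ∨ y = p ∨ y = q) := by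
          intro y hy
          have g1 : y ≠ s := hex y hy s (fun w hw => .inr (.inr (sz w hw)))
          have g2 : y ≠ a := hex y hy a (fun w hw => (az w hw).imp id .inl)
          have g3 : y ≠ b := hex y hy b (fun w hw => (bz w hw).imp id .inl)
          have g4 : y ≠ r := hex y hy r (fun w hw => .inr (.inr (rz w hw)))
          have g5 : y ≠ x := hy.2.2.2.2.2.1.symm
          refine ⟨g1, g2, g3, g4, g5, ?_⟩
          rcases X.en y hy.s34.t with h | h | h | h | h | h
          · exact absurd h g1
          · exact absurd h g2
          · exact .inl h
          · exact absurd h g3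
          · exact .inr (.inl h)
          · exact .inr (.inr h)
        have hxm : x = m ∨ x = p ∨ x = q := by
          rcases X.en x hx with h | h | h | h | h | h
          · exact absurd h hn.1
          · exact absurd h hn.2.1
          · exact .inl h
          · exact absurd h hn.2.2.1
          · exact .inr (.inl h)
          · exact .inr (.inr h)
        have k1 := f1 y hy
        have k2 := f1 y' hy'
        clear f1 hex
        grind
      · rintro (rfl | rfl | rfl | rfl)
        · exact Tes
        · exact Tea
        · exact Teb
        · exact hr.s34.t
    · right
      have hcard : ({s, a, b, r, r'} : Finset ℕ).card = 5 := by
        have h4 : a ≠ r := hr.2.2.2.2.2.1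
        have h5 : b ≠ r' := hr'.2.2.2.2.2.1
        have h6 : a ≠ r' := by grind
        have h7 : b ≠ r := by grind
        rw [Finset.card_insert_of_notMem (by simp [*, hrs.symm, hrs'.symm]),
          Finset.card_insert_of_notMem (by simp [*]),
          Finset.card_insert_of_notMem (by simp [*]), Finset.card_pair hrr]
      have hN : ({s, a, b, r, r'} : Finset ℕ) = K.N2 u e := by
        apply Finset.eq_of_subset_of_card_le
        · intro x
          simp only [Finset.mem_insert, Finset.mem_singleton, mN2 X.eI.1.1]
          rintro (rfl | rfl | rfl | rfl | rfl)
          · exact Tes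
          · exact Tea
          · exact Teb
          · exact hr.s34.t
          · exact hr'.s34.t
        · omega
      have hN' : ∀ x, K.T u e x ↔ x = s ∨ x = a ∨ x = b ∨ x = r ∨ x = r' := by
        intro x
        rw [← mN2 X.eI.1.1, ← hN]
        simp
      refine ⟨hrr, ?_, hN'⟩
      obtain ⟨w, hwa, hw⟩ := other r hr.s34.t a
      rcases (hN' w).mp hw.s34.t with h | h | h | h | h
      · subst h
        rcases sz r hw.s34 with h | h
        · exact absurd h.symm hr.2.2.2.2.2.1
        · subst h; exact absurd hr noab
      · exact absurd h hwa
      · subst h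
        rcases bz r hw.s34 with h | h
        · exact absurd h hrs
        · exact absurd h hrr
      · exact absurd h.symm hw.2.2.2.2.2.1
      · subst h; exact hw
  · have hb := hz.s_big hK hc5 hc4
    have hnI : ¬ K.II u z := by rintro ⟨-, h | h⟩ <;> omega
    have hnt := hz.nt
    rcases X.all z hz.us with h | h | h | h | h | h | h | h | h
    · subst h; exact absurd X.vI hnI
    · subst h; exact absurd X.eI hnI
    · subst h; exact absurd X.fI hnI
    · subst h; exact absurd Tes hnt
    · subst h; exact absurd Tea hnt
    · exact .inl h
    · subst h; exact absurd Teb hnt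
    · exact .inr (.inl h)
    · exact .inr (.inr h)

end Beta
end ModK

section ModL
section BetaTypes
variable {K : SComplex} {u v e f s a m b p q : ℕ}

def B1 (K : SComplex) (u e s a m b p q : ℕ) : Prop :=
  K.Q u e a m ∧ K.Q u e m b ∧ (∀ x, K.T u e x → x = s ∨ x = a ∨ x = b ∨ x = m) ∧
    ((¬ K.T u m p ∧ K.Sus u e p (K.N2 u e)) ∨ (¬ K.T u m q ∧ K.Sus u e q (K.N2 u e)))

def B2 (K : SComplex) (u e s a m b p : ℕ) : Prop :=
  K.Q u e a p ∧ K.Q u e p b ∧ (∀ x, K.T u e x → x = s ∨ x = a ∨ x = b ∨ x = p) ∧ ¬ K.T u m p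

def B3 (K : SComplex) (u e s a m b p q : ℕ) : Prop :=
  K.Q u e a q ∧ K.Q u e q p ∧ K.Q u e p b ∧
    (∀ x, K.T u e x → x = s ∨ x = a ∨ x = b ∨ x = q ∨ x = p) ∧ ¬ K.T u m p ∧ ¬ K.T u m q ∧
    K.Sus u e m (K.N2 u e)

def B3' (K : SComplex) (u e s a m b p q : ℕ) : Prop :=
  K.Q u e a p ∧ K.Q u e p q ∧ K.Q u e q b ∧
    (∀ x, K.T u e x → x = s ∨ x = a ∨ x = b ∨ x = p ∨ x = q) ∧ ¬ K.T u m p ∧ ¬ K.T u m q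

def B4 (K : SComplex) (u e a m b p q : ℕ) : Prop :=
  K.Q u e a q ∧ K.Q u e q m ∧ K.Q u e m b ∧ ¬ K.T u m p ∧ ¬ K.T u p a

def BT (K : SComplex) (u e s a m b p q : ℕ) : Prop :=
  K.B1 u e s a m b p q ∨ K.B2 u e s a m b p ∨ K.B2 u e s b m a q ∨ K.B3 u e s a m b p q ∨
    K.B3' u e s a m b p q ∨ K.B4 u e a m b p q ∨ K.B4 u e b m a q p

theorem Beta.types (X : Beta K u v e f s a m b p q) : K.BT u e s a m b p q := by
  have hK := X.ctx.good
  obtain ⟨r, r', hr, hr', h1, h2, h3, z, hz, hnt, hS⟩ := X.shape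
  have nd := X.nd
  unfold Nd at nd
  have hmp : m ≠ p := by grind
  have hmq : m ≠ q := by grind
  have hpq : p ≠ q := by grind
  clear nd
  have Tma : K.T u m a := X.vam.p1432.t
  have Tmb : K.T u m b := X.vmb.p1342.t
  have Tpb : K.T u p b := X.vbp.p1432.t
  have Tpq : K.T u p q := X.vpq.p1342.t
  have Tqp : K.T u q p := Tpq.s23
  have Tqa : K.T u q a := X.vqa.p1342.t
  have q1 : ∀ x y, K.T u z x → K.T u z y → K.Q u e x y → False := fun x y hx hy hq =>
    hS.q1 hK hx hy hq
  rcases h3 with ⟨rfl, hN⟩ | ⟨hrr, h3, hN⟩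
  · rcases hr with rfl | rfl | rfl
    · refine .inl ⟨h1, h2.s34, fun x hx => (hN x).mp hx, ?_⟩
      rcases hz with rfl | rfl | rfl
      · exact absurd h1.s34.t hnt
      · exact .inl ⟨fun h => q1 _ _ h.s23 Tpb h2.s34, hS⟩
      · exact .inr ⟨fun h => q1 _ _ Tqa h.s23 h1, hS⟩
    · rcases hz with rfl | rfl | rfl
      · exact .inr (.inl ⟨h1, h2.s34, fun x hx => (hN x).mp hx, fun h => q1 _ _ Tma h h1⟩)
      · exact absurd h1.s34.t hnt
      · exact (q1 _ _ Tqa Tqp h1).elim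
    · rcases hz with rfl | rfl | rfl
      · refine .inr (.inr (.inl ⟨h2, h1.s34, fun x hx => ?_, fun h => q1 _ _ Tma h h1⟩))
        rcases (hN x).mp hx with h | h | h | h <;> simp [h]
      · exact (q1 _ _ Tpb Tpq h2).elim
      · exact absurd h1.s34.t hnt
  · have hzr : z ≠ r := by rintro rfl; exact hnt h1.s34.t
    have hzr' : z ≠ r' := by rintro rfl; exact hnt h2.s34.t
    rcases hr with rfl | rfl | rfl <;> rcases hr' with rfl | rfl | rfl
    · exact absurd rfl hrr
    · obtain rfl : z = q := by tauto
      refine .inr (.inr (.inr (.inr (.inr (.inr ⟨h2, h3.s34, h1.s34, fun h => ?_, fun h => ?_⟩)))))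
      · exact q1 _ _ Tqp h.s23 h3.s34
      · exact q1 _ _ Tqp h h2.s34
    · obtain rfl : z = p := by tauto
      exact (q1 _ _ Tpb Tpq h2).elim
    · obtain rfl : z = q := by tauto
      exact (q1 _ _ Tqa Tqp h1).elim
    · exact absurd rfl hrr
    · obtain rfl : z = m := by tauto
      exact .inr (.inr (.inr (.inr (.inl ⟨h1, h3, h2.s34, fun x hx => (hN x).mp hx,
        fun h => q1 _ _ Tma h h1, fun h => q1 _ _ Tmb h h2⟩))))
    · obtain rfl : z = p := by tauto
      exact .inr (.inr (.inr (.inr (.inr (.inl ⟨h1, h3, h2.s34, fun h => q1 _ _ Tpq h.s23 h3,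
        fun h => q1 _ _ Tpq h h1.s34⟩)))))
    · obtain rfl : z = m := by tauto
      exact .inr (.inr (.inr (.inl ⟨h1, h3, h2.s34, fun x hx => (hN x).mp hx,
        fun h => q1 _ _ Tmb h h2, fun h => q1 _ _ Tma h h1, hS⟩)))
    · exact absurd rfl hrr

theorem Beta.no12 (X : Beta K u v e f s a m b p q) (h1 : K.B1 u e s a m b p q)
    (h2 : K.B2 u f s a m b p) : False := by
  have hK := X.ctx.good
  have nd := X.nd
  unfold Nd at nd
  obtain ⟨eam, emb, eN, -⟩ := h1
  obtain ⟨fap, fpb, fN, -⟩ := h2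
  have qn : ∀ x, K.T u q x → x = v ∨ x = p ∨ x = a ∨ x = m ∨ x = b := by
    intro x hx
    have h1 := X.all x hx.e13
    have h2 : x ≠ s := by
      rintro rfl
      have := X.sn _ hx.s23; grind
    have h3 : x ≠ e := by
      rintro rfl
      have := eN _ hx.s23; grind
    have h4 : x ≠ f := by
      rintro rfl
      have := fN _ hx.s23; grind
    have h5 : x ≠ q := hx.2.2.1.symm
    clear nd
    grind
  have hab : a ≠ b := by grind
  have hap : a ≠ p := by grind
  have hpv : p ≠ v := by grind
  have hve : v ≠ e := by grind
  have hvf : v ≠ f := by grind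
  have hvq : v ≠ q := by grind
  have heq : e ≠ q := by grind
  have hfq : f ≠ q := by grind
  have hpa : p ≠ a := hap.symm
  have hmp : m ≠ p := by grind
  have hma : m ≠ a := by grind
  have hbp : b ≠ p := by grind
  have hmb : m ≠ b := by grind
  have hmq : m ≠ q := by grind
  have hbq : b ≠ q := by grind
  clear nd
  have vq : ∀ x, K.Q u v q x → x = p ∨ x = a := fun x hx =>
    hK.nrm.only2 X.vpq.s34 X.vqa hpa hx
  have nqm : ¬ K.T u q m := by
    intro h
    have key : ∀ z, K.Q u q m z → z = p := by
      intro z hz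
      rcases qn z hz.s34.t with rfl | h | rfl | rfl | rfl
      · rcases vq m hz.p1423 with h | h
        · exact absurd h hmp
        · exact absurd h hma
      · exact h
      · exact (hK.nrm.only3 X.vam.p1342 eam.p1342 hz.p1432 hve hvq heq).elim
      · exact absurd rfl hz.2.2.2.2.2.1
      · exact (hK.nrm.only3 X.vmb.p1342 emb.p1342 hz.p1342 hve hvq heq).elim
    obtain ⟨x, y, hxy, hx, hy, -⟩ := hK.nrm.twoT h
    exact hxy ((key x hx).trans (key y hy).symm)
  have Eq : K.E u q := X.vqa.p1342.t.e
  have hsub : K.N2 u q ⊆ {v, p, a, b} := by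
    intro x hx
    rw [mN2 Eq.1] at hx
    simp only [Finset.mem_insert, Finset.mem_singleton]
    rcases qn x hx with h | h | h | h | h
    · exact .inl h
    · exact .inr (.inl h)
    · exact .inr (.inr (.inl h))
    · subst h; exact absurd hx nqm
    · exact .inr (.inr (.inr h))
  have hE := Finset.eq_of_subset_of_card_le hsub
    (Finset.card_le_four.trans (hK.N2_ge Eq))
  have Tqb : K.T u q b := by rw [← mN2 Eq.1, hE]; simp
  have key : ∀ z, K.Q u q b z → z = a := by
    intro z hz
    rcases qn z hz.s34.t with rfl | rfl | rfl | rfl | rfl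
    · rcases vq b hz.p1423 with h | h
      · exact absurd h hbp
      · exact absurd h.symm hab
    · exact (hK.nrm.only3 X.vbp.p1342 fpb.p1432 hz.p1342 hvf hvq hfq).elim
    · rfl
    · exact absurd hz.s34.t nqm
    · exact absurd rfl hz.2.2.2.2.2.1
  obtain ⟨x, y, hxy, hx, hy, -⟩ := hK.nrm.twoT Tqb
  exact hxy ((key x hx).trans (key y hy).symm)

theorem Beta.no13'_aux (X : Beta K u v e f s a m b p q)
    (eN : ∀ x, K.T u e x → x = s ∨ x = a ∨ x = b ∨ x = m)
    (fpq : K.Q u f p q) (fqb : K.Q u f q b) (nmq : ¬ K.T u m q) : K.Q u q a b := by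
  have hK := X.ctx.good
  have nd := X.nd
  unfold Nd at nd
  have qn : ∀ x, K.T u q x → x = v ∨ x = f ∨ x = p ∨ x = a ∨ x = b := by
    intro x hx
    have h1 := X.all x hx.e13
    have h2 : x ≠ s := by
      rintro rfl
      have := X.sn _ hx.s23; grind
    have h3 : x ≠ e := by
      rintro rfl
      have := eN _ hx.s23; grind
    have h4 : x ≠ m := by
      rintro rfl
      exact nmq hx.s23
    have h5 : x ≠ q := hx.2.2.1.symm
    clear nd
    grind
  have hva : v ≠ a := by grind
  have hfa : f ≠ a := by grind
  have hvf : v ≠ f := by grind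
  have hpa : p ≠ a := by grind
  have hba : b ≠ a := by grind
  have hpb : p ≠ b := by grind
  clear nd
  have key : ∀ z, K.Q u q a z → z = v ∨ z = b := by
    intro z hz
    rcases qn z hz.s34.t with rfl | rfl | rfl | rfl | rfl
    · exact .inl rfl
    · exact (hK.nrm.only3 fpq.s34 fqb hz.p1423 hpb hpa hba).elim
    · exact (hK.nrm.only3 X.vpq.p1342 fpq.p1342 hz.p1423 hvf hva hfa).elim
    · exact absurd rfl hz.2.2.2.2.2.1
    · exact .inr rfl
  obtain ⟨x, y, hxy, hx, hy, -⟩ := hK.nrm.twoT X.vqa.p1342.t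
  rcases key x hx with rfl | rfl
  · rcases key y hy with rfl | rfl
    · exact absurd rfl hxy
    · exact hy
  · exact hx

theorem Beta.no13' (X : Beta K u v e f s a m b p q) (h1 : K.B1 u e s a m b p q)
    (h2 : K.B3' u f s a m b p q) : False := by
  have hK := X.ctx.good
  obtain ⟨eam, emb, eN, -⟩ := h1
  obtain ⟨fap, fpq, fqb, fN, nmp, nmq⟩ := h2
  have k1 := X.no13'_aux eN fpq fqb nmq
  have k2 := X.mirror.no13'_aux (fun x hx => by rcases eN x hx with h | h | h | h <;> simp [h])
    fpq.s34 fap.s34 nmp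
  have Ea : K.E u a := k1.p1324.t.e
  have hsub : ({s, e, m, v, q, b, p, f} : Finset ℕ) ⊆ K.N2 u a := by
    intro x
    simp only [Finset.mem_insert, Finset.mem_singleton, mN2 Ea.1]
    rintro (rfl | rfl | rfl | rfl | rfl | rfl | rfl | rfl)
    · exact X.sea.p1423.t
    · exact eam.p1324.t
    · exact eam.p1342.t
    · exact X.vam.p1324.t
    · exact k1.p1324.t
    · exact k1.p1342.t
    · exact fap.p1342.t
    · exact fap.p1324.t
  have hc : ({s, e, m, v, q, b, p, f} : Finset ℕ).card = 8 := by
    have nd := X.nd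
    unfold Nd at nd
    have h' : [s, e, m, v, q, b, p, f].Nodup := by
      simp only [List.nodup_cons, List.mem_cons, List.not_mem_nil, or_false, not_or]
      grind
    have := List.toFinset_card_of_nodup h'
    simpa using this
  have h1 := Finset.card_le_card hsub
  have h2 := hK.N2_le Ea
  have h3 := X.n9
  omega

theorem Beta.mlow (X : Beta K u v e f s a m b p q) (he : ¬ K.T u e m) (hf : ¬ K.T u f m)
    (hp : ¬ K.T u m p) (hq : ¬ K.T u m q) : False := by
  have hK := X.ctx.good
  have Em : K.E u m := X.vmb.p1342.t.e
  have hsub : K.N2 u m ⊆ {v, a, b} := by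
    intro x hx
    rw [mN2 Em.1] at hx
    have h2 : x ≠ s := by
      rintro rfl
      have nd := X.nd
      unfold Nd at nd
      have := X.sn _ hx.s23; grind
    have h5 : x ≠ m := hx.2.2.1.symm
    simp only [Finset.mem_insert, Finset.mem_singleton]
    rcases X.all x hx.e13 with rfl | rfl | rfl | rfl | rfl | rfl | rfl | rfl | rfl
    · exact .inl rfl
    · exact absurd hx.s23 he
    · exact absurd hx.s23 hf
    · exact absurd rfl h2
    · exact .inr (.inl rfl)
    · exact absurd rfl h5
    · exact .inr (.inr rfl)
    · exact absurd hx hp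
    · exact absurd hx hq
  have := Finset.card_le_card hsub
  have := hK.N2_ge Em
  have := Finset.card_le_three (a := v) (b := a) (c := b)
  omega

theorem Beta.nB2 (X : Beta K u v e f s a m b p q) (h : K.B2 u e s a m b p) : ¬ K.T u e m := by
  intro h'
  have nd := X.nd
  unfold Nd at nd
  have := h.2.2.1 _ h'
  grind

theorem Beta.nB3' (X : Beta K u v e f s a m b p q) (h : K.B3' u e s a m b p q) : ¬ K.T u e m := by
  intro h'
  have nd := X.nd
  unfold Nd at nd
  have := h.2.2.2.1 _ h'
  grind

theorem B1.mir (h : K.B1 u e s a m b p q) : K.B1 u e s b m a q p := by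
  obtain ⟨h1, h2, h3, h4⟩ := h
  refine ⟨h2.s34, h1.s34, fun x hx => ?_, h4.symm⟩
  rcases h3 x hx with h | h | h | h <;> simp [h]

/-- all pairs of types except the exceptional one -/
theorem Beta.pairs (X : Beta K u v e f s a m b p q) :
    (K.B1 u e s a m b p q ∧ K.B3 u f s a m b p q) ∨
    (K.B3 u e s a m b p q ∧ K.B1 u f s a m b p q) := by
  have ho : ∀ e f, Beta K u v e f s a m b p q → 
      (K.B1 u e s a m b p q → K.B1 u f s a m b p q → False) ∧
      (K.B1 u e s a m b p q → K.B2 u f s a m b p → False) ∧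
      (K.B1 u e s a m b p q → K.B2 u f s b m a q → False) ∧
      (K.B1 u e s a m b p q → K.B3' u f s a m b p q → False) ∧
      (K.B1 u e s a m b p q → K.B4 u f a m b p q → False) ∧
      (K.B1 u e s a m b p q → K.B4 u f b m a q p → False) ∧
      (K.B2 u e s a m b p → K.B2 u f s a m b p → False) ∧
      (K.B2 u e s a m b p → K.B2 u f s b m a q → False) ∧
      (K.B2 u e s a m b p → K.B3 u f s a m b p q → False) ∧
      (K.B2 u e s a m b p → K.B3' u f s a m b p q → False) ∧
      (K.B2 u e s a m b p → K.B4 u f a m b p q → False) ∧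
      (K.B2 u e s a m b p → K.B4 u f b m a q p → False) ∧
      (K.B2 u e s b m a q → K.B2 u f s b m a q → False) ∧
      (K.B2 u e s b m a q → K.B3 u f s a m b p q → False) ∧
      (K.B2 u e s b m a q → K.B3' u f s a m b p q → False) ∧
      (K.B2 u e s b m a q → K.B4 u f a m b p q → False) ∧
      (K.B2 u e s b m a q → K.B4 u f b m a q p → False) := by
    intro e f X
    refine ⟨fun h1 h2 => X.thr X.vam h1.1 h2.1, fun h1 h2 => X.no12 h1 h2,
      fun h1 h2 => X.mirror.no12 h1.mir h2, fun h1 h2 => X.no13' h1 h2,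
      fun h1 h2 => X.thr X.vmb h1.2.1 h2.2.2.1, fun h1 h2 => X.thr X.vam h1.1 h2.2.2.1.s34,
      fun h1 h2 => X.thr X.vbp h1.2.1.s34 h2.2.1.s34,
      fun h1 h2 => X.mlow (X.nB2 h1) (X.swap.mirror.nB2 h2) h1.2.2.2 h2.2.2.2,
      fun h1 h2 => X.thr X.vbp h1.2.1.s34 h2.2.2.1.s34,
      fun h1 h2 => X.mlow (X.nB2 h1) (X.swap.nB3' h2) h2.2.2.2.2.1 h2.2.2.2.2.2,
      fun h1 h2 => h2.2.2.2.2 h1.1.p1432.t,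
      fun h1 h2 => X.thr X.vbp h1.2.1.s34 h2.1,
      fun h1 h2 => X.thr X.vqa h1.2.1 h2.2.1,
      fun h1 h2 => X.thr X.vqa h1.2.1 h2.1.s34,
      fun h1 h2 => X.mlow (X.mirror.nB2 h1) (X.swap.nB3' h2) h2.2.2.2.2.1 h2.2.2.2.2.2,
      fun h1 h2 => X.thr X.vqa h1.2.1 h2.1.s34,
      fun h1 h2 => h2.2.2.2.2 h1.1.p1432.t⟩
  have hp : ∀ e f, Beta K u v e f s a m b p q → 
      (K.B3 u e s a m b p q → K.B3 u f s a m b p q → False) ∧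
      (K.B3 u e s a m b p q → K.B3' u f s a m b p q → False) ∧
      (K.B3 u e s a m b p q → K.B4 u f a m b p q → False) ∧
      (K.B3 u e s a m b p q → K.B4 u f b m a q p → False) ∧
      (K.B3' u e s a m b p q → K.B3' u f s a m b p q → False) ∧
      (K.B3' u e s a m b p q → K.B4 u f a m b p q → False) ∧
      (K.B3' u e s a m b p q → K.B4 u f b m a q p → False) ∧
      (K.B4 u e a m b p q → K.B4 u f a m b p q → False) ∧
      (K.B4 u e a m b p q → K.B4 u f b m a q p → False) ∧
      (K.B4 u e b m a q p → K.B4 u f b m a q p → False) := by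
    intro e f X
    exact ⟨fun h1 h2 => X.thr X.vbp h1.2.2.1.s34 h2.2.2.1.s34,
      fun h1 h2 => X.thr X.vpq h1.2.1.s34 h2.2.1,
      fun h1 h2 => X.thr X.vqa h1.1.s34 h2.1.s34,
      fun h1 h2 => X.thr X.vbp h1.2.2.1.s34 h2.1,
      fun h1 h2 => X.thr X.vpq h1.2.1 h2.2.1,
      fun h1 h2 => h1.2.2.2.2.2 h2.2.1.p1432.t,
      fun h1 h2 => h1.2.2.2.2.1 h2.2.1.p1432.t,
      fun h1 h2 => X.thr X.vqa h1.1.s34 h2.1.s34,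
      fun h1 h2 => h1.2.2.2.1 h2.2.1.p1432.t,
      fun h1 h2 => X.thr X.vbp h1.1 h2.1⟩
  have o1 := ho e f X
  have o2 := ho f e X.swap
  have o3 := hp e f X
  have o4 := hp f e X.swap
  have t1 := X.types
  have t2 := X.swap.types
  unfold BT at t1 t2
  clear ho hp X
  generalize K.B1 u e s a m b p q = e1 at *
  generalize K.B1 u f s a m b p q = f1 at *
  generalize K.B2 u e s a m b p = e2 at *
  generalize K.B2 u f s a m b p = f2 at *
  generalize K.B2 u e s b m a q = e3 at *
  generalize K.B2 u f s b m a q = f3 at *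
  generalize K.B3 u e s a m b p q = e4 at *
  generalize K.B3 u f s a m b p q = f4 at *
  generalize K.B3' u e s a m b p q = e5 at *
  generalize K.B3' u f s a m b p q = f5 at *
  generalize K.B4 u e a m b p q = e6 at *
  generalize K.B4 u f a m b p q = f6 at *
  generalize K.B4 u e b m a q p = e7 at *
  generalize K.B4 u f b m a q p = f7 at *
  grind

end BetaTypes
end ModL

section ModM
section CaseX
variable {K : SComplex} {u v e f s a m b p q : ℕ}

theorem Sus.tr {v s : ℕ} {C : Finset ℕ} (h : K.Sus u v s C) {x y : ℕ} (hq : K.Q u v x y) :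
    K.Q s v x y :=
  h.qs x y ((h.Cu x).mp hq.t) ((h.Cu y).mp hq.s34.t) hq.p2341.t

structure XX (K : SComplex) (u v e f s a m b p q : ℕ) : Prop where
  X : Beta K u v e f s a m b p q
  eam : K.Q u e a m
  emb : K.Q u e m b
  eN : ∀ x, K.T u e x → x = s ∨ x = a ∨ x = b ∨ x = m
  eS : K.Sus u e q (K.N2 u e)
  faq : K.Q u f a q
  fqp : K.Q u f q p
  fpb : K.Q u f p b
  nmp : ¬ K.T u m p
  nmq : ¬ K.T u m q
  fS : K.Sus u f m (K.N2 u f)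
  fN : ∀ x, K.T u f x → x = s ∨ x = a ∨ x = b ∨ x = q ∨ x = p

def PS (u v e f x : ℕ) : Prop := x = u ∨ x = v ∨ x = e ∨ x = f

theorem XX.xEdge (Y : XX K u v e f s a m b p q) {x y z : ℕ} (hz : PS u v e f z)
    (hx : ¬ PS u v e f x) (hy : ¬ PS u v e f y) (h : K.Q m x y z) :
    ((x = b ∨ x = p ∨ x = q) ∧ (y = b ∨ y = p ∨ y = q)) ∨ ∀ z', K.Q m x y z' → PS u v e f z' := by
  have X := Y.X
  have hK := X.ctx.good
  have nd := X.nd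
  unfold Nd at nd
  have nef : e ≠ f := by grind
  have nve : v ≠ e := by grind
  have nvf : v ≠ f := by grind
  have nvb : v ≠ b := by grind
  have nva : v ≠ a := by grind
  have neb : e ≠ b := by grind
  have nab : a ≠ b := by grind
  have nsb : s ≠ b := by grind
  have nsa : s ≠ a := by grind
  have nsm : s ≠ m := by grind
  have nmq : m ≠ q := by grind
  have nmb : m ≠ b := by grind
  have nqb : q ≠ b := by grind
  have nmv : m ≠ v := by grind
  have nsp : s ≠ p := by grind
  have naq : a ≠ q := by grind
  have nsq : s ≠ q := by grind
  have nap : a ≠ p := by grind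
  have nbp : b ≠ p := by grind
  have npq : p ≠ q := by grind
  clear nd
  -- the good edges
  have gsa : ∀ z', K.Q m s a z' → PS u v e f z' := fun z' hz' => by
    rcases hK.nrm.only2 (X.sus.tr X.vam).p4132 (Y.fS.tr X.sfa.p1324).p1342 nvf hz' with h | h
    · exact .inr (.inl h)
    · exact .inr (.inr (.inr h))
  have gsb : ∀ z', K.Q m s b z' → PS u v e f z' := fun z' hz' => by
    rcases hK.nrm.only2 (X.sus.tr X.vmb).p3142 (Y.fS.tr X.sfb.p1324).p1342 nvf hz' with h | h
    · exact .inr (.inl h)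
    · exact .inr (.inr (.inr h))
  have gaq : ∀ z', K.Q m a q z' → PS u v e f z' := fun z' hz' => by
    rcases hK.nrm.only2 (Y.eS.tr Y.eam).p4312 (Y.fS.tr Y.faq).p1342 nef hz' with h | h
    · exact .inr (.inr (.inl h))
    · exact .inr (.inr (.inr h))
  have xu : x ≠ u := fun h => hx (.inl h)
  have yu : y ≠ u := fun h => hy (.inl h)
  have hxy : x ≠ y := h.2.2.2.1
  have hxm : m ≠ x := h.1
  have hym : m ≠ y := h.2.1
  rcases hz with rfl | rfl | rfl | rfl
  · exfalso
    have key : ∀ w, K.T z m w → ¬ PS z v e f w → w = a ∨ w = b := by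
      intro w hw hS
      rcases X.all w hw.e13 with h | h | h | h | h | h | h | h | h
      · exact absurd (.inr (.inl h)) hS
      · exact absurd (.inr (.inr (.inl h))) hS
      · exact absurd (.inr (.inr (.inr h))) hS
      · subst h
        have := X.sn m hw.s23
        have h1 : m ≠ a := X.vam.2.2.2.2.2.1.symm
        have h2 : m ≠ e := Y.eam.2.2.2.2.1.symm
        have h3 : m ≠ f := Y.fS.sv.1
        tauto
      · exact .inl h
      · exact absurd h.symm hw.2.2.1
      · exact .inr h
      · subst h; exact absurd hw Y.nmp
      · subst h; exact absurd hw Y.nmq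
    have kx := key x h.p4123.t hx
    have ky := key y h.p4132.t hy
    have hab : K.Q z m a b := by
      rcases kx with rfl | rfl <;> rcases ky with rfl | rfl
      · exact absurd rfl hxy
      · exact h.p4123
      · exact h.p4132
      · exact absurd rfl hxy
    exact hK.nrm.only3 X.vam.p1432 Y.eam.p1432 hab nve nvb neb
  · right
    have mC : m ∈ K.N2 u z := (X.sus.Cu m).mp X.vmb.t
    have k1 : ∀ w, w ∈ K.N2 u z → K.T z m w → w = a ∨ w = b := fun w hw hT =>
      hK.nrm.only2 X.vam.s34 X.vmb nab (X.sus.qu m w mC hw hT)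
    have nQ : ¬ K.Q u z a b := fun h' =>
      hK.nrm.only3 X.vam X.vqa.s34 h' nmq nmb nqb
    have k2 : ∀ w, w ≠ u → K.T z m w → w = s ∨ w = a ∨ w = b := by
      intro w hw hT
      rcases X.sus.nb w hT.e13 with h | h | h
      · exact absurd h hw
      · exact .inl h
      · exact .inr (k1 w h hT)
    have aC : a ∈ K.N2 u z := (X.sus.Cu a).mp X.vam.t
    have bC : b ∈ K.N2 u z := (X.sus.Cu b).mp X.vbp.t
    rcases k2 x xu h.p4123.t with h1 | h1 | h1 <;> rcases k2 y yu h.p4132.t with h2 | h2 | h2 <;>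
      subst h1 <;> subst h2
    · exact absurd rfl hxy
    · exact gsa
    · exact gsb
    · exact fun z' hz' => gsa z' hz'.s23
    · exact absurd rfl hxy
    · exact absurd (X.sus.qu _ _ aC bC h.p4231.t) nQ
    · exact fun z' hz' => gsb z' hz'.s23
    · exact absurd (X.sus.qu _ _ aC bC h.p4321.t) nQ
    · exact absurd rfl hxy
  · have mC : m ∈ K.N2 u z := (Y.eS.Cu m).mp Y.emb.t
    have k1 : ∀ w, w ∈ K.N2 u z → K.T z m w → w = a ∨ w = b := fun w hw hT =>
      hK.nrm.only2 Y.eam.s34 Y.emb nab (Y.eS.qu m w mC hw hT)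
    have nQ : ¬ K.Q u z a b := fun h' =>
      hK.nrm.only3 Y.eam X.sea.p1342 h' nsm.symm nmb nsb
    have k2 : ∀ w, w ≠ u → K.T z m w → w = q ∨ w = a ∨ w = b := by
      intro w hw hT
      rcases Y.eS.nb w hT.e13 with h | h | h
      · exact absurd h hw
      · exact .inl h
      · exact .inr (k1 w h hT)
    have aC : a ∈ K.N2 u z := (Y.eS.Cu a).mp Y.eam.t
    have bC : b ∈ K.N2 u z := (Y.eS.Cu b).mp X.seb.p1342.t
    rcases k2 x xu h.p4123.t with h1 | h1 | h1 <;> rcases k2 y yu h.p4132.t with h2 | h2 | h2 <;>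
      subst h1 <;> subst h2
    · exact absurd rfl hxy
    · exact .inr (fun z' hz' => gaq z' hz'.s23)
    · simp
    · exact .inr gaq
    · exact absurd rfl hxy
    · exact absurd (Y.eS.qu _ _ aC bC h.p4231.t) nQ
    · simp
    · exact absurd (Y.eS.qu _ _ aC bC h.p4321.t) nQ
    · exact absurd rfl hxy
  · have xC : x ∈ K.N2 u z := (Y.fS.Cs x).mp h.p1423.t
    have yC : y ∈ K.N2 u z := (Y.fS.Cs y).mp h.p1432.t
    have hQ : K.Q u z x y := Y.fS.qu x y xC yC h.p4231.t
    rcases Y.fN x hQ.t with h1 | h1 | h1 | h1 | h1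
    · subst h1
      rcases hK.nrm.only2 X.sfa.p1324 X.sfb.p1324 nab hQ with h2 | h2 <;> subst h2
      · exact .inr gsa
      · exact .inr gsb
    · subst h1
      rcases hK.nrm.only2 X.sfa.p1342 Y.faq nsq hQ with h2 | h2 <;> subst h2
      · exact .inr (fun z' hz' => gsa z' hz'.s23)
      · exact .inr gaq
    · subst h1
      rcases hK.nrm.only2 X.sfb.p1342 Y.fpb.s34 nsp hQ with h2 | h2 <;> subst h2
      · exact .inr (fun z' hz' => gsb z' hz'.s23)
      · simp
    · subst h1
      rcases hK.nrm.only2 Y.faq.s34 Y.fqp nap hQ with h2 | h2 <;> subst h2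
      · exact .inr (fun z' hz' => gaq z' hz'.s23)
      · simp
    · subst h1
      rcases hK.nrm.only2 Y.fqp.s34 Y.fpb nqb hQ with h2 | h2 <;> subst h2
      · simp
      · simp

theorem XX.gEdge (Y : XX K u v e f s a m b p q) {x y : ℕ} (hx : x = b ∨ x = p ∨ x = q)
    (hy : y = b ∨ y = p ∨ y = q) (hxy : x ≠ y) :
    ∃ g, PS u v e f g ∧ K.Q m x y g ∧ ∀ z, PS u v e f z → K.Q m x y z → z = g := by
  have X := Y.X
  have hK := X.ctx.good
  have nd := X.nd
  unfold Nd at nd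
  have nsp : s ≠ p := by grind
  have nsq : s ≠ q := by grind
  have npq : p ≠ q := by grind
  have hpe : p ≠ s ∧ p ≠ a ∧ p ≠ b ∧ p ≠ m ∧ p ≠ u := by grind
  clear nd
  have mC : m ∈ K.N2 u v := (X.sus.Cu m).mp X.vmb.t
  have pC : p ∈ K.N2 u v := (X.sus.Cu p).mp X.vpq.t
  have qC : q ∈ K.N2 u v := (X.sus.Cu q).mp X.vqa.t
  have hvp : ¬ K.T v m p := fun h => Y.nmp (X.sus.qu m p mC pC h).p1342.t
  have hvq : ¬ K.T v m q := fun h => Y.nmq (X.sus.qu m q mC qC h).p1342.t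
  have hep : ¬ K.E e p := fun h => by
    rcases Y.eS.nb p h with h | h | h
    · exact hpe.2.2.2.2 h
    · exact npq h
    · rcases Y.eN p ((Y.eS.Cu p).mpr h) with h | h | h | h
      · exact hpe.1 h
      · exact hpe.2.1 h
      · exact hpe.2.2.1 h
      · exact hpe.2.2.2.1 h
  have bp : ∃ g, PS u v e f g ∧ K.Q m b p g ∧ ∀ z, PS u v e f z → K.Q m b p z → z = g := by
    refine ⟨f, .inr (.inr (.inr rfl)), (Y.fS.tr Y.fpb).p1432, ?_⟩
    rintro z (rfl | rfl | rfl | rfl) hz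
    · exact absurd hz.p4132.t Y.nmp
    · exact absurd hz.p4132.t hvp
    · exact absurd hz.p4312.t.e hep
    · rfl
  have pq : ∃ g, PS u v e f g ∧ K.Q m p q g ∧ ∀ z, PS u v e f z → K.Q m p q z → z = g := by
    refine ⟨f, .inr (.inr (.inr rfl)), (Y.fS.tr Y.fqp).p1432, ?_⟩
    rintro z (rfl | rfl | rfl | rfl) hz
    · exact absurd hz.p4123.t Y.nmp
    · exact absurd hz.p4123.t hvp
    · exact absurd hz.p4213.t.e hep
    · rfl
  have bq : ∃ g, PS u v e f g ∧ K.Q m b q g ∧ ∀ z, PS u v e f z → K.Q m b q z → z = g := by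
    refine ⟨e, .inr (.inr (.inl rfl)), (Y.eS.tr Y.emb).p3412, ?_⟩
    rintro z (rfl | rfl | rfl | rfl) hz
    · exact absurd hz.p4132.t Y.nmq
    · exact absurd hz.p4132.t hvq
    · rfl
    · exfalso
      have hb : b ∈ K.N2 u z := (Y.fS.Cu b).mp X.sfb.p1342.t
      have hq : q ∈ K.N2 u z := (Y.fS.Cu q).mp Y.fqp.t
      exact hK.nrm.only3 X.sfb.p1342 Y.fpb.s34 (Y.fS.qu b q hb hq hz.p4231.t) nsp nsq npq
  have sw : ∀ {x y}, (∃ g, PS u v e f g ∧ K.Q m x y g ∧ ∀ z, PS u v e f z → K.Q m x y z → z = g) →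
      ∃ g, PS u v e f g ∧ K.Q m y x g ∧ ∀ z, PS u v e f z → K.Q m y x z → z = g := by
    rintro x y ⟨g, h1, h2, h3⟩
    exact ⟨g, h1, h2.s23, fun z hz hq => h3 z hz hq.s23⟩
  rcases hx with rfl | rfl | rfl <;> rcases hy with rfl | rfl | rfl
  · exact absurd rfl hxy
  · exact bp
  · exact bq
  · exact sw bp
  · exact absurd rfl hxy
  · exact pq
  · exact sw bq
  · exact sw pq
  · exact absurd rfl hxy

theorem XX.cut (Y : XX K u v e f s a m b p q) :
    CutData K m {b, p, q} (fun S => ∃ x ∈ S, PS u v e f x) := by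
  have X := Y.X
  have hK := X.ctx.good
  have nd := X.nd
  unfold Nd at nd
  have nbp : b ≠ p := by grind
  have nbq : b ≠ q := by grind
  have npq : p ≠ q := by grind
  have hm : m ≠ b ∧ m ≠ p ∧ m ≠ q := by grind
  have gS : ∀ x, (x = b ∨ x = p ∨ x = q) → ¬ PS u v e f x := by
    intro x hx
    unfold PS
    grind
  clear nd
  have Qf1 := (Y.fS.tr Y.fpb)
  have Qf2 := (Y.fS.tr Y.fqp)
  have Qe := (Y.eS.tr Y.emb)
  refine ⟨hK.nrm, card3 nbp nbq npq, by simpa using hm, ?_, ?_, ?_⟩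
  · intro d hd hd2
    rcases (card2_sub_iff nbp nbq npq d).mp ⟨hd2, hd⟩ with rfl | rfl | rfl
    · exact Qf1.p1432.t.mem
    · exact Qf2.p1432.t.mem
    · exact Qe.p3412.t.mem
  · intro hg
    have Tg : K.T b p q := ⟨nbp, nbq, npq, hg⟩
    have hQ := hK.fill Qf1.p1432.t Qe.p3412.t Qf2.p1432.t Tg
    exact hK.noDeg3 Qf1.p1342 Qf2.p1423 hQ.p1342
  · intro T1 T2 c1 w1 f1 c2 w2 f2 hI
    obtain ⟨x, y, hxy, hxyI⟩ := Finset.card_eq_two.mp hI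
    have dec : ∀ S : Finset ℕ, S.card = 3 → {x, y} ⊆ S → ∃ z, S = {x, y, z} ∧ z ≠ x ∧ z ≠ y := by
      intro S hS hsub
      have : (S \ {x, y}).card = 1 := by
        rw [Finset.card_sdiff_of_subset hsub, hS, Finset.card_pair hxy]
      obtain ⟨z, hz⟩ := Finset.card_eq_one.mp this
      have hz' : z ∈ S \ {x, y} := by rw [hz]; simp
      simp only [Finset.mem_sdiff, Finset.mem_insert, Finset.mem_singleton, not_or] at hz'
      refine ⟨z, ?_, hz'.2⟩
      rw [← Finset.sdiff_union_of_subset hsub, hz]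
      ext w; simp only [Finset.mem_union, Finset.mem_insert, Finset.mem_singleton]; tauto
    have s1 : ({x, y} : Finset ℕ) ⊆ T1 := hxyI ▸ Finset.inter_subset_left
    have s2 : ({x, y} : Finset ℕ) ⊆ T2 := hxyI ▸ Finset.inter_subset_right
    obtain ⟨z, rfl, zx, zy⟩ := dec T1 c1 s1
    obtain ⟨z', rfl, zx', zy'⟩ := dec T2 c2 s2
    have hzz : z ≠ z' := by
      rintro rfl
      rw [Finset.inter_self] at hI
      omega
    simp only [Finset.mem_insert, Finset.mem_singleton, not_or] at w1 w2
    have Q1 : K.Q m x y z := ⟨w1.1, w1.2.1, w1.2.2, hxy, zx.symm, zy.symm, f1⟩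
    have Q2 : K.Q m x y z' := ⟨w2.1, w2.2.1, w2.2.2, hxy, zx'.symm, zy'.symm, f2⟩
    have hsub : ({x, y, z} ∩ {x, y, z'} : Finset ℕ) ⊆ {b, p, q} ↔
        (x = b ∨ x = p ∨ x = q) ∧ (y = b ∨ y = p ∨ y = q) := by
      rw [hxyI]
      simp [Finset.insert_subset_iff]
    rw [hsub]
    simp only [Finset.mem_insert, Finset.mem_singleton, exists_eq_or_imp, exists_eq_left]
    by_cases hg : (x = b ∨ x = p ∨ x = q) ∧ (y = b ∨ y = p ∨ y = q)
    · have hxS := gS x hg.1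
      have hyS := gS y hg.2
      obtain ⟨g, g1, g2, g3⟩ := Y.gEdge hg.1 hg.2 hxy
      have h1 := g3 z
      have h2 := g3 z'
      rcases hK.nrm.only2 Q1 Q2 hzz g2 with h | h
      · subst h
        have : ¬ PS u v e f z' := fun h => hzz (h2 h Q2).symm
        simp only [hxS, hyS, false_or, this, g1, hg]
        simp
      · subst h
        have : ¬ PS u v e f z := fun h => hzz (h1 h Q1)
        simp only [hxS, hyS, false_or, this, g1, hg]
        simp
    · simp only [hg, not_false_eq_true, iff_true]
      by_cases hxS : PS u v e f x
      · simp [hxS]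
      by_cases hyS : PS u v e f y
      · simp [hyS]
      simp only [hxS, hyS, false_or]
      constructor
      · intro h
        exact ((Y.xEdge h hxS hyS Q1).resolve_left hg) _ Q2
      · intro h
        exact ((Y.xEdge h hxS hyS Q2).resolve_left hg) _ Q1

theorem Beta.x13 (X : Beta K u v e f s a m b p q) (h1 : K.B1 u e s a m b p q)
    (h3 : K.B3 u f s a m b p q) : False := by
  obtain ⟨eam, emb, eN, he⟩ := h1
  obtain ⟨faq, fqp, fpb, fN, nmp, nmq, fS⟩ := h3
  rcases he with ⟨-, he⟩ | ⟨-, he⟩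
  · refine cut_false X.ctx.good.inR (XX.cut (u := u) (v := v) (e := e) (f := f) (s := s) (a := b)
      (m := m) (b := a) (p := q) (q := p)
      ⟨X.mirror, emb.s34, eam.s34, fun x hx => ?_, he, fpb.s34, fqp.s34, faq.s34, nmq, nmp, fS,
        fun x hx => ?_⟩)
    · rcases eN x hx with h | h | h | h <;> simp [h]
    · rcases fN x hx with h | h | h | h | h <;> simp [h]
  · exact cut_false X.ctx.good.inR (XX.cut (u := u) (v := v) (e := e) (f := f) (s := s) (a := a)
      (m := m) (b := b) (p := p) (q := q)
      ⟨X, eam, emb, eN, he, faq, fqp, fpb, nmp, nmq, fS, fN⟩)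

theorem Beta.false (X : Beta K u v e f s a m b p q) : False := by
  rcases X.pairs with ⟨h1, h3⟩ | ⟨h3, h1⟩
  · exact X.x13 h1 h3
  · exact X.swap.x13 h1 h3

end CaseX
end ModM

section ModN
section Fin
variable {K : SComplex}

theorem Ctx.beta {u : ℕ} (hc : Ctx K u) (h9 : (K.N1 u).card = 9) (h3 : (K.IS u).card = 3)
    {v : ℕ} (hv : K.II u v) (h7 : (K.N1 v).card = 7) : False := by
  have hK := hc.good
  obtain ⟨s, hs, -, -, -, hC⟩ := hK.getSus hv
  have hC := hC h7
  have H := (hc.count hv hs (by omega) (by omega)).2 (by omega)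
  obtain ⟨a, b, e, f, hab, hef, ha, hb, he, hf, hea, heb, hfa, hfb, hS⟩ := hc.four hs (by omega) H
  have cov : ∀ x y, K.II u x → K.T u x y → y = s ∨ y ∈ K.N2 u v := fun x y hx h => hc.cov H hx h
  have hve : v ≠ e := by rintro rfl; exact hs.nt hea.p1324.t
  have hvf : v ≠ f := by rintro rfl; exact hs.nt hfa.p1324.t
  have hI : ∀ x, K.II u x → x = v ∨ x = e ∨ x = f := by
    have hE : ({v, e, f} : Finset ℕ) = K.IS u := by
      apply Finset.eq_of_subset_of_card_le
      · intro x; simp only [Finset.mem_insert, Finset.mem_singleton, mIS]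
        rintro (rfl | rfl | rfl) <;> assumption
      · rw [h3, card3 hve hvf hef]
    intro x hx
    rw [← mIS, ← hE] at hx
    simpa using hx
  have nQ : ¬ K.Q u v a b := hs.q1 hK hea.s34.t heb.s34.t
  have vC : ∀ x, K.T u v x ↔ x ∈ K.N2 u v := fun x => hs.Cu x
  set C := K.N2 u v with hCdef
  -- the two neighbours of `a` and of `b` in the cycle
  obtain ⟨a1, a2, ha12, ha1, ha2, haN⟩ := hK.nrm.twoT ((vC a).mpr ha)
  obtain ⟨b1, b2, hb12, hb1, hb2, hbN⟩ := hK.nrm.twoT ((vC b).mpr hb)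
  have inC : ∀ {x y}, K.Q u v x y → y ∈ C := fun h => (vC _).mp h.s34.t
  have hne : ∀ {x y}, K.Q u v x y → x ≠ y := fun h => h.2.2.2.2.2.1
  have nea : ∀ {x}, K.Q u v a x → x ≠ b := fun h h' => nQ (h' ▸ h)
  have neb : ∀ {x}, K.Q u v b x → x ≠ a := fun h h' => nQ (h' ▸ h).s34
  have hcard3 : (C \ {a, b}).card = 3 := by
    rw [Finset.card_sdiff_of_subset (by
      intro w; simp only [Finset.mem_insert, Finset.mem_singleton]
      rintro (rfl | rfl) <;> assumption), Finset.card_pair hab]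
    omega
  have mem3 : ∀ x, x ∈ C → x ≠ a → x ≠ b → x ∈ C \ {a, b} := by
    intro x h1 h2 h3; simp [h1, h2, h3]
  -- a common neighbour
  have core : ∀ m q p, K.Q u v a m → K.Q u v a q → m ≠ q → K.Q u v b m → K.Q u v b p → m ≠ p →
      False := by
    intro m q p am aq hmq bm bp hmp
    have nqm : ∀ x, K.Q u v m x → x = a ∨ x = b := fun x hx =>
      hK.nrm.only2 am.s34 bm.s34 hab hx
    have naN : ∀ x, K.Q u v a x → x = m ∨ x = q := fun x hx => hK.nrm.only2 am aq hmq hx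
    have nbN : ∀ x, K.Q u v b x → x = m ∨ x = p := fun x hx => hK.nrm.only2 bm bp hmp hx
    have hpq : p ≠ q := by
      rintro rfl
      -- the remaining vertex `z`
      obtain ⟨z, hz, hz'⟩ : ∃ z ∈ C, z ∉ ({a, b, m, p} : Finset ℕ) :=
        exists_mem_notMem_of_card (by rw [hC]; exact Nat.lt_succ_of_le Finset.card_le_four)
      simp only [Finset.mem_insert, Finset.mem_singleton, not_or] at hz'
      have npN : ∀ x, K.Q u v p x → x = a ∨ x = b := fun x hx =>
        hK.nrm.only2 aq.s34 bp.s34 hab hx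
      have h5 : ({a, b, m, p, z} : Finset ℕ) = C := by
        apply Finset.eq_of_subset_of_card_le
        · intro x; simp only [Finset.mem_insert, Finset.mem_singleton]
          rintro (rfl | rfl | rfl | rfl | rfl)
          · exact ha
          · exact hb
          · exact inC am
          · exact inC aq
          · exact hz
        · have h1 := hne am
          have h2 := hne aq
          have h3 := hne bm
          have h4 := hne bp
          rw [hC, Finset.card_insert_of_notMem (by simp; grind),
            Finset.card_insert_of_notMem (by simp; grind),
            Finset.card_insert_of_notMem (by simp; grind),
            Finset.card_pair (by grind)]
      obtain ⟨x, -, -, hx, -⟩ := hK.nrm.twoT ((vC z).mpr hz)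
      have hxC := inC hx
      rw [← h5] at hxC
      simp only [Finset.mem_insert, Finset.mem_singleton] at hxC
      rcases hxC with h | h | h | h | h
      · subst h
        rcases naN z hx.s34 with h | h
        · exact hz'.2.2.1 h
        · exact hz'.2.2.2 h
      · subst h
        rcases nbN z hx.s34 with h | h
        · exact hz'.2.2.1 h
        · exact hz'.2.2.2 h
      · subst h
        rcases nqm z hx.s34 with h | h
        · exact hz'.1 h
        · exact hz'.2.1 h
      · subst h
        rcases npN z hx.s34 with h | h
        · exact hz'.1 h
        · exact hz'.2.1 h
      · exact hne hx h.symm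
    have d1 := hne am
    have d2 := hne aq
    have d3 := hne bm
    have d4 := hne bp
    have d5 : q ≠ b := nea aq
    have d6 : p ≠ a := neb bp
    have h5 : ({a, m, b, p, q} : Finset ℕ) = C := by
      apply Finset.eq_of_subset_of_card_le
      · intro x; simp only [Finset.mem_insert, Finset.mem_singleton]
        rintro (rfl | rfl | rfl | rfl | rfl)
        · exact ha
        · exact inC am
        · exact hb
        · exact inC bp
        · exact inC aq
      · rw [hC, Finset.card_insert_of_notMem (by simp; grind),
          Finset.card_insert_of_notMem (by simp; grind),
          Finset.card_insert_of_notMem (by simp; grind),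
          Finset.card_pair (by grind)]
    have hCm : ∀ x, x ∈ C → x = a ∨ x = m ∨ x = b ∨ x = p ∨ x = q := by
      intro x hx
      rw [← h5] at hx
      simpa using hx
    have pq : K.Q u v p q := by
      have key : ∀ x, K.Q u v p x → x = b ∨ x = q := by
        intro x hx
        rcases hCm x (inC hx) with h | h | h | h | h
        · subst h
          rcases naN p hx.s34 with h | h
          · exact absurd h.symm hmp
          · exact absurd h hpq
        · subst h
          rcases nqm p hx.s34 with h | h
          · exact absurd h d6
          · exact absurd h d4.symm
        · exact .inl h
        · exact absurd h.symm (hne hx)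
        · exact .inr h
      obtain ⟨x, y, hxy, hx, hy, -⟩ := hK.nrm.twoT ((vC p).mpr (inC bp))
      rcases key x hx with rfl | rfl
      · rcases key y hy with rfl | rfl
        · exact absurd rfl hxy
        · exact hy
      · exact hx
    have sC : ∀ x, x ∈ C → s ≠ x := by rintro x hx rfl; exact hs.nt ((vC s).mpr hx)
    have iC : ∀ i, K.II u i → ∀ x, x ∈ C → i ≠ x := by
      rintro i hi x hx rfl; exact hc.indep hv hi ((vC _).mpr hx)
    have uC : ∀ x, x ∈ C → u ≠ x := fun x hx => ((vC x).mpr hx).2.1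
    have cov' : ∀ i, K.II u i → ∀ x, K.T u i x →
        x = s ∨ x = a ∨ x = m ∨ x = b ∨ x = p ∨ x = q := by
      intro i hi x hx
      rcases cov i x hi hx with h | h
      · exact .inl h
      · exact .inr (hCm x h)
    have mC := inC am
    have pC := inC bp
    have qC := inC aq
    refine Beta.false (K := K) (u := u) (v := v) (e := e) (f := f) (s := s) (a := a) (m := m)
      (b := b) (p := p) (q := q)
      { ctx := hc, n9 := h9, sus := hs, vI := hv, eI := he, fI := hf, vam := am, vmb := bm.s34
        vbp := bp, vpq := pq, vqa := aq.s34, sea := hea, seb := heb, sfa := hfa, sfb := hfb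
        sn := hS, en := cov' e he, fn := cov' f hf
        vn := fun x hx => hCm x ((vC x).mp hx)
        all := ?_, nd := ?_ }
    · exact ⟨hv.1.1, he.1.1, hf.1.1, hs.us.1, uC a ha, uC m mC, uC b hb, uC p pC, uC q qC,
        hve, hvf, hs.sv.1.symm, iC v hv a ha, iC v hv m mC, iC v hv b hb, iC v hv p pC, iC v hv q qC,
        hef, hea.2.2.2.1.symm, iC e he a ha, iC e he m mC, iC e he b hb, iC e he p pC, iC e he q qC,
        hfa.2.2.2.1.symm, iC f hf a ha, iC f hf m mC, iC f hf b hb, iC f hf p pC, iC f hf q qC,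
        sC a ha, sC m mC, sC b hb, sC p pC, sC q qC, d1, hab, d6.symm, d2, d3.symm, hmp, hmq, d4,
        d5.symm, hpq⟩
    · intro x hx
      rcases H x hx with h | h | h
      · exact .inr (.inr (.inr (.inl h)))
      · exact .inr (.inr (.inr (.inr (hCm x h))))
      · rcases hI x h with h | h | h
        · exact .inl h
        · exact .inr (.inl h)
        · exact .inr (.inr (.inl h))
  by_cases e1 : a1 = b1
  · subst e1; exact core _ _ _ ha1 ha2 ha12 hb1 hb2 hb12
  by_cases e2 : a1 = b2
  · subst e2; exact core _ _ _ ha1 ha2 ha12 hb2 hb1 hb12.symm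
  by_cases e3 : a2 = b1
  · subst e3; exact core _ _ _ ha2 ha1 ha12.symm hb1 hb2 hb12
  by_cases e4 : a2 = b2
  · subst e4; exact core _ _ _ ha2 ha1 ha12.symm hb2 hb1 hb12.symm
  have hsub : ({a1, a2, b1, b2} : Finset ℕ) ⊆ C \ {a, b} := by
    intro x; simp only [Finset.mem_insert, Finset.mem_singleton]
    rintro (rfl | rfl | rfl | rfl)
    · exact mem3 _ (inC ha1) (hne ha1).symm (nea ha1)
    · exact mem3 _ (inC ha2) (hne ha2).symm (nea ha2)
    · exact mem3 _ (inC hb1) (neb hb1) (hne hb1).symm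
    · exact mem3 _ (inC hb2) (neb hb2) (hne hb2).symm
  have := Finset.card_le_card hsub
  rw [Finset.card_insert_of_notMem (by simp; grind), Finset.card_insert_of_notMem (by simp; grind),
    Finset.card_pair hb12] at this
  omega

end Fin
end ModN

section ModO
section Final
variable {K : SComplex}

theorem fin_ctx {t u : ℕ} (hK : InClassR K) (ht : K.DistinguishedSingular t)
    (hu : ({u} : Finset ℕ) ∈ K.faces) (hust : ({u} : Finset ℕ) ∉ (K.st {t}).faces) : Ctx K u := by
  refine ⟨⟨hK, t, ht.2.2⟩, ?_⟩
  intro s hs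
  by_contra hcon
  push Not at hcon
  have hut : u ≠ t := by
    rintro rfl
    exact hust (by simp [st, hu])
  have hst : s ≠ t := by
    rintro rfl
    apply hust
    simp only [st, Finset.mem_filter]
    exact ⟨hu, by simpa [Finset.singleton_union] using hs.2⟩
  have hsm : ({s} : Finset ℕ) ∈ K.faces :=
    K.down_closed _ hs.2 _ (by simp) (by simp)
  have hfin : {v | K.IsSingular v}.Finite :=
    (K.vertexSet.finite_toSet).subset (fun v hv => mem_vertexSet.mpr hv.1)
  have hsub : ((({t, u, s} : Finset ℕ)) : Set ℕ) ⊆ {v | K.IsSingular v} := by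
    intro x hx
    simp only [Finset.coe_insert, Finset.coe_singleton, Set.mem_insert_iff,
      Set.mem_singleton_iff] at hx
    rcases hx with rfl | rfl | rfl
    · exact ht.1
    · exact ⟨hu, hcon.1⟩
    · exact ⟨hsm, hcon.2⟩
  have h1 := Set.ncard_le_ncard hsub hfin
  rw [Set.ncard_coe_finset, Finset.card_eq_three.mpr ⟨t, u, s, hut.symm, hst.symm, hs.1, rfl⟩] at h1
  have := hK.2.2.1
  omega

theorem Good.exE (hK : Good K) {u : ℕ} (hu : ({u} : Finset ℕ) ∈ K.faces) : ∃ x, K.E u x := by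
  obtain ⟨F, hF, hs, h4⟩ := hK.nrm.pure _ hu
  have : ∃ x ∈ F, x ≠ u := by
    by_contra hcon
    push Not at hcon
    have : F ⊆ {u} := fun x hx => by simpa using hcon x hx
    have := Finset.card_le_card this
    simp at this; omega
  obtain ⟨x, hx, hxu⟩ := this
  refine ⟨x, hxu.symm, K.down_closed _ hF _ ?_ (by simp)⟩
  intro y hy
  simp only [Finset.mem_insert, Finset.mem_singleton] at hy
  rcases hy with rfl | rfl
  · exact hs (by simp)
  · exact hx

theorem lam_out {t u : ℕ} (hust : ({u} : Finset ℕ) ∉ (K.st {t}).faces) (v : ℕ) :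
    K.lam t u v = if 9 ≤ (K.N1 u).card ∧ (K.N1 v).card ≤ 8 then 1 - lamAux K v u
      else lamAux K u v := by
  unfold lam N1
  rw [if_neg (fun h => hust h.1), fnum_zero, fnum_zero]

theorem lamAux_eq (u v : ℕ) : lamAux K u v = if (K.N1 u).card = 6 then 2/3
    else if (K.N1 u).card = 7 ∧ (K.N2 u v).card = 5 then 3/4 else 1/2 := by
  unfold lamAux N1 N2
  simp only [fnum_zero]
  split_ifs <;> norm_num

theorem arith9 (n i a b : ℕ) (hn : 9 ≤ n) (hi : a + b = i)
    (h0 : b = 0 → a + 5 ≤ n ∨ a = 0) (h1 : 0 < b → i + 6 ≤ n)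
    (h2 : n = 9 → b = 0 → a ≠ 4) (h3 : n = 9 → 0 < b → i ≠ 3) : 2 * a + 3 * b + 48 ≤ 6 * n := by
  rcases Nat.eq_zero_or_pos b with hb | hb
  · have := h0 hb
    have := h2
    by_cases h : n = 9
    · have := h2 h hb; omega
    · omega
  · have := h1 hb
    by_cases h : n = 9
    · have := h3 h hb; omega
    · omega

theorem Ctx.weight {u : ℕ} (hc : Ctx K u) (h9 : 9 ≤ (K.N1 u).card) :
    2 * ((K.IS u).filter fun v => (K.N1 v).card = 6).card +
      3 * ((K.IS u).filter fun v => ¬ (K.N1 v).card = 6).card + 48 ≤ 6 * (K.N1 u).card := by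
  have hK := hc.good
  have hadd := Finset.card_filter_add_card_filter_not (s := K.IS u) (fun v => (K.N1 v).card = 6)
  refine arith9 _ (K.IS u).card _ _ h9 hadd ?_ ?_ ?_ ?_
  · intro hb
    rw [Finset.card_eq_zero] at hb
    rcases Finset.eq_empty_or_nonempty ((K.IS u).filter fun v => (K.N1 v).card = 6) with h | ⟨v, hv⟩
    · right; rw [h]; rfl
    · left
      rw [Finset.mem_filter, mIS] at hv
      obtain ⟨s, hs, h4, h5, h6, -⟩ := hK.getSus hv.1
      have h6 := h6 hv.2
      have := (hc.count hv.1 hs h5 h4).1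
      have hle := Finset.card_filter_le (K.IS u) (fun v => (K.N1 v).card = 6)
      omega
  · intro hb
    obtain ⟨v, hv⟩ := Finset.card_pos.mp hb
    rw [Finset.mem_filter, mIS] at hv
    obtain ⟨s, hs, h4, h5, -, h7⟩ := hK.getSus hv.1
    have h7 := h7 (hv.1.2.resolve_left hv.2).1
    have := (hc.count hv.1 hs h5 h4).1
    omega
  · intro hn hb ha
    rw [hb] at hadd
    rw [Finset.card_eq_zero] at hb
    refine hc.alpha hn (by omega) ?_
    intro v hv
    by_contra hcon
    have : v ∈ (K.IS u).filter fun v => ¬ (K.N1 v).card = 6 := by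
      rw [Finset.mem_filter, mIS]; exact ⟨hv, hcon⟩
    rw [hb] at this; simp at this
  · intro hn hb hi
    obtain ⟨v, hv⟩ := Finset.card_pos.mp hb
    rw [Finset.mem_filter, mIS] at hv
    exact hc.beta hn hi hv.1 (hv.1.2.resolve_left hv.2).1

theorem lam_big {t u : ℕ} (hust : ({u} : Finset ℕ) ∉ (K.st {t}).faces) (h9 : 9 ≤ (K.N1 u).card)
    {v : ℕ} (hv : v ∈ K.N1 u) :
    (1/2 : ℝ) - (if v ∈ (K.IS u).filter (fun v => (K.N1 v).card = 6) then 1/6 else 0)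
      - (if v ∈ (K.IS u).filter (fun v => ¬ (K.N1 v).card = 6) then 1/4 else 0) = K.lam t u v := by
  rw [lam_out hust, lamAux_eq, lamAux_eq]
  have hE := mN1.mp hv
  have h6 : ¬ (K.N1 u).card = 6 := by omega
  have h7 : ¬ (K.N1 u).card = 7 := by omega
  simp only [Finset.mem_filter, mIS, II, hE, true_and, h9, h6, h7, false_and, if_false]
  by_cases c6 : (K.N1 v).card = 6
  · simp [c6]; norm_num
  · by_cases c7 : (K.N1 v).card = 7 ∧ (K.N2 v u).card = 5
    · have c8 : (K.N1 v).card ≤ 8 := by omega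
      simp [c6, c7]; norm_num
    · simp only [c6, c7]; norm_num

theorem final_bound {t u : ℕ} (hK : InClassR K) (ht : K.DistinguishedSingular t)
    (hu : ({u} : Finset ℕ) ∈ K.faces) (hust : ({u} : Finset ℕ) ∉ (K.st {t}).faces) :
    (4 : ℝ) ≤ ∑ v ∈ K.N1 u, K.lam t u v := by
  have hc := fin_ctx hK ht hu hust
  have hG := hc.good
  obtain ⟨x, hx⟩ := hG.exE hu
  have h1 := hG.N2_ge hx
  have h2 := hG.N2_le hx
  by_cases h9 : 9 ≤ (K.N1 u).card
  · rw [← Finset.sum_congr rfl (fun v hv => lam_big hust h9 hv)]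
    rw [Finset.sum_sub_distrib, Finset.sum_sub_distrib, ← Finset.sum_filter, ← Finset.sum_filter]
    have hsub : K.IS u ⊆ K.N1 u := fun v hv => mN1.mpr (mIS.mp hv).1
    have e : ∀ p : ℕ → Prop, ∀ _ : DecidablePred p,
        (K.N1 u).filter (fun v => v ∈ (K.IS u).filter p) = (K.IS u).filter p := by
      intro p _
      ext v
      simp only [Finset.mem_filter]
      exact ⟨fun h => h.2, fun h => ⟨hsub h.1, h⟩⟩
    rw [e, e]
    simp only [Finset.sum_const, nsmul_eq_mul]
    have hw := hc.weight h9
    have hw' : (2 * (((K.IS u).filter fun v => (K.N1 v).card = 6).card : ℝ) +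
      3 * (((K.IS u).filter fun v => ¬ (K.N1 v).card = 6).card : ℝ) + 48) ≤
        6 * ((K.N1 u).card : ℝ) := by exact_mod_cast hw
    linarith
  · have hl : ∀ v, K.lam t u v = lamAux K u v := fun v => by
      rw [lam_out hust, if_neg (fun h => h9 h.1)]
    simp only [hl, lamAux_eq]
    have : (K.N1 u).card = 6 ∨ (K.N1 u).card = 7 ∨ (K.N1 u).card = 8 := by omega
    rcases this with h | h | h
    · simp [h]; norm_num
    · obtain ⟨-, h5⟩ := hG.sum7 h
      have hadd := Finset.card_filter_add_card_filter_not (s := K.N1 u)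
        (fun x => (K.N2 u x).card = 5)
      have h6 : ((K.N1 u).filter fun x => ¬ (K.N2 u x).card = 5).card = 5 := by omega
      simp only [h, true_and]
      norm_num
      rw [Finset.sum_ite, Finset.sum_const, Finset.sum_const, h5, h6]
      norm_num
    · simp [h]; norm_num

end Final
end ModO

/-- Lemma 3.13: every vertex outside `st(t)` has weight at least 4. -/
theorem statement11 (K : SComplex) (t u : ℕ) (hK : InClassR K)
    (ht : K.DistinguishedSingular t)
    (hu : ({u} : Finset ℕ) ∈ K.faces)
    (hust : ({u} : Finset ℕ) ∉ (K.st {t}).faces) :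
    (4 : ℝ) ≤ ∑ v ∈ (K.lk {u}).vertexSet, K.lam t u v := by
  exact final_bound hK ht hu hust

end SComplex
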